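/- The book thickness of every k-map graph is at most 6k + 5. -/

import Mathlib

open SimpleGraph

/-- A book embedding of `G` on `p` pages with respect to the linear order on the vertices
given by the injection `ord : V ↪ ℕ`: a symmetric page assignment of the edges to pages
`0, …, p-1` such that no two edges on the same page cross. -/
def IsBookEmbedding {V : Type*} (G : SimpleGraph V) (p : ℕ)
    (ord : V ↪ ℕ) (page : V → V → ℕ) : Prop :=
  (∀ a b, page a b = page b a) ∧
  (∀ a b, G.Adj a b → page a b < p) ∧
  (∀ a b c d, G.Adj a b → G.Adj c d → page a b = page c d →
    ¬ (ord a < ord c ∧ ord c < ord b ∧ ord b < ord d))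

/-- The book thickness of `G`: the least number of pages over all book embeddings. -/
noncomputable def bookThickness {V : Type*} (G : SimpleGraph V) : ℕ :=
  sInf {p | ∃ ord page, IsBookEmbedding G p ord page}

/-- A straight-line plane drawing of a (finite simple) graph: vertices go to distinct points
of the plane and the closed segments representing distinct edges meet only at shared
endpoints.  By Fáry's theorem, a finite simple graph is planar iff it has such a drawing. -/
def IsPlaneDrawing {V : Type*} (G : SimpleGraph V) (pos : V → ℝ × ℝ) : Prop :=
  Function.Injective pos ∧
  (∀ a b c d : V, G.Adj a b → G.Adj c d → a ≠ c → a ≠ d → b ≠ c → b ≠ d →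
    segment ℝ (pos a) (pos b) ∩ segment ℝ (pos c) (pos d) = ∅) ∧
  (∀ a b c : V, G.Adj a b → G.Adj a c → b ≠ c →
    segment ℝ (pos a) (pos b) ∩ segment ℝ (pos a) (pos c) = {pos a}) ∧
  (∀ a b v : V, G.Adj a b → v ≠ a → v ≠ b → pos v ∉ segment ℝ (pos a) (pos b))

/-- A graph is planar if it admits a plane (straight-line) drawing. -/
def IsPlanarG {V : Type*} (G : SimpleGraph V) : Prop :=
  ∃ pos : V → ℝ × ℝ, IsPlaneDrawing G pos

/-- A graph is outerplanar if it admits a plane drawing in which every vertex lies on the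
outer face, i.e. every vertex point is an extreme point of the drawing (it is not in the
convex hull of the other vertex points). -/
def IsOuterplanarG {V : Type*} (G : SimpleGraph V) : Prop :=
  ∃ pos : V → ℝ × ℝ, IsPlaneDrawing G pos ∧
    ∀ v : V, pos v ∉ convexHull ℝ (pos '' {w | w ≠ v})

/-- A `k`-map graph, via the standard witness characterization: `G` is the "half-square" of
a planar bipartite graph `H` on `V ⊕ P` (vertices and intersection points), in which every
point `p : P` is incident to at most `k` nations, and two distinct vertices of `G` are
adjacent iff their nations meet at a common point. -/
def IsKMapGraph {V : Type*} (G : SimpleGraph V) (k : ℕ) : Prop :=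
  ∃ (P : Type) (_ : Fintype P) (H : SimpleGraph (V ⊕ P)),
    IsPlanarG H ∧
    (∀ a b : V, ¬ H.Adj (Sum.inl a) (Sum.inl b)) ∧
    (∀ p q : P, ¬ H.Adj (Sum.inr p) (Sum.inr q)) ∧
    (∀ p : P, {v : V | H.Adj (Sum.inl v) (Sum.inr p)}.ncard ≤ k) ∧
    (∀ a b : V, G.Adj a b ↔
      a ≠ b ∧ ∃ p : P, H.Adj (Sum.inl a) (Sum.inr p) ∧ H.Adj (Sum.inl b) (Sum.inr p))

/-- The slope of the line through two points of a planar point set. -/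
noncomputable def slopeBetween {W : Type*} (X Y : W → ℝ) (a b : W) : ℝ :=
  (Y b - Y a) / (X b - X a)

/-- The height at abscissa `x` of the line through two points of a planar point set. -/
noncomputable def heightOn {W : Type*} (X Y : W → ℝ) (a b : W) (x : ℝ) : ℝ :=
  Y a + slopeBetween X Y a b * (x - X a)

theorem slopeBetween_comm {W : Type*} (X Y : W → ℝ) (a b : W) :
    slopeBetween X Y a b = slopeBetween X Y b a := by
  unfold slopeBetween
  rw [← neg_sub (Y a) (Y b), ← neg_sub (X a) (X b), neg_div_neg_eq]

theorem heightOn_left {W : Type*} (X Y : W → ℝ) (a b : W) : heightOn X Y a b (X a) = Y a := by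
  simp [heightOn]

theorem heightOn_right {W : Type*} {X : W → ℝ} (Y : W → ℝ) {a b : W} (h : X a < X b) :
    heightOn X Y a b (X b) = Y b := by
  have : X b - X a ≠ 0 := by linarith
  unfold heightOn slopeBetween
  field_simp
  ring

theorem affine_neg_mid_iff_left {α β l r : ℝ} (hlr : l < r)
    (h : ∀ x, l < x → x < r → α + β * x ≠ 0) :
    α + β * ((l + r) / 2) < 0 ↔ α + β * l < 0 ∨ (α + β * l = 0 ∧ β < 0) := by
  have key : ∀ f : ℝ → ℝ, Continuous f → (∀ x, l < x → x < r → f x ≠ 0) →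
      f l < 0 → f ((l + r) / 2) < 0 := by
    intro f hf hz hl
    by_contra hm
    push Not at hm
    obtain ⟨x, hx, hx0⟩ := intermediate_value_Icc (by linarith : l ≤ (l + r) / 2) hf.continuousOn
      (show (0 : ℝ) ∈ Set.Icc (f l) (f ((l + r) / 2)) from ⟨hl.le, hm⟩)
    rcases eq_or_lt_of_le hx.1 with h1 | h1
    · subst h1; linarith
    · exact hz x h1 (by linarith [hx.2]) hx0
  constructor
  · intro hm
    rcases lt_trichotomy (α + β * l) 0 with h1 | h1 | h1
    · exact Or.inl h1
    · refine Or.inr ⟨h1, ?_⟩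
      by_contra hb
      push Not at hb
      nlinarith
    · exfalso
      have := key (fun x => -(α + β * x)) (by fun_prop)
        (fun x h1 h2 => by simpa only [ne_eq, neg_eq_zero] using h x h1 h2) (by linarith)
      linarith
  · rintro (h1 | ⟨h1, h2⟩)
    · exact key (fun x => α + β * x) (by fun_prop) h h1
    · nlinarith

theorem affine_neg_mid_iff_right {α β l r : ℝ} (hlr : l < r)
    (h : ∀ x, l < x → x < r → α + β * x ≠ 0) :
    α + β * ((l + r) / 2) < 0 ↔ α + β * r < 0 ∨ (α + β * r = 0 ∧ 0 < β) := by
  have := affine_neg_mid_iff_left (α := α) (β := -β) (l := -r) (r := -l) (by linarith)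
    (fun x h1 h2 => by
      have := h (-x) (by linarith) (by linarith)
      intro h3; apply this; linarith)
  have e : α + -β * ((-r + -l) / 2) = α + β * ((l + r) / 2) := by ring
  have e2 : α + -β * -r = α + β * r := by ring
  rw [e, e2] at this
  rw [this]
  simp

/-- A drawing with distinct abscissae in which two edges meet only at a common end. -/
structure GeneralDrawing {W : Type*} (H : SimpleGraph W) (X Y : W → ℝ) : Prop where
  inj : Function.Injective X
  cross : ∀ a b c d, H.Adj a b → H.Adj c d → X a < X b → X c < X d → ∀ x, X a ≤ x → x ≤ X b →
    X c ≤ x → x ≤ X d → heightOn X Y a b x = heightOn X Y c d x →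
    (a = c ∧ b = d) ∨ (a = c ∧ x = X a) ∨ (b = d ∧ x = X b) ∨ (a = d ∧ x = X a) ∨
      (b = c ∧ x = X b)

theorem IsPlaneDrawing.exists_generalDrawing {W : Type*} [Finite W] {H : SimpleGraph W}
    {pos : W → ℝ × ℝ} (h : IsPlaneDrawing H pos) : ∃ X Y : W → ℝ, GeneralDrawing H X Y := by
  obtain ⟨hinj, hdisj, hshare, -⟩ := h
  have hfin : (Set.range fun q : W × W =>
      -((pos q.1).1 - (pos q.2).1) / ((pos q.1).2 - (pos q.2).2)).Finite := Set.finite_range _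
  obtain ⟨t, ht⟩ := hfin.infinite_compl.nonempty
  have hXinj : Function.Injective fun w => (pos w).1 + t * (pos w).2 := by
    intro a b hab
    by_contra hne
    have hab' : (pos a).1 + t * (pos a).2 = (pos b).1 + t * (pos b).2 := hab
    by_cases hy : (pos a).2 = (pos b).2
    · apply hne
      apply hinj
      rw [hy] at hab'
      exact Prod.ext (by linarith) hy
    · apply ht
      refine ⟨(a, b), ?_⟩
      have : (pos a).2 - (pos b).2 ≠ 0 := sub_ne_zero.2 hy
      simp only
      rw [div_eq_iff this]
      linarith
  refine ⟨fun w => (pos w).1 + t * (pos w).2, fun w => (pos w).2, hXinj, ?_⟩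
  set X : W → ℝ := fun w => (pos w).1 + t * (pos w).2 with hX
  set Y : W → ℝ := fun w => (pos w).2 with hY
  have hpt : ∀ a b, X a < X b → ∀ x, X a ≤ x → x ≤ X b →
      ((x - t * heightOn X Y a b x, heightOn X Y a b x) : ℝ × ℝ) ∈
        segment ℝ (pos a) (pos b) := by
    intro a b hab x h1 h2
    have hd : 0 < X b - X a := by linarith
    refine ⟨(X b - x) / (X b - X a), (x - X a) / (X b - X a), by
      apply div_nonneg <;> linarith, by apply div_nonneg <;> linarith, by
        field_simp; ring, ?_⟩
    have e2 : (X b - x) / (X b - X a) * Y a + (x - X a) / (X b - X a) * Y b =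
        heightOn X Y a b x := by
      unfold heightOn slopeBetween
      field_simp
      ring
    have e1 : (X b - x) / (X b - X a) * X a + (x - X a) / (X b - X a) * X b = x := by
      field_simp; ring
    apply Prod.ext
    · have : (X b - x) / (X b - X a) * (pos a).1 + (x - X a) / (X b - X a) * (pos b).1 =
        ((X b - x) / (X b - X a) * X a + (x - X a) / (X b - X a) * X b) -
          t * ((X b - x) / (X b - X a) * Y a + (x - X a) / (X b - X a) * Y b) := by
        simp only [hX, hY]; ring
      rw [e1, e2] at this
      simpa using this
    · simpa using e2
  have hX1 : ∀ x y w, ((x - t * y, y) : ℝ × ℝ) = pos w → x = X w := by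
    intro x y w hw
    have h1 := congrArg Prod.fst hw
    have h2 := congrArg Prod.snd hw
    simp only at h1 h2
    simp only [hX, ← h1, ← h2]; ring
  intro a b c d hab hcd h1 h2 x ha hb hc hd heq
  have p1 := hpt a b h1 x ha hb
  have p2 := hpt c d h2 x hc hd
  rw [← heq] at p2
  by_cases e1 : a = c
  · subst e1
    by_cases e2 : b = d
    · exact Or.inl ⟨rfl, e2⟩
    · have := (hshare a b d hab hcd e2).subset ⟨p1, p2⟩
      exact Or.inr (Or.inl ⟨rfl, hX1 _ _ _ this⟩)
  by_cases e2 : b = d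
  · subst e2
    rw [segment_symm] at p1 p2
    have := (hshare b a c hab.symm hcd.symm e1).subset ⟨p1, p2⟩
    exact Or.inr (Or.inr (Or.inl ⟨rfl, hX1 _ _ _ this⟩))
  by_cases e3 : a = d
  · subst e3
    rw [segment_symm _ (pos c)] at p2
    have hbc : b ≠ c := by rintro rfl; linarith
    have := (hshare a b c hab hcd.symm hbc).subset ⟨p1, p2⟩
    exact Or.inr (Or.inr (Or.inr (Or.inl ⟨rfl, hX1 _ _ _ this⟩)))
  by_cases e4 : b = c
  · subst e4
    rw [segment_symm _ (pos a)] at p1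
    have := (hshare b a d hab.symm hcd e3).subset ⟨p1, p2⟩
    exact Or.inr (Or.inr (Or.inr (Or.inr ⟨rfl, hX1 _ _ _ this⟩)))
  exact absurd (Set.mem_inter p1 p2) (by rw [hdisj a b c d hab hcd e1 e3 e4 e2]; simp)

theorem heightOn_eq_affine {W : Type*} (X Y : W → ℝ) (a b u v : W) (x : ℝ) :
    heightOn X Y a b x - heightOn X Y u v x =
      ((Y a - slopeBetween X Y a b * X a) - (Y u - slopeBetween X Y u v * X u)) +
        (slopeBetween X Y a b - slopeBetween X Y u v) * x := by
  unfold heightOn; ring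

theorem GeneralDrawing.below_left_iff_below_right {W : Type*} {H : SimpleGraph W} {X Y : W → ℝ}
    (h : GeneralDrawing H X Y) {u v a b : W} (huv : H.Adj u v) (hX : X u < X v)
    (hab : H.Adj a b) (hXab : X a < X b) :
    ((((X a < X u ∧ X u < X b ∧ heightOn X Y a b (X u) < Y u) ∨
        (a = u ∧ slopeBetween X Y u b < slopeBetween X Y u v)) ∨
        (X u < X a ∧ X a < X v ∧ Y a < heightOn X Y u v (X a))) ↔
      (((X a < X v ∧ X v < X b ∧ heightOn X Y a b (X v) < Y v) ∨
        (b = v ∧ slopeBetween X Y u v < slopeBetween X Y a v)) ∨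
        (X u < X b ∧ X b < X v ∧ Y b < heightOn X Y u v (X b)))) := by
  by_cases huvab : a = u ∧ b = v
  · obtain ⟨rfl, rfl⟩ := huvab
    simp
  set l := max (X a) (X u) with hl
  set r := min (X b) (X v) with hr
  by_cases hlr : l < r
  swap
  · push Not at hlr
    have h1 : ∀ z, X z < X v → z = u ∨ z = u ∨ True := by simp
    have hor : X b ≤ X u ∨ X v ≤ X a := by
      simp only [hl, hr, le_max_iff, min_le_iff] at hlr
      rcases hlr with (h | h) | (h | h)
      · linarith
      · exact Or.inr h
      · exact Or.inl h
      · linarith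
    rcases hor with h | h
    · constructor
      · rintro ((⟨h1, h2, -⟩ | ⟨rfl, -⟩) | ⟨h1, h2, -⟩) <;> linarith
      · rintro ((⟨h1, h2, -⟩ | ⟨rfl, -⟩) | ⟨h1, h2, -⟩) <;> linarith
    · constructor
      · rintro ((⟨h1, h2, -⟩ | ⟨rfl, -⟩) | ⟨h1, h2, -⟩) <;> linarith
      · rintro ((⟨h1, h2, -⟩ | ⟨rfl, -⟩) | ⟨h1, h2, -⟩) <;> linarith
  have hau : X a ≤ l := le_max_left _ _
  have hul : X u ≤ l := le_max_right _ _
  have hrb : r ≤ X b := min_le_left _ _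
  have hrv : r ≤ X v := min_le_right _ _
  have hz : ∀ x, l ≤ x → x ≤ r → heightOn X Y a b x = heightOn X Y u v x →
      (a = u ∧ x = X a) ∨ (b = v ∧ x = X b) := by
    intro x h1 h2 h3
    rcases h.cross a b u v hab huv hXab hX x (by linarith) (by linarith) (by linarith)
      (by linarith) h3 with h4 | h4 | h4 | h4 | h4
    · exact absurd h4 huvab
    · exact Or.inl h4
    · exact Or.inr h4
    · obtain ⟨rfl, h4⟩ := h4; linarith
    · obtain ⟨rfl, h4⟩ := h4; linarith
  set α := ((Y a - slopeBetween X Y a b * X a) - (Y u - slopeBetween X Y u v * X u)) with hα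
  set β := (slopeBetween X Y a b - slopeBetween X Y u v) with hβ
  have hD : ∀ x, heightOn X Y a b x - heightOn X Y u v x = α + β * x :=
    heightOn_eq_affine X Y a b u v
  have hne : ∀ x, l < x → x < r → α + β * x ≠ 0 := by
    intro x h1 h2 h3
    rw [← hD, sub_eq_zero] at h3
    rcases hz x h1.le h2.le h3 with ⟨-, h4⟩ | ⟨-, h4⟩ <;> linarith
  have hL := affine_neg_mid_iff_left hlr hne
  have hR := affine_neg_mid_iff_right hlr hne
  have hleft : (((X a < X u ∧ X u < X b ∧ heightOn X Y a b (X u) < Y u) ∨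
        (a = u ∧ slopeBetween X Y u b < slopeBetween X Y u v)) ∨
        (X u < X a ∧ X a < X v ∧ Y a < heightOn X Y u v (X a))) ↔
        (α + β * l < 0 ∨ (α + β * l = 0 ∧ β < 0)) := by
    rw [← hD]
    rcases lt_trichotomy (X a) (X u) with h1 | h1 | h1
    · have e : l = X u := max_eq_right h1.le
      have hnau : a ≠ u := by rintro rfl; exact lt_irrefl _ h1
      have h0 : ¬ (heightOn X Y a b l - heightOn X Y u v l = 0) := by
        intro h0
        rcases hz l le_rfl hlr.le (sub_eq_zero.1 h0) with ⟨h2, -⟩ | ⟨-, h2⟩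
        · exact hnau h2
        · linarith
      have : X u < X b := by linarith
      simp only [h0, false_and, or_false, hnau, h1, this, true_and, not_lt.2 h1.le]
      rw [e, heightOn_left]
      constructor <;> intro <;> linarith
    · have := h.inj h1
      subst this
      have e : l = X a := max_self _
      rw [e, heightOn_left, heightOn_left]
      simp [hβ]
    · have e : l = X a := max_eq_left h1.le
      have hnau : a ≠ u := by rintro rfl; exact lt_irrefl _ h1
      have h0 : ¬ (heightOn X Y a b l - heightOn X Y u v l = 0) := by
        intro h0
        rcases hz l le_rfl hlr.le (sub_eq_zero.1 h0) with ⟨h2, -⟩ | ⟨-, h2⟩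
        · exact hnau h2
        · linarith
      have : X a < X v := by linarith
      simp only [h0, false_and, or_false, hnau, h1, this, true_and, not_lt.2 h1.le, false_or]
      rw [e, heightOn_left]
      constructor <;> intro <;> linarith
  have hright : (((X a < X v ∧ X v < X b ∧ heightOn X Y a b (X v) < Y v) ∨
        (b = v ∧ slopeBetween X Y u v < slopeBetween X Y a v)) ∨
        (X u < X b ∧ X b < X v ∧ Y b < heightOn X Y u v (X b))) ↔
        (α + β * r < 0 ∨ (α + β * r = 0 ∧ 0 < β)) := by
    rw [← hD]
    rcases lt_trichotomy (X b) (X v) with h1 | h1 | h1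
    · have e : r = X b := min_eq_left h1.le
      have hnau : b ≠ v := by rintro rfl; exact lt_irrefl _ h1
      have h0 : ¬ (heightOn X Y a b r - heightOn X Y u v r = 0) := by
        intro h0
        rcases hz r hlr.le le_rfl (sub_eq_zero.1 h0) with ⟨-, h2⟩ | ⟨h2, -⟩
        · linarith
        · exact hnau h2
      have : X u < X b := by linarith
      simp only [h0, false_and, or_false, hnau, h1, this, true_and, not_lt.2 h1.le, false_or,
        and_false]
      rw [e, heightOn_right Y hXab]
      constructor <;> intro <;> linarith
    · have := h.inj h1
      subst this
      have e : r = X b := min_self _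
      rw [e, heightOn_right Y hXab, heightOn_right Y hX]
      simp [hβ]
    · have e : r = X v := min_eq_right h1.le
      have hnau : b ≠ v := by rintro rfl; exact lt_irrefl _ h1
      have h0 : ¬ (heightOn X Y a b r - heightOn X Y u v r = 0) := by
        intro h0
        rcases hz r hlr.le le_rfl (sub_eq_zero.1 h0) with ⟨-, h2⟩ | ⟨h2, -⟩
        · linarith
        · exact hnau h2
      have : X a < X v := by linarith
      simp only [h0, false_and, or_false, hnau, h1, this, true_and, not_lt.2 h1.le,
        and_false]
      rw [e, heightOn_right Y hX]
      constructor <;> intro <;> linarith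
  rw [hleft, hright, ← hL, ← hR]

theorem zmod_two_ite_sum (c : ZMod 2) (p q r s : Prop) [Decidable p] [Decidable q] [Decidable r]
    [Decidable s] (h : (p ∨ q) ↔ (r ∨ s)) (h1 : ¬ (p ∧ q)) (h2 : ¬ (r ∧ s)) :
    (if p then c else 0) + (if q then c else 0) =
      (if r then c else 0) + (if s then c else 0) := by
  by_cases hp : p <;> by_cases hq : q <;> by_cases hr : r <;> by_cases hs : s <;> simp_all

open Classical in
theorem GeneralDrawing.potential_right {W : Type*} [Fintype W] {H : SimpleGraph W}
    {X Y : W → ℝ} (h : GeneralDrawing H X Y) (C : W → W → ZMod 2) (hs : ∀ a b, C a b = C b a)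
    (hadj : ∀ a b, ¬ H.Adj a b → C a b = 0) (heven : ∀ a, ∑ b, C a b = 0) {u v : W}
    (huv : H.Adj u v) (hX : X u < X v) :
    (∑ a, ∑ b, if X a < X u ∧ X u < X b ∧ heightOn X Y a b (X u) < Y u then C a b else 0) +
      (∑ w, if X u < X w ∧ slopeBetween X Y u w < slopeBetween X Y u v then C u w else 0) =
    (∑ a, ∑ b, if X a < X v ∧ X v < X b ∧ heightOn X Y a b (X v) < Y v then C a b else 0) +
      (∑ w, if X w < X v ∧ slopeBetween X Y u v < slopeBetween X Y v w then C v w else 0) := by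
  set T : W → Prop := fun w => X u < X w ∧ X w < X v ∧ Y w < heightOn X Y u v (X w) with hT
  have e1 : (∑ w, if X u < X w ∧ slopeBetween X Y u w < slopeBetween X Y u v
      then C u w else 0) = ∑ a, ∑ b, if X a < X b ∧ a = u ∧
        slopeBetween X Y u b < slopeBetween X Y u v then C a b else 0 := by
    rw [Finset.sum_comm]
    refine Finset.sum_congr rfl fun b _ => ?_
    rw [Finset.sum_eq_single u]
    · simp
    · intro a _ ha; simp [ha]
    · simp
  have e2 : (∑ w, if X w < X v ∧ slopeBetween X Y u v < slopeBetween X Y v w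
      then C v w else 0) = ∑ a, ∑ b, if X a < X b ∧ b = v ∧
        slopeBetween X Y u v < slopeBetween X Y a v then C a b else 0 := by
    refine Finset.sum_congr rfl fun b _ => ?_
    rw [Finset.sum_eq_single v]
    · simp [hs b v, slopeBetween_comm X Y b v]
    · intro a _ ha; simp [ha]
    · simp
  have e3 : (∑ a, ∑ b, if X a < X b ∧ T a then C a b else 0) =
      ∑ a, ∑ b, if X a < X b ∧ T b then C a b else 0 := by
    have h0 : ∑ a, ∑ b, (if T a then C a b else 0) = 0 := by
      refine Finset.sum_eq_zero fun a _ => ?_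
      by_cases ha : T a
      · simpa [ha] using heven a
      · simp [ha]
    have h1 : ∑ a, ∑ b, (if T a then C a b else 0) =
        (∑ a, ∑ b, if X a < X b ∧ T a then C a b else 0) +
          ∑ a, ∑ b, if X b < X a ∧ T a then C a b else 0 := by
      rw [← Finset.sum_add_distrib]
      refine Finset.sum_congr rfl fun a _ => ?_
      rw [← Finset.sum_add_distrib]
      refine Finset.sum_congr rfl fun b _ => ?_
      rcases lt_trichotomy (X a) (X b) with h2 | h2 | h2
      · simp [h2, not_lt.2 h2.le]
      · have := hadj a b (by rw [h.inj h2]; exact H.loopless.irrefl b)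
        simp [this]
      · simp [h2, not_lt.2 h2.le]
    rw [h0] at h1
    have h2 : (∑ a, ∑ b, if X b < X a ∧ T a then C a b else 0) =
        ∑ a, ∑ b, if X a < X b ∧ T b then C a b else 0 := by
      rw [Finset.sum_comm]
      refine Finset.sum_congr rfl fun a _ => Finset.sum_congr rfl fun b _ => ?_
      rw [hs]
    rw [h2] at h1
    exact CharTwo.add_eq_zero.1 h1.symm
  rw [e1, e2]
  rw [← add_left_inj (∑ a, ∑ b, if X a < X b ∧ T a then C a b else 0)]
  nth_rewrite 2 [e3]
  simp only [← Finset.sum_add_distrib]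
  refine Finset.sum_congr rfl fun a _ => Finset.sum_congr rfl fun b _ => ?_
  by_cases hab : H.Adj a b
  swap
  · simp [hadj a b hab]
  by_cases hXab : X a < X b
  swap
  · have n1 : ¬ (X a < X u ∧ X u < X b ∧ heightOn X Y a b (X u) < Y u) := by
      rintro ⟨h1, h2, -⟩; exact hXab (h1.trans h2)
    have n2 : ¬ (X a < X v ∧ X v < X b ∧ heightOn X Y a b (X v) < Y v) := by
      rintro ⟨h1, h2, -⟩; exact hXab (h1.trans h2)
    simp [hXab, n1, n2]
  simp only [hXab, true_and]
  have key := h.below_left_iff_below_right huv hX hab hXab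
  have f1 := zmod_two_ite_sum (C a b) (X a < X u ∧ X u < X b ∧ heightOn X Y a b (X u) < Y u)
    (a = u ∧ slopeBetween X Y u b < slopeBetween X Y u v)
    ((X a < X u ∧ X u < X b ∧ heightOn X Y a b (X u) < Y u) ∨
    (a = u ∧ slopeBetween X Y u b < slopeBetween X Y u v)) False (by simp)
    (by rintro ⟨⟨h1, -⟩, rfl, -⟩; exact lt_irrefl _ h1) (by simp)
  have f2 := zmod_two_ite_sum (C a b) (X a < X v ∧ X v < X b ∧ heightOn X Y a b (X v) < Y v)
    (b = v ∧ slopeBetween X Y u v < slopeBetween X Y a v)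
    ((X a < X v ∧ X v < X b ∧ heightOn X Y a b (X v) < Y v) ∨
    (b = v ∧ slopeBetween X Y u v < slopeBetween X Y a v)) False (by simp)
    (by rintro ⟨⟨-, h1, -⟩, rfl, -⟩; exact lt_irrefl _ h1) (by simp)
  rw [f1, f2]
  simp only [if_false, add_zero]
  refine zmod_two_ite_sum (C a b) _ _ _ _ key ?_ ?_
  · rintro ⟨⟨h1, -⟩ | ⟨rfl, -⟩, h2, -⟩ <;> linarith
  · rintro ⟨⟨-, h1, -⟩ | ⟨rfl, -⟩, -, h2, -⟩ <;> linarith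

/-- A rotation key with the property that every even edge labelling is a coboundary of a face
potential: `g v` is the value of the potential at the start of the rotation at `v`. -/
structure RotationKey {W : Type*} [Fintype W] (H : SimpleGraph W) (key : W → W → ℕ) (N : ℕ) :
    Prop where
  lt : ∀ u v, key u v < N
  inj : ∀ u v w, H.Adj u v → H.Adj u w → key u v = key u w → v = w
  potential : ∀ C : W → W → ZMod 2, (∀ a b, C a b = C b a) → (∀ a b, ¬ H.Adj a b → C a b = 0) →
    (∀ a, ∑ b, C a b = 0) → ∃ g : W → ZMod 2, ∀ u v, H.Adj u v →
      g u + (∑ w, if key u w < key u v then C u w else 0) + C u v =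
        g v + ∑ w, if key v w < key v u then C v w else 0

open Classical in
/-- The counterclockwise angle of the ray from `u` to `w`, measured from straight down. -/
noncomputable def rayAngle {W : Type*} (X Y : W → ℝ) (u w : W) : ℝ :=
  Real.arctan (slopeBetween X Y u w) + if X w < X u then Real.pi else 0

theorem rayAngle_lt_iff_of_right {W : Type*} {X Y : W → ℝ} {u v : W} (hv : X u < X v) (w : W) :
    rayAngle X Y u w < rayAngle X Y u v ↔
      ¬ X w < X u ∧ slopeBetween X Y u w < slopeBetween X Y u v := by
  unfold rayAngle
  rw [if_neg (not_lt.2 hv.le)]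
  have h1 := Real.neg_pi_div_two_lt_arctan (slopeBetween X Y u w)
  have h2 := Real.arctan_lt_pi_div_two (slopeBetween X Y u v)
  by_cases h : X w < X u
  · simp only [h, if_true, not_true, false_and, iff_false]
    linarith
  · simp only [h, if_false, not_false_iff, true_and, add_zero]
    exact Real.arctan_strictMono.lt_iff_lt

theorem rayAngle_lt_iff_of_left {W : Type*} {X Y : W → ℝ} {u v : W} (hv : X v < X u) (w : W) :
    rayAngle X Y u w < rayAngle X Y u v ↔
      ¬ X w < X u ∨ slopeBetween X Y u w < slopeBetween X Y u v := by
  unfold rayAngle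
  rw [if_pos hv]
  have h1 := Real.neg_pi_div_two_lt_arctan (slopeBetween X Y u v)
  have h2 := Real.arctan_lt_pi_div_two (slopeBetween X Y u w)
  by_cases h : X w < X u
  · simp only [h, if_true, not_true, false_or, add_lt_add_iff_right]
    exact Real.arctan_strictMono.lt_iff_lt
  · simp only [h, if_false, not_false_iff, true_or, iff_true, add_zero]
    linarith

theorem GeneralDrawing.slope_inj {W : Type*} {H : SimpleGraph W} {X Y : W → ℝ}
    (h : GeneralDrawing H X Y) {u v w : W} (hv : H.Adj u v) (hw : H.Adj u w)
    (hX : (X u < X v ∧ X u < X w) ∨ (X v < X u ∧ X w < X u))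
    (he : slopeBetween X Y u v = slopeBetween X Y u w) : v = w := by
  rcases hX with ⟨h1, h2⟩ | ⟨h1, h2⟩
  · have hm : X u < min (X v) (X w) := lt_min h1 h2
    have := h.cross u v u w hv hw h1 h2 (min (X v) (X w)) hm.le (min_le_left _ _) hm.le
      (min_le_right _ _) (by unfold heightOn; rw [he])
    rcases this with h4 | h4 | h4 | h4 | h4
    · exact h4.2
    · linarith [h4.2]
    · exact h4.1
    · rw [h4.1] at h2; linarith
    · rw [← h4.1] at h1; linarith
  · have hm : max (X v) (X w) < X u := max_lt h1 h2
    have := h.cross v u w u hv.symm hw.symm h1 h2 (max (X v) (X w)) (le_max_left _ _) hm.le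
      (le_max_right _ _) hm.le (by
        have e1 := heightOn_eq_affine X Y v u w u (X u)
        rw [heightOn_right Y h1, heightOn_right Y h2] at e1
        have e2 := heightOn_eq_affine X Y v u w u (max (X v) (X w))
        rw [slopeBetween_comm X Y v u, slopeBetween_comm X Y w u, he] at e1 e2
        linarith)
    rcases this with h4 | h4 | h4 | h4 | h4
    · exact h4.1
    · exact h4.1
    · linarith [h4.2]
    · rw [h4.1] at h1; linarith
    · rw [h4.1] at h2; linarith

open Classical in
theorem GeneralDrawing.potential_rayAngle {W : Type*} [Fintype W] {H : SimpleGraph W}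
    {X Y : W → ℝ} (h : GeneralDrawing H X Y) (C : W → W → ZMod 2) (hs : ∀ a b, C a b = C b a)
    (hadj : ∀ a b, ¬ H.Adj a b → C a b = 0) (heven : ∀ a, ∑ b, C a b = 0) :
    ∃ g : W → ZMod 2, ∀ u v, H.Adj u v →
      g u + (∑ w, if rayAngle X Y u w < rayAngle X Y u v then C u w else 0) + C u v =
        g v + ∑ w, if rayAngle X Y v w < rayAngle X Y v u then C v w else 0 := by
  set g : W → ZMod 2 := fun u => ∑ a, ∑ b,
    if X a < X u ∧ X u < X b ∧ heightOn X Y a b (X u) < Y u then C a b else 0 with hg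
  have key : ∀ u v, H.Adj u v → X u < X v →
      g u + (∑ w, if rayAngle X Y u w < rayAngle X Y u v then C u w else 0) + C u v =
        g v + ∑ w, if rayAngle X Y v w < rayAngle X Y v u then C v w else 0 := by
    intro u v huv hX
    have hp := h.potential_right C hs hadj heven huv hX
    have e1 : (∑ w, if rayAngle X Y u w < rayAngle X Y u v then C u w else 0) =
        ∑ w, if X u < X w ∧ slopeBetween X Y u w < slopeBetween X Y u v then C u w else 0 := by
      refine Finset.sum_congr rfl fun w _ => ?_
      by_cases hw : H.Adj u w
      · have hne : X u ≠ X w := fun e => hw.ne (h.inj e)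
        have : ¬ X w < X u ↔ X u < X w := by
          rw [not_lt]; exact ⟨fun h => lt_of_le_of_ne h hne, le_of_lt⟩
        simp only [rayAngle_lt_iff_of_right hX, this]
      · simp [hadj u w hw]
    have e2 : (∑ w, if rayAngle X Y v w < rayAngle X Y v u then C v w else 0) + C v u +
        (∑ w, if X w < X v ∧ slopeBetween X Y u v < slopeBetween X Y v w then C v w else 0) =
        0 := by
      refine Eq.trans ?_ (heven v)
      have : C v u = ∑ w, if w = u then C v w else 0 := by simp
      rw [this, ← Finset.sum_add_distrib, ← Finset.sum_add_distrib]
      refine Finset.sum_congr rfl fun w _ => ?_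
      by_cases hw : H.Adj v w
      swap
      · simp [hadj v w hw]
      simp only [rayAngle_lt_iff_of_left hX]
      by_cases hlt : X w < X v
      · have hinj := h.slope_inj hw huv.symm (Or.inr ⟨hlt, hX⟩)
        rw [slopeBetween_comm X Y u v]
        simp only [hlt, not_true, false_or, true_and]
        rcases lt_trichotomy (slopeBetween X Y v w) (slopeBetween X Y v u) with h3 | h3 | h3
        · have : w ≠ u := by rintro rfl; exact lt_irrefl _ h3
          simp [h3, this, not_lt.2 h3.le]
        · have := hinj h3
          subst this
          simp
        · have : w ≠ u := by rintro rfl; exact lt_irrefl _ h3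
          simp [h3, this, not_lt.2 h3.le]
      · have : w ≠ u := by rintro rfl; exact hlt hX
        simp [hlt, this]
    simp only [hg]
    rw [e1, hp, hs u v, add_assoc]
    congr 1
    set P := ∑ w, if rayAngle X Y v w < rayAngle X Y v u then C v w else 0
    set Q := ∑ w, if X w < X v ∧ slopeBetween X Y u v < slopeBetween X Y v w then C v w else 0
    have : P + (C v u + Q) = 0 := by rw [← add_assoc]; exact e2
    rw [CharTwo.add_eq_zero.1 this, add_comm]
  refine ⟨g, fun u v huv => ?_⟩
  rcases lt_trichotomy (X u) (X v) with h1 | h1 | h1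
  · exact key u v huv h1
  · exact absurd (h.inj h1) huv.ne
  · have := key v u huv.symm h1
    rw [← this, hs v u, add_assoc _ (C u v), CharTwo.add_self_eq_zero, add_zero]

open Classical in
theorem IsPlaneDrawing.exists_rotationKey {W : Type*} [Fintype W] {H : SimpleGraph W}
    {pos : W → ℝ × ℝ} (h : IsPlaneDrawing H pos) :
    ∃ key : W → W → ℕ, ∃ N, RotationKey H key N := by
  obtain ⟨X, Y, hXY⟩ := h.exists_generalDrawing
  set key : W → W → ℕ := fun u w =>
    (Finset.univ.filter fun w' => rayAngle X Y u w' < rayAngle X Y u w).card with hkey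
  have hmono : ∀ u a b, key u a < key u b ↔ rayAngle X Y u a < rayAngle X Y u b := by
    intro u a b
    constructor
    · intro hlt
      by_contra hle
      push Not at hle
      refine absurd hlt (not_lt.2 (Finset.card_le_card ?_))
      intro w hw
      simp only [Finset.mem_filter, Finset.mem_univ, true_and] at hw ⊢
      exact hw.trans_le hle
    · intro hlt
      refine Finset.card_lt_card ⟨?_, ?_⟩
      · intro w hw
        simp only [Finset.mem_filter, Finset.mem_univ, true_and] at hw ⊢
        exact hw.trans hlt
      · intro hsub
        have := hsub (by simpa using hlt : a ∈ _)
        simp at this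
  refine ⟨key, Fintype.card W + 1, ⟨?_, ?_, ?_⟩⟩
  · intro u v
    exact Nat.lt_succ_of_le (Finset.card_le_univ _)
  · intro u v w hv hw he
    have h1 : ¬ rayAngle X Y u v < rayAngle X Y u w := by rw [← hmono, he]; exact lt_irrefl _
    have h2 : ¬ rayAngle X Y u w < rayAngle X Y u v := by rw [← hmono, he]; exact lt_irrefl _
    rcases lt_trichotomy (X u) (X v) with a | a | a
    · rcases lt_trichotomy (X u) (X w) with b | b | b
      · rw [rayAngle_lt_iff_of_right b] at h1
        rw [rayAngle_lt_iff_of_right a] at h2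
        simp only [not_lt.2 a.le, not_lt.2 b.le, not_false_iff, true_and, not_lt] at h1 h2
        exact hXY.slope_inj hv hw (Or.inl ⟨a, b⟩) (le_antisymm h2 h1)
      · exact absurd (hXY.inj b) hw.ne
      · rw [rayAngle_lt_iff_of_left b] at h1
        exact absurd (Or.inl (not_lt.2 a.le)) h1
    · exact absurd (hXY.inj a) hv.ne
    · rcases lt_trichotomy (X u) (X w) with b | b | b
      · rw [rayAngle_lt_iff_of_left a] at h2
        exact absurd (Or.inl (not_lt.2 b.le)) h2
      · exact absurd (hXY.inj b) hw.ne
      · rw [rayAngle_lt_iff_of_left b] at h1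
        rw [rayAngle_lt_iff_of_left a] at h2
        simp only [a, b, not_true, false_or, not_lt] at h1 h2
        exact hXY.slope_inj hv hw (Or.inr ⟨a, b⟩) (le_antisymm h2 h1)
  · intro C hs hadj heven
    obtain ⟨g, hg⟩ := hXY.potential_rayAngle C hs hadj heven
    refine ⟨g, fun u v huv => ?_⟩
    simp only [hmono]
    exact hg u v huv

/-- Level structure of a graph in which adjacent vertices lie on consecutive levels and every
component has exactly one vertex of level zero. -/
structure IsLeveling {W : Type*} (H : SimpleGraph W) (lev : W → ℕ) : Prop where
  adj : ∀ u v, H.Adj u v → lev v = lev u + 1 ∨ lev u = lev v + 1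
  pred : ∀ v n, lev v = n + 1 → ∃ u, H.Adj u v ∧ lev u = n
  root : ∀ u v, lev u = 0 → lev v = 0 → H.Reachable u v → u = v

theorem IsLeveling.exists_root {W : Type*} {H : SimpleGraph W} {lev : W → ℕ}
    (h : IsLeveling H lev) (v : W) : ∃ u, lev u = 0 ∧ H.Reachable u v := by
  induction hn : lev v generalizing v with
  | zero => exact ⟨v, hn, SimpleGraph.Reachable.refl _⟩
  | succ n ih =>
    obtain ⟨u, hu, hun⟩ := h.pred v n hn
    obtain ⟨z, hz, hzu⟩ := ih u hun
    exact ⟨z, hz, hzu.trans hu.reachable⟩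

theorem RotationKey.exists_normalized {W : Type*} [Fintype W] {H : SimpleGraph W}
    {key : W → W → ℕ} {N : ℕ} (h : RotationKey H key N) {lev : W → ℕ} (hl : IsLeveling H lev)
    (C : W → W → ZMod 2) (hs : ∀ a b, C a b = C b a)
    (hadj : ∀ a b, ¬ H.Adj a b → C a b = 0) (heven : ∀ a, ∑ b, C a b = 0) :
    ∃ g : W → ZMod 2, (∀ u, lev u = 0 → g u = 0) ∧ ∀ u v, H.Adj u v →
      g u + (∑ w, if key u w < key u v then C u w else 0) + C u v =
        g v + ∑ w, if key v w < key v u then C v w else 0 := by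
  obtain ⟨g, hg⟩ := h.potential C hs hadj heven
  choose ρ hρ0 hρ using hl.exists_root
  refine ⟨fun v => g v + g (ρ v), fun u hu => ?_, fun u v huv => ?_⟩
  · simp only [hl.root _ _ (hρ0 u) hu (hρ u)]
    exact CharTwo.add_self_eq_zero _
  · have : ρ u = ρ v :=
      hl.root _ _ (hρ0 u) (hρ0 v) ((hρ u).trans (huv.reachable.trans (hρ v).symm))
    have h1 := hg u v huv
    simp only [this]
    calc _ = (g u + (∑ w, if key u w < key u v then C u w else 0) + C u v) + g (ρ v) := by ring
      _ = _ := by rw [h1]; ring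

/-- Restarting every rotation at a prescribed threshold. -/
def shiftKey {W : Type*} (key : W → W → ℕ) (N : ℕ) (τ : W → ℕ) (v u : W) : ℕ :=
  if key v u < τ v then key v u + N else key v u

theorem RotationKey.shift {W : Type*} [Fintype W] {H : SimpleGraph W}
    {key : W → W → ℕ} {N : ℕ} (h : RotationKey H key N) (τ : W → ℕ) :
    RotationKey H (shiftKey key N τ) (2 * N) := by
  refine ⟨fun u v => ?_, fun u v w hv hw he => ?_, fun C hs hadj heven => ?_⟩
  · have := h.lt u v
    unfold shiftKey
    split_ifs <;> omega
  · refine h.inj u v w hv hw ?_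
    have h1 := h.lt u v
    have h2 := h.lt u w
    unfold shiftKey at he
    split_ifs at he <;> omega
  · obtain ⟨g, hg⟩ := h.potential C hs hadj heven
    have key' : ∀ v u, (∑ w, if shiftKey key N τ v w < shiftKey key N τ v u then C v w else 0) =
        (∑ w, if key v w < τ v then C v w else 0) +
          ∑ w, if key v w < key v u then C v w else 0 := by
      intro v u
      have hu := h.lt v u
      by_cases hτ : key v u < τ v
      · have h0 := heven v
        rw [← sub_eq_zero, CharTwo.sub_eq_add]
        refine Eq.trans ?_ h0
        rw [← Finset.sum_add_distrib, ← Finset.sum_add_distrib]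
        refine Finset.sum_congr rfl fun w _ => ?_
        have hw := h.lt v w
        have e : shiftKey key N τ v w < shiftKey key N τ v u ↔
            (¬ key v w < τ v ∨ key v w < key v u) := by
          unfold shiftKey; rw [if_pos hτ]; split_ifs <;> omega
        simp only [e]
        by_cases h1 : key v w < τ v <;> by_cases h2 : key v w < key v u <;> simp [h1, h2]
        · rw [CharTwo.add_self_eq_zero]
        · omega
      · rw [← Finset.sum_add_distrib]
        refine Finset.sum_congr rfl fun w _ => ?_
        have hw := h.lt v w
        have e : shiftKey key N τ v w < shiftKey key N τ v u ↔
            (¬ key v w < τ v ∧ key v w < key v u) := by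
          unfold shiftKey; rw [if_neg hτ]; split_ifs <;> omega
        simp only [e]
        by_cases h1 : key v w < τ v <;> by_cases h2 : key v w < key v u <;> simp [h1, h2]
        · rw [CharTwo.add_self_eq_zero]
        · omega
    refine ⟨fun v => g v + ∑ w, if key v w < τ v then C v w else 0, fun u v huv => ?_⟩
    have h1 := hg u v huv
    rw [key', key']
    set A := ∑ w, if key u w < τ u then C u w else 0
    set B := ∑ w, if key v w < τ v then C v w else 0
    calc _ = (g u + (∑ w, if key u w < key u v then C u w else 0) + C u v) + (A + A) := by ring
      _ = (g v + (∑ w, if key v w < key v u then C v w else 0)) + (B + B) := by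
        rw [h1, CharTwo.add_self_eq_zero, CharTwo.add_self_eq_zero]
      _ = _ := by ring

/-- The sign with which a level is read. -/
def levelSign (n : ℕ) : ℤ := (-1) ^ (n / 2)

theorem levelSign_cases (n : ℕ) : levelSign n = 1 ∨ levelSign n = -1 := by
  unfold levelSign
  exact neg_one_pow_eq_or ℤ _

/-- A breadth first tree with vertex ranks, compatible with rotation keys. -/
structure RankedTree {W : Type*} (H : SimpleGraph W) (lev : W → ℕ) (k : W → W → ℕ) (M : ℕ)
    (par : W → W) (rk : W → ℤ) : Prop where
  adj : ∀ v, 0 < lev v → H.Adj (par v) v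
  lev_par : ∀ v, 0 < lev v → lev (par v) + 1 = lev v
  le : ∀ u v, H.Adj u v → lev v = lev u + 1 →
    levelSign (lev u) * (rk (par v) * M + k (par v) v) ≤ levelSign (lev u) * (rk u * M + k u v)
  rk_eq : ∀ v, 0 < lev v → rk v = rk (par v) * M + k (par v) v
  rk_root : ∀ u v, lev u = 0 → lev v = 0 → rk u = rk v → u = v
  k_le : ∀ u v, 0 < lev v → H.Adj v u → k v (par v) ≤ k v u

open Classical in
/-- One step of the breadth first construction of ranks and parents. -/
noncomputable def rankStep {W : Type*} (H : SimpleGraph W) (lev : W → ℕ) (key : W → W → ℕ) (N : ℕ)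
    (n : ℕ) (s : (W → ℤ) × (W → W)) : (W → ℤ) × (W → W) :=
  let d : W → W → ℤ := fun v u => s.1 v * (2 * N : ℕ) +
    shiftKey key N (fun v => if n = 0 then 0 else key v (s.2 v)) v u
  let p : W → W := fun w => if h : ∃ u, H.Adj u w ∧ lev u = n ∧ ∀ u', H.Adj u' w → lev u' = n →
    levelSign n * d u w ≤ levelSign n * d u' w then h.choose else w
  (fun w => d (p w) w, p)

theorem RotationKey.exists_rankedTree {W : Type*} [Fintype W] {H : SimpleGraph W}
    {key : W → W → ℕ} {N : ℕ} (h : RotationKey H key N) {lev : W → ℕ} (hl : IsLeveling H lev) :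
    ∃ k M par rk, RotationKey H k M ∧ RankedTree H lev k M par rk := by
  set s : ℕ → (W → ℤ) × (W → W) := fun n =>
    Nat.rec (fun w => (Fintype.equivFin W w : ℤ), id) (fun n s => rankStep H lev key N n s) n with hs
  set par : W → W := fun w => (s (lev w)).2 w with hpar
  set rk : W → ℤ := fun w => (s (lev w)).1 w with hrk
  set τ : W → ℕ := fun v => if lev v = 0 then 0 else key v (par v) with hτ
  set k := shiftKey key N τ with hk
  have hd : ∀ n u v, lev u = n → (s n).1 u * (2 * N : ℕ) +
      shiftKey key N (fun v => if n = 0 then 0 else key v ((s n).2 v)) u v =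
        rk u * (2 * N : ℕ) + k u v := by
    rintro n u v rfl
    rfl
  have hstep : ∀ v n, lev v = n + 1 → (H.Adj (par v) v ∧ lev (par v) = n ∧
      (∀ u', H.Adj u' v → lev u' = n → levelSign n * (rk (par v) * (2 * N : ℕ) + k (par v) v) ≤
        levelSign n * (rk u' * (2 * N : ℕ) + k u' v))) ∧
      rk v = rk (par v) * (2 * N : ℕ) + k (par v) v := by
    intro v n hv
    set d : W → W → ℤ := fun v u => (s n).1 v * (2 * N : ℕ) +
      shiftKey key N (fun v => if n = 0 then 0 else key v ((s n).2 v)) v u with hdd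
    have hex : ∃ u, H.Adj u v ∧ lev u = n ∧ ∀ u', H.Adj u' v → lev u' = n →
        levelSign n * d u v ≤ levelSign n * d u' v := by
      classical
      obtain ⟨u, hu, hun⟩ := hl.pred v n hv
      obtain ⟨x, hx, hmin⟩ := Finset.exists_min_image
        (Finset.univ.filter fun u => H.Adj u v ∧ lev u = n) (fun u => levelSign n * d u v)
        ⟨u, by simp [hu, hun]⟩
      simp only [Finset.mem_filter, Finset.mem_univ, true_and] at hx hmin
      exact ⟨x, hx.1, hx.2, fun u' h1 h2 => hmin u' ⟨h1, h2⟩⟩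
    have hp : par v = hex.choose := by
      simp only [hpar, hv]
      exact dif_pos hex
    have hr : rk v = d (par v) v := by
      simp only [hrk, hpar, hv]
      rfl
    obtain ⟨h1, h2, h3⟩ := hex.choose_spec
    rw [← hp] at h1 h2 h3
    refine ⟨⟨h1, h2, fun u' h4 h5 => ?_⟩, ?_⟩
    · have := h3 u' h4 h5
      simp only [hdd] at this
      rwa [hd n _ _ h2, hd n _ _ h5] at this
    · rw [hr]
      exact hd n _ _ h2
  have hpos : ∀ v, 0 < lev v → ∃ n, lev v = n + 1 := fun v hv => ⟨lev v - 1, by omega⟩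
  refine ⟨k, 2 * N, par, rk, h.shift τ, ⟨fun v hv => ?_, fun v hv => ?_, fun u v huv hv => ?_,
    fun v hv => ?_, fun u v hu hv he => ?_, fun u v hv huv => ?_⟩⟩
  · obtain ⟨n, hn⟩ := hpos v hv
    exact (hstep v n hn).1.1
  · obtain ⟨n, hn⟩ := hpos v hv
    have := (hstep v n hn).1.2.1
    omega
  · exact (hstep v _ hv).1.2.2 u huv rfl
  · obtain ⟨n, hn⟩ := hpos v hv
    exact (hstep v n hn).2
  · simp only [hrk, hu, hv] at he
    have : ((Fintype.equivFin W u : ℕ) : ℤ) = (Fintype.equivFin W v : ℕ) := he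
    exact (Fintype.equivFin W).injective (Fin.ext (by exact_mod_cast this))
  · have h1 : τ v = key v (par v) := if_neg hv.ne'
    have h2 := h.lt v (par v)
    have h3 := h.lt v u
    simp only [hk, shiftKey, h1]
    split_ifs <;> omega

/-- The position of the dart `(v, u)` among the darts leaving the level of `v`. -/
def dartPos {W : Type*} (k : W → W → ℕ) (M : ℕ) (rk : W → ℤ) (v u : W) : ℤ := rk v * M + k v u

theorem mul_add_lt_mul_add_iff {r r' : ℤ} {k k' M : ℕ} (hk : k < M) (hk' : k' < M) :
    r * M + k < r' * M + k' ↔ r < r' ∨ (r = r' ∧ k < k') := by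
  have hk1 : (k : ℤ) < M := by exact_mod_cast hk
  have hk2 : (k' : ℤ) < M := by exact_mod_cast hk'
  constructor
  · intro h
    rcases lt_trichotomy r r' with h1 | h1 | h1
    · exact Or.inl h1
    · subst h1
      exact Or.inr ⟨rfl, by exact_mod_cast (by linarith : (k : ℤ) < k')⟩
    · exfalso
      have : (r' + 1) * (M : ℤ) ≤ r * M := by
        apply mul_le_mul_of_nonneg_right _ (by positivity)
        omega
      nlinarith
  · rintro (h | ⟨rfl, h⟩)
    · have : (r + 1) * (M : ℤ) ≤ r' * M := by
        apply mul_le_mul_of_nonneg_right _ (by positivity)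
        omega
      nlinarith
    · have : (k : ℤ) < k' := by exact_mod_cast h
      linarith

section
variable {W : Type*} {H : SimpleGraph W} {lev : W → ℕ} {k : W → W → ℕ} {M : ℕ}
  {par : W → W} {rk : W → ℤ}

theorem RankedTree.rk_inj [Fintype W] (hk : RotationKey H k M) (ht : RankedTree H lev k M par rk)
    {u v : W} (hl : lev u = lev v) (h : rk u = rk v) : u = v := by
  induction hn : lev u generalizing u v with
  | zero => exact ht.rk_root u v hn (by omega) h
  | succ n ih =>
    have hu : 0 < lev u := by omega
    have hv : 0 < lev v := by omega
    have h1 := ht.lev_par u hu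
    have h2 := ht.lev_par v hv
    rw [ht.rk_eq u hu, ht.rk_eq v hv] at h
    have k1 := hk.lt (par u) u
    have k2 := hk.lt (par v) v
    have n1 := mt (mul_add_lt_mul_add_iff (r := rk (par u)) (r' := rk (par v)) k1 k2).2
      (by rw [h]; exact lt_irrefl _)
    have n2 := mt (mul_add_lt_mul_add_iff (r := rk (par v)) (r' := rk (par u)) k2 k1).2
      (by rw [h]; exact lt_irrefl _)
    push Not at n1 n2
    have hp : par u = par v := ih (by omega) (le_antisymm n2.1 n1.1) (by omega)
    refine hk.inj (par u) u v (ht.adj u hu) (hp ▸ ht.adj v hv) ?_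
    have := n1.2 (by rw [hp])
    have := n2.2 (by rw [hp])
    rw [hp] at *
    omega

open Classical in
/-- If an even labelling uses only tree edges below level `n`, then its normalized potential at
the start of a corner is the sum of the labels of all earlier darts of that level. -/
theorem RankedTree.potential_eq_sum_earlier [Fintype W] (hk : RotationKey H k M)
    (hl : IsLeveling H lev) (ht : RankedTree H lev k M par rk) {C : W → W → ZMod 2}
    (hs : ∀ a b, C a b = C b a) (hadj : ∀ a b, ¬ H.Adj a b → C a b = 0)
    (heven : ∀ a, ∑ b, C a b = 0) {g : W → ZMod 2} (hg0 : ∀ u, lev u = 0 → g u = 0)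
    (hg : ∀ u v, H.Adj u v → g u + (∑ w, if k u w < k u v then C u w else 0) + C u v =
        g v + ∑ w, if k v w < k v u then C v w else 0) {n : ℕ}
    (htree : ∀ a b, lev b = lev a + 1 → lev a < n → C a b ≠ 0 → a = par b) :
    ∀ j ≤ n, ∀ v u, lev v = j → lev u = j + 1 → H.Adj v u →
      g v + (∑ w, if k v w < k v u then C v w else 0) =
        ∑ a, ∑ b, if lev a = j ∧ lev b = j + 1 ∧ dartPos k M rk a b < dartPos k M rk v u
          then C a b else 0 := by
  have hlt : ∀ a b v u, dartPos k M rk a b < dartPos k M rk v u ↔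
      rk a < rk v ∨ (rk a = rk v ∧ k a b < k v u) := fun a b v u =>
    mul_add_lt_mul_add_iff (hk.lt a b) (hk.lt v u)
  have split : ∀ j v u, lev v = j → (∑ a, ∑ b, if lev a = j ∧ lev b = j + 1 ∧
      dartPos k M rk a b < dartPos k M rk v u then C a b else 0) =
      (∑ a, if lev a = j ∧ rk a < rk v then ∑ b, if lev b = j + 1 then C a b else 0 else 0) +
        ∑ b, if lev b = j + 1 ∧ k v b < k v u then C v b else 0 := by
    intro j v u hv
    have e : (∑ b, if lev b = j + 1 ∧ k v b < k v u then C v b else 0) =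
        ∑ a, if a = v then ∑ b, (if lev b = j + 1 ∧ k v b < k v u then C v b else 0) else 0 := by
      simp
    rw [e, ← Finset.sum_add_distrib]
    refine Finset.sum_congr rfl fun a _ => ?_
    by_cases ha : lev a = j
    swap
    · have : a ≠ v := by rintro rfl; exact ha hv
      simp [ha, this]
    rcases lt_trichotomy (rk a) (rk v) with h | h | h
    · have : a ≠ v := by rintro rfl; exact lt_irrefl _ h
      simp [ha, this, hlt, h]
    · have : a = v := ht.rk_inj hk (by omega) h
      subst this
      simp [ha, hlt]
    · have : a ≠ v := by rintro rfl; exact lt_irrefl _ h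
      simp [this, hlt, not_lt.2 h.le, h.ne']
  intro j
  induction j with
  | zero =>
    intro _ v u hv hu hvu
    rw [split 0 v u hv, hg0 v hv, zero_add]
    have up : ∀ a b, lev a = 0 → ¬ lev b = 0 + 1 → C a b = 0 := by
      intro a b ha hb
      refine hadj a b fun hab => ?_
      rcases hl.adj a b hab with h | h <;> omega
    have e : (∑ a, if lev a = 0 ∧ rk a < rk v then ∑ b, if lev b = 0 + 1 then C a b else 0
        else 0) = 0 := by
      refine Finset.sum_eq_zero fun a _ => ?_
      split_ifs with h
      · refine Eq.trans (Finset.sum_congr rfl fun b _ => ?_) (heven a)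
        by_cases hb : lev b = 0 + 1
        · simp [hb]
        · simp only [hb, if_false, up a b h.1 hb]
      · rfl
    rw [e, zero_add]
    refine Finset.sum_congr rfl fun b _ => ?_
    by_cases hb : lev b = 0 + 1
    · simp [hb]
    · simp [up v b hv hb]
  | succ j ih =>
    intro hj v u hv hu hvu
    have hv0 : 0 < lev v := by omega
    have hpv := ht.adj v hv0
    have hplev := ht.lev_par v hv0
    have hdown : ∀ a b, lev a = j + 1 → ¬ lev b = j + 1 + 1 → b ≠ par a → C a b = 0 := by
      intro a b ha hb hne
      by_contra hC
      have hab : H.Adj a b := by by_contra h; exact hC (hadj a b h)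
      rcases hl.adj a b hab with h | h
      · omega
      · exact hne (htree b a (by omega) (by omega) (by rw [hs]; exact hC))
    have gv : g v = (∑ a, ∑ b, if lev a = j ∧ lev b = j + 1 ∧
        dartPos k M rk a b < dartPos k M rk (par v) v then C a b else 0) + C v (par v) := by
      rw [← ih (by omega) (par v) v (by omega) hv hpv]
      have h1 := hg v (par v) hpv.symm
      have h2 : (∑ w, if k v w < k v (par v) then C v w else 0) = 0 := by
        refine Finset.sum_eq_zero fun w _ => ?_
        split_ifs with h
        · refine hadj v w fun hvw => ?_
          exact absurd (ht.k_le w v hv0 hvw) (not_le.2 h)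
        · rfl
      rw [h2, add_zero] at h1
      rw [← h1, add_assoc, CharTwo.add_self_eq_zero, add_zero]
    have trees : (∑ a, ∑ b, if lev a = j ∧ lev b = j + 1 ∧
        dartPos k M rk a b < dartPos k M rk (par v) v then C a b else 0) =
        ∑ b, if lev b = j + 1 ∧ rk b < rk v then C b (par b) else 0 := by
      rw [Finset.sum_comm]
      refine Finset.sum_congr rfl fun b _ => ?_
      by_cases hb : lev b = j + 1
      swap
      · simp [hb]
      have hb0 : 0 < lev b := by omega
      have hbl := ht.lev_par b hb0
      rw [Finset.sum_eq_single (par b)]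
      · rw [ht.rk_eq b hb0, ht.rk_eq v hv0, hs]
        have : lev (par b) = j := by omega
        simp only [hb, this, true_and]
        rfl
      · intro a _ ha
        split_ifs with h
        · by_contra hC
          exact ha (htree a b (by omega) (by omega) hC)
        · rfl
      · simp
    have blk : ∀ a, lev a = j + 1 → (∑ b, if lev b = j + 1 + 1 then C a b else 0) =
        C a (par a) := by
      intro a ha
      have ha0 : 0 < lev a := by omega
      have hal := ht.lev_par a ha0
      rw [← sub_eq_zero, CharTwo.sub_eq_add]
      have e : C a (par a) = ∑ b, if b = par a then C a b else 0 := by simp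
      rw [e, ← Finset.sum_add_distrib]
      refine Eq.trans (Finset.sum_congr rfl fun b _ => ?_) (heven a)
      by_cases hb : lev b = j + 1 + 1
      · have : b ≠ par a := by rintro rfl; omega
        simp [hb, this]
      · by_cases hbp : b = par a
        · subst hbp
          simp [hb]
        · simp [hb, hbp, hdown a b ha hb hbp]
    rw [split (j + 1) v u hv, gv, trees]
    have e1 : (∑ a, if lev a = j + 1 ∧ rk a < rk v then
        ∑ b, if lev b = j + 1 + 1 then C a b else 0 else 0) =
        ∑ b, if lev b = j + 1 ∧ rk b < rk v then C b (par b) else 0 := by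
      refine Finset.sum_congr rfl fun a _ => ?_
      by_cases ha : lev a = j + 1
      · simp only [blk a ha]
      · simp [ha]
    rw [e1, add_assoc]
    congr 1
    have e : C v (par v) = ∑ b, if b = par v then C v b else 0 := by simp
    rw [e, ← Finset.sum_add_distrib]
    refine Finset.sum_congr rfl fun b _ => ?_
    by_cases hb : lev b = j + 1 + 1
    · have : b ≠ par v := by rintro rfl; omega
      simp [hb, this]
    · by_cases hbp : b = par v
      · have hlt : k v (par v) < k v u := by
          refine lt_of_le_of_ne (ht.k_le u v hv0 hvu) fun he => ?_
          have := hk.inj v _ _ hpv.symm hvu he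
          rw [← this] at hu
          omega
        subst hbp
        simp only [if_true, hlt, hb, false_and, if_false, CharTwo.add_self_eq_zero]
      · simp [hb, hbp, hdown v b hv hb hbp]

end

open Classical in
/-- A mod 2 chain of edges with boundary `x + y`. -/
structure IsPathChain {W : Type*} [Fintype W] (r : W → W → Prop) (x y : W)
    (C : W → W → ZMod 2) : Prop where
  symm : ∀ a b, C a b = C b a
  supp : ∀ a b, C a b ≠ 0 → r a b ∨ r b a
  boundary : ∀ a, ∑ b, C a b = (if a = x then 1 else 0) + if a = y then 1 else 0

open Classical in
theorem IsPathChain.single {W : Type*} [Fintype W] {r : W → W → Prop} {x y : W} (h : r x y)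
    (hne : x ≠ y) : IsPathChain r x y
      (fun a b => if (a = x ∧ b = y) ∨ (a = y ∧ b = x) then 1 else 0) := by
  refine ⟨fun a b => ?_, fun a b hC => ?_, fun a => ?_⟩
  · refine if_congr ?_ rfl rfl
    tauto
  · by_cases hc : (a = x ∧ b = y) ∨ (a = y ∧ b = x)
    · rcases hc with ⟨rfl, rfl⟩ | ⟨rfl, rfl⟩
      · exact Or.inl h
      · exact Or.inr h
    · simp [hc] at hC
  · by_cases h1 : a = x
    · subst h1
      simp [hne]
    · by_cases h2 : a = y
      · subst h2
        simp [h1]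
      · simp [h1, h2]

theorem IsPathChain.add {W : Type*} [Fintype W] {r r' : W → W → Prop} {x y z : W}
    {C C' : W → W → ZMod 2} (h : IsPathChain r x y C) (h' : IsPathChain r' y z C') :
    IsPathChain (fun a b => r a b ∨ r' a b) x z (fun a b => C a b + C' a b) := by
  refine ⟨fun a b => ?_, fun a b hC => ?_, fun a => ?_⟩
  · rw [h.symm, h'.symm]
  · by_cases h1 : C a b = 0
    · have h2 : C' a b ≠ 0 := by
        intro h2; simp [h1, h2] at hC
      rcases h'.supp a b h2 with h3 | h3
      · exact Or.inl (Or.inr h3)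
      · exact Or.inr (Or.inr h3)
    · rcases h.supp a b h1 with h3 | h3
      · exact Or.inl (Or.inl h3)
      · exact Or.inr (Or.inl h3)
  · classical
    rw [Finset.sum_add_distrib, h.boundary, h'.boundary]
    have : ∀ p q s : ZMod 2, p + q + (q + s) = p + s := by decide
    exact this _ _ _

theorem IsPathChain.reverse {W : Type*} [Fintype W] {r : W → W → Prop} {x y : W}
    {C : W → W → ZMod 2} (h : IsPathChain r x y C) : IsPathChain r y x C :=
  ⟨h.symm, h.supp, fun a => by rw [h.boundary, add_comm]⟩

theorem exists_isPathChain {W : Type*} [Fintype W] {r : W → W → Prop} (hr : ∀ a, ¬ r a a)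
    {x y : W} (h : Relation.ReflTransGen r x y) : ∃ C, IsPathChain r x y C := by
  induction h with
  | refl =>
    refine ⟨fun _ _ => 0, fun _ _ => rfl, fun _ _ h => absurd rfl h, fun a => ?_⟩
    simp [CharTwo.add_self_eq_zero]
  | tail _ hbc ih =>
    obtain ⟨C, hC⟩ := ih
    have := hC.add (IsPathChain.single hbc (fun e => hr _ (e ▸ hbc)))
    exact ⟨_, this.symm, fun a b hab => by simpa using this.supp a b hab, this.boundary⟩

/-- Adjacency within a vertex set. -/
def AdjIn {W : Type*} (H : SimpleGraph W) (A : Set W) (x y : W) : Prop :=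
  H.Adj x y ∧ x ∈ A ∧ y ∈ A

/-- Two vertices are linked in `A` if a walk inside `A` joins them. -/
def LinkedIn {W : Type*} (H : SimpleGraph W) (A : Set W) (x y : W) : Prop :=
  Relation.ReflTransGen (AdjIn H A) x y

theorem LinkedIn.reachable {W : Type*} {H : SimpleGraph W} {A : Set W} {x y : W}
    (h : LinkedIn H A x y) : H.Reachable x y := by
  induction h with
  | refl => exact SimpleGraph.Reachable.refl _
  | tail _ hbc ih => exact ih.trans hbc.1.reachable

theorem AdjIn.symm {W : Type*} {H : SimpleGraph W} {A : Set W} {x y : W}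
    (h : AdjIn H A x y) : AdjIn H A y x := ⟨h.1.symm, h.2.2, h.2.1⟩

theorem LinkedIn.symm {W : Type*} {H : SimpleGraph W} {A : Set W} {x y : W}
    (h : LinkedIn H A x y) : LinkedIn H A y x := by
  induction h with
  | refl => exact Relation.ReflTransGen.refl
  | tail _ hbc ih => exact Relation.ReflTransGen.head hbc.symm ih

section
variable {W : Type*} {H : SimpleGraph W} {lev : W → ℕ} {k : W → W → ℕ} {M : ℕ}
  {par : W → W} {rk : W → ℤ}

/-- Tree edges up to level `n`. -/
def TreeEdge (lev : W → ℕ) (par : W → W) (n : ℕ) (a b : W) : Prop :=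
  a = par b ∧ 0 < lev b ∧ lev b ≤ n

theorem RankedTree.exists_treePath (ht : RankedTree H lev k M par rk) {n : ℕ} (v : W)
    (hv : lev v ≤ n) : ∃ z, lev z = 0 ∧ H.Reachable z v ∧
      Relation.ReflTransGen (TreeEdge lev par n) z v := by
  induction hm : lev v generalizing v with
  | zero => exact ⟨v, hm, SimpleGraph.Reachable.refl _, Relation.ReflTransGen.refl⟩
  | succ m ih =>
    have hv0 : 0 < lev v := by omega
    have := ht.lev_par v hv0
    obtain ⟨z, hz, hzu, hp⟩ := ih (par v) (by omega) (by omega)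
    exact ⟨z, hz, hzu.trans (ht.adj v hv0).reachable, hp.tail ⟨rfl, hv0, hv⟩⟩

theorem sum_sum_ite_of_unique [Fintype W] {C : W → W → ZMod 2} (P : W → W → Prop)
    [∀ a b, Decidable (P a b)] (s : Finset (W × W))
    (hs : ∀ a b, P a b → C a b ≠ 0 → (a, b) ∈ s) (hP : ∀ q ∈ s, P q.1 q.2) :
    (∑ a, ∑ b, if P a b then C a b else 0) = ∑ q ∈ s, C q.1 q.2 := by
  rw [← Fintype.sum_prod_type' (f := fun a b => if P a b then C a b else 0)]
  rw [← Finset.sum_subset (Finset.subset_univ s)]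
  · exact Finset.sum_congr rfl fun q hq => if_pos (hP q hq)
  · intro q _ hq
    split_ifs with h
    · by_contra hC
      exact hq (hs q.1 q.2 h hC)
    · rfl

/-- Disjoint connected sets above level `n` do not interleave their darts from level `n`. -/
theorem RankedTree.not_interleaved [Fintype W] (hk : RotationKey H k M)
    (hl : IsLeveling H lev) (ht : RankedTree H lev k M par rk) {n : ℕ} {A B : Set W}
    (hAB : Disjoint A B) (hA : ∀ x ∈ A, n < lev x) (hB : ∀ x ∈ B, n < lev x)
    {u₁ u₂ u₃ u₄ e₁ e₂ g₁ g₂ : W} (hu₁ : lev u₁ = n) (hu₂ : lev u₂ = n) (hu₃ : lev u₃ = n)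
    (hu₄ : lev u₄ = n) (a₁ : H.Adj u₁ e₁) (a₂ : H.Adj u₂ g₁) (a₃ : H.Adj u₃ e₂)
    (a₄ : H.Adj u₄ g₂) (he₁ : e₁ ∈ A) (he₂ : e₂ ∈ A) (hg₁ : g₁ ∈ B) (hg₂ : g₂ ∈ B)
    (hA' : LinkedIn H A e₁ e₂) (hB' : LinkedIn H B g₁ g₂)
    (h₁₂ : dartPos k M rk u₁ e₁ < dartPos k M rk u₂ g₁)
    (h₂₃ : dartPos k M rk u₂ g₁ < dartPos k M rk u₃ e₂)
    (h₃₄ : dartPos k M rk u₃ e₂ < dartPos k M rk u₄ g₂) : False := by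
  classical
  have lev_e : ∀ u e, lev u = n → H.Adj u e → n < lev e → lev e = n + 1 := by
    intro u e hu hue he
    rcases hl.adj u e hue with h | h <;> omega
  have le₁ := lev_e _ _ hu₁ a₁ (hA _ he₁)
  have le₂ := lev_e _ _ hu₃ a₃ (hA _ he₂)
  have lg₁ := lev_e _ _ hu₂ a₂ (hB _ hg₁)
  have lg₂ := lev_e _ _ hu₄ a₄ (hB _ hg₂)
  obtain ⟨z, hz0, hz, hzp⟩ := ht.exists_treePath u₁ hu₁.le
  obtain ⟨z', hz0', hz', hzp'⟩ := ht.exists_treePath u₃ hu₃.le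
  have hzz : z' = z := by
    refine hl.root _ _ hz0' hz0 ?_
    exact hz'.trans (a₃.reachable.trans (hA'.symm.reachable.trans (a₁.symm.reachable.trans hz.symm)))
  subst hzz
  have htirr : ∀ a, ¬ TreeEdge lev par n a a := by
    rintro a ⟨h1, h2, -⟩
    have := ht.lev_par a h2
    rw [← h1] at this
    omega
  obtain ⟨C₁, hC₁⟩ := exists_isPathChain htirr hzp
  obtain ⟨C₃, hC₃⟩ := exists_isPathChain htirr hzp'
  obtain ⟨C₂, hC₂⟩ := exists_isPathChain (fun a h => H.loopless.irrefl a h.1) hA'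
  have hE₁ := IsPathChain.single (r := fun a b => a = u₁ ∧ b = e₁) ⟨rfl, rfl⟩ a₁.ne
  have hE₂ := IsPathChain.single (r := fun a b => a = e₂ ∧ b = u₃) ⟨rfl, rfl⟩ a₃.symm.ne
  have hsum := (((hC₁.add hE₁).add hC₂).add hE₂).add hC₃.reverse
  set E₁ : W → W → ZMod 2 := fun a b => if (a = u₁ ∧ b = e₁) ∨ (a = e₁ ∧ b = u₁) then 1 else 0
    with hE₁d
  set E₂ : W → W → ZMod 2 := fun a b => if (a = e₂ ∧ b = u₃) ∨ (a = u₃ ∧ b = e₂) then 1 else 0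
    with hE₂d
  set C : W → W → ZMod 2 := fun a b => C₁ a b + E₁ a b + C₂ a b + E₂ a b + C₃ a b with hC
  have heven : ∀ a, ∑ b, C a b = 0 := fun a => by
    rw [hsum.boundary, CharTwo.add_self_eq_zero]
  have hTadj : ∀ a b, TreeEdge lev par n a b → H.Adj a b := by
    rintro a b ⟨rfl, h2, -⟩
    exact ht.adj b h2
  have hadj : ∀ a b, ¬ H.Adj a b → C a b = 0 := by
    intro a b hab
    by_contra hne
    apply hab
    have key : ∀ a b, ((((TreeEdge lev par n a b ∨ (a = u₁ ∧ b = e₁)) ∨ AdjIn H A a b) ∨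
        (a = e₂ ∧ b = u₃)) ∨ TreeEdge lev par n a b) → H.Adj a b := by
      rintro a b ((((h | ⟨rfl, rfl⟩) | h) | ⟨rfl, rfl⟩) | h)
      · exact hTadj _ _ h
      · exact a₁
      · exact h.1
      · exact a₃.symm
      · exact hTadj _ _ h
    rcases hsum.supp a b hne with h | h
    · exact key _ _ h
    · exact (key _ _ h).symm
  have hT0 : ∀ D x y, IsPathChain (TreeEdge lev par n) x y D → ∀ a b, n < lev a ∨ n < lev b →
      D a b = 0 := by
    intro D x y hD a b hab
    by_contra hne
    have key : ∀ a b, TreeEdge lev par n a b → lev a ≤ n ∧ lev b ≤ n := by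
      rintro a b ⟨rfl, h2, h3⟩
      have := ht.lev_par b h2
      omega
    rcases hD.supp a b hne with h | h
    · have := key _ _ h; omega
    · have := key _ _ h; omega
  have hA0 : ∀ a b, a ∉ A ∨ b ∉ A → C₂ a b = 0 := by
    intro a b hab
    by_contra hne
    rcases hC₂.supp a b hne with h | h
    · have := h.2; tauto
    · have := h.2; tauto
  obtain ⟨g, hg0, hg⟩ := hk.exists_normalized hl C hsum.symm hadj heven
  have htree : ∀ a b, lev b = lev a + 1 → lev a < n → C a b ≠ 0 → a = par b := by
    intro a b hab ha hne
    have hE1 : E₁ a b = 0 := by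
      rw [hE₁d]
      refine if_neg ?_
      rintro (⟨rfl, rfl⟩ | ⟨rfl, rfl⟩) <;> omega
    have hE2 : E₂ a b = 0 := by
      rw [hE₂d]
      refine if_neg ?_
      rintro (⟨rfl, rfl⟩ | ⟨rfl, rfl⟩) <;> omega
    have hC2 : C₂ a b = 0 := hA0 a b (Or.inl fun h => absurd (hA a h) (by omega))
    have key : ∀ D x y, IsPathChain (TreeEdge lev par n) x y D → D a b ≠ 0 → a = par b := by
      intro D x y hD hne
      rcases hD.supp a b hne with h | h
      · exact h.1
      · obtain ⟨rfl, h2, -⟩ := h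
        have := ht.lev_par a h2
        omega
    by_cases h1 : C₁ a b = 0
    · refine key _ _ _ hC₃ fun h3 => hne ?_
      simp only [hC, hE1, hE2, hC2, h1, h3, add_zero]
    · exact key _ _ _ hC₁ h1
  have hpot := ht.potential_eq_sum_earlier hk hl hsum.symm hadj heven hg0 hg htree n le_rfl
  have hCn : ∀ a b, lev a = n → lev b = n + 1 →
      C a b = (if a = u₁ ∧ b = e₁ then 1 else 0) + if a = u₃ ∧ b = e₂ then 1 else 0 := by
    intro a b ha hb
    have h1 := hT0 _ _ _ hC₁ a b (Or.inr (by omega))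
    have h3 := hT0 _ _ _ hC₃ a b (Or.inr (by omega))
    have h2 : C₂ a b = 0 := hA0 a b (Or.inl fun h => absurd (hA a h) (by omega))
    have f1 : ¬ (a = e₁ ∧ b = u₁) := by rintro ⟨rfl, rfl⟩; omega
    have f2 : ¬ (a = e₂ ∧ b = u₃) := by rintro ⟨rfl, rfl⟩; omega
    simp only [hC, h1, h2, h3, hE₁d, hE₂d, f1, f2, or_false, false_or, zero_add, add_zero]
  have hd13 : (u₁, e₁) ≠ (u₃, e₂) := by
    intro h
    rw [Prod.mk.injEq] at h
    rw [h.1, h.2] at h₁₂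
    omega
  have v1 : C u₁ e₁ = 1 := by
    rw [hCn _ _ hu₁ le₁, if_pos ⟨rfl, rfl⟩, if_neg, add_zero]
    rintro ⟨h, h'⟩
    exact hd13 (by rw [h, h'])
  have v3 : C u₃ e₂ = 1 := by
    rw [hCn _ _ hu₃ le₂, if_neg, if_pos ⟨rfl, rfl⟩, zero_add]
    rintro ⟨h, h'⟩
    exact hd13 (by rw [h, h'])
  have hsupp : ∀ a b, lev a = n → lev b = n + 1 → C a b ≠ 0 →
      (a, b) = (u₁, e₁) ∨ (a, b) = (u₃, e₂) := by
    intro a b ha hb hne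
    rw [hCn a b ha hb] at hne
    by_contra hcon
    push Not at hcon
    apply hne
    rw [if_neg (by rintro ⟨rfl, rfl⟩; exact hcon.1 rfl),
      if_neg (by rintro ⟨rfl, rfl⟩; exact hcon.2 rfl), add_zero]
  have s2 := hpot u₂ g₁ hu₂ lg₁ a₂
  have s4 := hpot u₄ g₂ hu₄ lg₂ a₄
  rw [sum_sum_ite_of_unique (fun a b => lev a = n ∧ lev b = n + 1 ∧
    dartPos k M rk a b < dartPos k M rk u₂ g₁) {(u₁, e₁)}] at s2
  rotate_left
  · rintro a b ⟨h1, h2, h3⟩ hne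
    rcases hsupp a b h1 h2 hne with h | h
    · simpa using h
    · rw [Prod.mk.injEq] at h
      rw [h.1, h.2] at h3
      omega
  · intro q hq
    rw [Finset.mem_singleton] at hq
    subst hq
    exact ⟨hu₁, le₁, h₁₂⟩
  rw [sum_sum_ite_of_unique (fun a b => lev a = n ∧ lev b = n + 1 ∧
    dartPos k M rk a b < dartPos k M rk u₄ g₂) {(u₁, e₁), (u₃, e₂)}] at s4
  rotate_left
  · rintro a b ⟨h1, h2, h3⟩ hne
    simpa using hsupp a b h1 h2 hne
  · intro q hq
    rw [Finset.mem_insert, Finset.mem_singleton] at hq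
    rcases hq with rfl | rfl
    · exact ⟨hu₁, le₁, h₁₂.trans (h₂₃.trans h₃₄)⟩
    · exact ⟨hu₃, le₂, by omega⟩
  rw [Finset.sum_singleton, v1] at s2
  rw [Finset.sum_pair hd13, v1, v3] at s4
  have hBz : ∀ x ∈ B, ∀ y, C x y = 0 := by
    intro x hx y
    have hxA : x ∉ A := fun h => Set.disjoint_left.1 hAB h hx
    have hxn := hB x hx
    have n1 : x ≠ e₁ := by rintro rfl; exact hxA he₁
    have n2 : x ≠ e₂ := by rintro rfl; exact hxA he₂
    have n3 : x ≠ u₁ := by rintro rfl; omega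
    have n4 : x ≠ u₃ := by rintro rfl; omega
    simp only [hC, hT0 _ _ _ hC₁ x y (Or.inl hxn), hT0 _ _ _ hC₃ x y (Or.inl hxn),
      hA0 x y (Or.inl hxA), hE₁d, hE₂d, n1, n2, n3, n4, false_and, or_self, if_false, add_zero]
  have hgB : ∀ x y, AdjIn H B x y → g x = g y := by
    rintro x y ⟨hxy, hx, hy⟩
    have := hg x y hxy
    simpa [hBz x hx, hBz y hy] using this
  have hgg' : ∀ x, LinkedIn H B g₁ x → g g₁ = g x := by
    intro x hx
    induction hx with
    | refl => rfl
    | tail _ hbc ih => exact ih.trans (hgB _ _ hbc)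
  have hgg := hgg' _ hB'
  have r2 := hg u₂ g₁ a₂
  have r4 := hg u₄ g₂ a₄
  simp only [hBz _ hg₁, hBz _ hg₂, hsum.symm u₂ g₁, hsum.symm u₄ g₂, ite_self,
    Finset.sum_const_zero, add_zero] at r2 r4
  rw [s2] at r2
  rw [s4] at r4
  rw [← hgg, ← r2] at r4
  exact absurd r4 (by decide)

end

/-- The combinatorial layer structure: levels, parents, the signed position `a u w` of a dart
among the darts leaving the level of `u`, and the signed rank `R` of a vertex in its level. -/
structure Layering {W : Type*} (H : SimpleGraph W) (lev : W → ℕ) (par : W → W) (a : W → W → ℤ)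
    (R : W → ℤ) : Prop extends IsLeveling H lev where
  par_adj : ∀ v, 0 < lev v → H.Adj (par v) v
  par_lev : ∀ v, 0 < lev v → lev (par v) + 1 = lev v
  par_min : ∀ u v, H.Adj u v → lev v = lev u + 1 → a (par v) v ≤ a u v
  R_odd : ∀ v, Odd (lev v) → R v = a (par v) v
  R_even : ∀ v, Even (lev v) → 0 < lev v → R v = -a (par v) v
  R_inj : ∀ u v, lev u = lev v → R u = R v → u = v
  a_lt : ∀ u v w z, lev u = lev v → R u < R v → a u w < a v z
  a_inj : ∀ u w w', H.Adj u w → H.Adj u w' → a u w = a u w' → w = w'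
  cross : ∀ (n : ℕ) (A B : Set W), Disjoint A B → (∀ x ∈ A, n < lev x) → (∀ x ∈ B, n < lev x) →
    ∀ u₁ u₂ u₃ u₄ e₁ e₂ g₁ g₂ : W, lev u₁ = n → lev u₂ = n → lev u₃ = n → lev u₄ = n →
      H.Adj u₁ e₁ → H.Adj u₂ g₁ → H.Adj u₃ e₂ → H.Adj u₄ g₂ → e₁ ∈ A → e₂ ∈ A → g₁ ∈ B →
      g₂ ∈ B → LinkedIn H A e₁ e₂ → LinkedIn H B g₁ g₂ → a u₁ e₁ < a u₂ g₁ →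
      a u₂ g₁ < a u₃ e₂ → a u₃ e₂ < a u₄ g₂ → False

theorem levelSign_succ_of_even {n : ℕ} (h : Even n) : levelSign (n + 1) = levelSign n := by
  obtain ⟨m, rfl⟩ := h
  unfold levelSign
  congr 1
  omega

theorem levelSign_succ_of_odd {n : ℕ} (h : Odd n) : levelSign (n + 1) = -levelSign n := by
  obtain ⟨m, rfl⟩ := h
  unfold levelSign
  have h1 : (2 * m + 1 + 1) / 2 = m + 1 := by omega
  have h2 : (2 * m + 1) / 2 = m := by omega
  rw [h1, h2, pow_succ]
  ring

theorem RankedTree.layering {W : Type*} [Fintype W] {H : SimpleGraph W} {lev : W → ℕ}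
    {k : W → W → ℕ} {M : ℕ} {par : W → W} {rk : W → ℤ} (hk : RotationKey H k M)
    (hl : IsLeveling H lev) (ht : RankedTree H lev k M par rk) :
    Layering H lev par (fun u w => levelSign (lev u) * dartPos k M rk u w)
      (fun u => levelSign (lev u) * rk u) where
  toIsLeveling := hl
  par_adj := ht.adj
  par_lev := ht.lev_par
  par_min u v huv hv := by
    have h1 := ht.lev_par v (by omega)
    have h2 : lev (par v) = lev u := by omega
    rw [h2]
    exact ht.le u v huv hv
  R_odd v hv := by
    have h0 : 0 < lev v := hv.pos
    have h1 := ht.lev_par v h0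
    have h2 : Even (lev (par v)) := by
      rw [← h1] at hv
      rcases Nat.even_or_odd (lev (par v)) with h | h
      · exact h
      · exact absurd hv (Nat.not_odd_iff_even.2 h.add_one)
    simp only [← h1, levelSign_succ_of_even h2, ht.rk_eq v h0, dartPos]
  R_even v hv h0 := by
    have h1 := ht.lev_par v h0
    have h2 : Odd (lev (par v)) := by
      rw [← h1] at hv
      rcases Nat.even_or_odd (lev (par v)) with h | h
      · exact absurd hv (Nat.not_even_iff_odd.2 h.add_one)
      · exact h
    simp only [← h1, levelSign_succ_of_odd h2, ht.rk_eq v h0, dartPos, neg_mul]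
  R_inj u v he h := by
    refine ht.rk_inj hk he ?_
    simp only [he] at h
    rcases levelSign_cases (lev v) with h1 | h1 <;> rw [h1] at h <;> linarith
  a_lt u v w z he h := by
    have key : ∀ u v w z, rk u < rk v → dartPos k M rk u w < dartPos k M rk v z :=
      fun u v w z h => (mul_add_lt_mul_add_iff (hk.lt u w) (hk.lt v z)).2 (Or.inl h)
    simp only [he] at h ⊢
    rcases levelSign_cases (lev v) with h1 | h1 <;> rw [h1] at h ⊢
    · linarith [key u v w z (by linarith)]
    · linarith [key v u z w (by linarith)]
  a_inj u w w' hw hw' h := by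
    refine hk.inj u w w' hw hw' ?_
    have : dartPos k M rk u w = dartPos k M rk u w' := by
      rcases levelSign_cases (lev u) with h1 | h1 <;> simp only [h1] at h <;> linarith
    unfold dartPos at this
    have h2 : (k u w : ℤ) = k u w' := by linarith
    exact_mod_cast h2
  cross n A B hAB hA hB u₁ u₂ u₃ u₄ e₁ e₂ g₁ g₂ hu₁ hu₂ hu₃ hu₄ a₁ a₂ a₃ a₄ he₁ he₂ hg₁ hg₂
      hA' hB' h₁₂ h₂₃ h₃₄ := by
    simp only [hu₁, hu₂, hu₃, hu₄] at h₁₂ h₂₃ h₃₄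
    rcases levelSign_cases n with h1 | h1 <;> simp only [h1] at h₁₂ h₂₃ h₃₄
    · exact ht.not_interleaved hk hl hAB hA hB hu₁ hu₂ hu₃ hu₄ a₁ a₂ a₃ a₄ he₁ he₂ hg₁ hg₂ hA' hB'
        (by linarith) (by linarith) (by linarith)
    · exact ht.not_interleaved hk hl hAB.symm hB hA hu₄ hu₃ hu₂ hu₁ a₄ a₃ a₂ a₁ hg₂ hg₁ he₂ he₁
        hB'.symm hA'.symm (by linarith) (by linarith) (by linarith)

theorem IsPlaneDrawing.exists_layering {W : Type*} [Fintype W] {H : SimpleGraph W}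
    {pos : W → ℝ × ℝ} (h : IsPlaneDrawing H pos) {lev : W → ℕ} (hl : IsLeveling H lev) :
    ∃ par a R, Layering H lev par a R := by
  obtain ⟨key, N, hkey⟩ := h.exists_rotationKey
  obtain ⟨k, M, par, rk, hk, ht⟩ := hkey.exists_rankedTree hl
  exact ⟨_, _, _, ht.layering hk hl⟩

/-- Distances to a set of roots, one in each component, taken from a given side of a bipartition
whenever the component meets it. -/
theorem exists_isLeveling {W : Type*} (H : SimpleGraph W) (S : Set W)
    (hS : ∀ u v, H.Adj u v → (u ∈ S ↔ v ∉ S)) :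
    ∃ lev, IsLeveling H lev ∧ ∀ u ∈ S, Even (lev u) := by
  classical
  have hex : ∀ c : H.ConnectedComponent, ∃ r, H.connectedComponentMk r = c ∧
      ((∃ s ∈ S, H.connectedComponentMk s = c) → r ∈ S) := by
    intro c
    by_cases h : ∃ s ∈ S, H.connectedComponentMk s = c
    · obtain ⟨s, hs, hc⟩ := h
      exact ⟨s, hc, fun _ => hs⟩
    · obtain ⟨r, hr⟩ := c.exists_rep
      exact ⟨r, hr, fun h' => absurd h' h⟩
  choose ρ hρ hρS using hex
  set r : W → W := fun v => ρ (H.connectedComponentMk v) with hr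
  have hreach : ∀ v, H.Reachable (r v) v := fun v =>
    SimpleGraph.ConnectedComponent.exact (hρ _)
  have hradj : ∀ u v, H.Reachable u v → r u = r v := by
    intro u v huv
    simp only [hr, SimpleGraph.ConnectedComponent.sound huv]
  have hpar : ∀ u v (p : H.Walk u v), (u ∈ S ↔ v ∈ S) ↔ Even p.length := by
    intro u v p
    induction p with
    | nil => simp
    | cons h p ih =>
      rw [SimpleGraph.Walk.length_cons, Nat.even_add_one, ← ih, hS _ _ h]
      tauto
  have hdist : ∀ v, (r v ∈ S ↔ v ∈ S) ↔ Even (H.dist (r v) v) := by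
    intro v
    obtain ⟨p, hp⟩ := (hreach v).exists_walk_length_eq_dist
    rw [← hp]
    exact hpar _ _ p
  have hle : ∀ u v, H.Adj u v → H.dist (r v) v ≤ H.dist (r u) u + 1 := by
    intro u v huv
    rw [hradj u v huv.reachable] at *
    obtain ⟨p, hp⟩ := (hradj u v huv.reachable ▸ hreach u :
      H.Reachable (r v) u).exists_walk_length_eq_dist
    have := SimpleGraph.dist_le (p.append huv.toWalk)
    rw [SimpleGraph.Walk.length_append, hp] at this
    simpa using this
  have hS' : ∀ u ∈ S, Even (H.dist (r u) u) := by
    intro u hu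
    rw [← hdist]
    exact ⟨fun _ => hu, fun _ => hρS _ ⟨u, hu, rfl⟩⟩
  refine ⟨fun v => H.dist (r v) v, ⟨?_, ?_, ?_⟩, hS'⟩
  · intro u v huv
    have h1 := hle u v huv
    have h2 := hle v u huv.symm
    have h3 : H.dist (r v) v ≠ H.dist (r u) u := by
      intro he
      have h4 := hdist u
      have h5 := hdist v
      have h6 := hS u v huv
      rw [he, ← h4, hradj u v huv.reachable] at h5
      tauto
    omega
  · intro v n hn
    obtain ⟨p, hp⟩ := (hreach v).exists_walk_length_eq_dist
    have hpn : ¬ p.Nil := by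
      intro h
      have := SimpleGraph.Walk.length_eq_zero_iff.2 h
      omega
    refine ⟨p.penultimate, p.adj_penultimate hpn, ?_⟩
    have h1 := hle _ _ (p.adj_penultimate hpn)
    have h2 : H.dist (r p.penultimate) p.penultimate ≤ p.dropLast.length := by
      rw [hradj _ _ (p.adj_penultimate hpn).reachable]
      exact SimpleGraph.dist_le _
    have h3 : p.dropLast.length + 1 = p.length := SimpleGraph.Walk.length_dropLast_add_one hpn
    omega
  · intro u v hu hv huv
    have h1 := (hreach u).dist_eq_zero_iff.1 hu
    have h2 := (hreach v).dist_eq_zero_iff.1 hv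
    rw [← h1, ← h2, hradj u v huv]

/-- A graph together with a layer structure. -/
structure Layered (W : Type*) where
  /-- the underlying graph -/
  graph : SimpleGraph W
  /-- the level function -/
  lev : W → ℕ
  /-- the parent function -/
  par : W → W
  /-- the position of a dart among the darts leaving a level -/
  a : W → W → ℤ
  /-- the signed rank of a vertex in its level -/
  R : W → ℤ
  isLayering : Layering graph lev par a R

namespace Layered

variable {W : Type*} (L : Layered W)

/-- The dart from `p` to `y` goes up one level. -/
def Up (p y : W) : Prop := L.graph.Adj p y ∧ L.lev y = L.lev p + 1

/-- The position of the first dart entering `y` from below. -/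
def dm (y : W) : ℤ := L.a (L.par y) y

/-- Being joined by a walk that stays on levels at least `m`. -/
def Con (m : ℕ) (u v : W) : Prop := LinkedIn L.graph {x | m ≤ L.lev x} u v

variable {L}

theorem lev_lt_of_up {p y : W} (h : L.Up p y) : 0 < L.lev y := by
  have := h.2; omega

theorem up_par {y : W} (h : 0 < L.lev y) : L.Up (L.par y) y :=
  ⟨L.isLayering.par_adj y h, (L.isLayering.par_lev y h).symm⟩

theorem up_of_adj {p y : W} (h : L.graph.Adj p y) : L.Up p y ∨ L.Up y p := by
  rcases L.isLayering.adj p y h with h1 | h1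
  · exact Or.inl ⟨h, h1⟩
  · exact Or.inr ⟨h.symm, h1⟩

theorem dm_le {p y : W} (h : L.Up p y) : L.dm y ≤ L.a p y :=
  L.isLayering.par_min p y h.1 h.2

theorem R_le_of_a_le {u v w z : W} (hl : L.lev u = L.lev v) (h : L.a u w ≤ L.a v z) :
    L.R u ≤ L.R v := by
  by_contra hlt
  push Not at hlt
  exact absurd (L.isLayering.a_lt v u z w hl.symm hlt) (not_lt.2 h)

theorem dart_eq {p q y z : W} (hp : L.Up p y) (hq : L.Up q z) (hl : L.lev y = L.lev z)
    (h : L.a p y = L.a q z) : p = q ∧ y = z := by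
  have hlev : L.lev p = L.lev q := by
    have := hp.2; have := hq.2; omega
  have hpq : p = q := L.isLayering.R_inj p q hlev
    (le_antisymm (R_le_of_a_le hlev h.le) (R_le_of_a_le hlev.symm h.ge))
  subst hpq
  exact ⟨rfl, L.isLayering.a_inj p y z hp.1 hq.1 h⟩

theorem dart_ne {p q y z : W} (hp : L.Up p y) (hq : L.Up q z) (hl : L.lev y = L.lev z)
    (hne : y ≠ z) : L.a p y ≠ L.a q z := fun h => hne (dart_eq hp hq hl h).2

theorem R_eq_dm {p : W} (h : Odd (L.lev p)) : L.R p = L.dm p := L.isLayering.R_odd p h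

theorem R_eq_neg_dm {y : W} (h : Even (L.lev y)) (h0 : 0 < L.lev y) : L.R y = -L.dm y :=
  L.isLayering.R_even y h h0

theorem dm_ne {y z : W} (hl : L.lev y = L.lev z) (h0 : 0 < L.lev y) (hne : y ≠ z) :
    L.dm y ≠ L.dm z :=
  dart_ne (up_par h0) (up_par (hl ▸ h0)) hl hne

theorem Con.symm {m : ℕ} {u v : W} (h : L.Con m u v) : L.Con m v u := LinkedIn.symm h

theorem Con.trans {m : ℕ} {u v w : W} (h : L.Con m u v) (h' : L.Con m v w) : L.Con m u w :=
  Relation.ReflTransGen.trans h h'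

theorem LinkedIn.mono {W : Type*} {H : SimpleGraph W} {A B : Set W} (hAB : A ⊆ B) {x y : W}
    (h : LinkedIn H A x y) : LinkedIn H B x y :=
  Relation.ReflTransGen.mono (fun _ _ h => ⟨h.1, hAB h.2.1, hAB h.2.2⟩) _ _ h

theorem Con.mono {m n : ℕ} (hmn : m ≤ n) {u v : W} (h : L.Con n u v) : L.Con m u v :=
  LinkedIn.mono (fun _ hx => le_trans hmn hx) h

theorem con_of_adj {m : ℕ} {u v : W} (h : L.graph.Adj u v) (hu : m ≤ L.lev u)
    (hv : m ≤ L.lev v) : L.Con m u v := Relation.ReflTransGen.single ⟨h, hu, hv⟩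

/-- A walk on levels at least `m` stays in its component. -/
theorem Con.linkedIn {m : ℕ} {u v z : W} (h : L.Con m u v) (hzu : L.Con m z u) :
    LinkedIn L.graph {x | m ≤ L.lev x ∧ L.Con m z x} u v := by
  induction h with
  | refl => exact Relation.ReflTransGen.refl
  | tail hab hbc ih =>
    exact ih.tail ⟨hbc.1, ⟨hbc.2.1, hzu.trans hab⟩, ⟨hbc.2.2, hzu.trans (hab.tail hbc)⟩⟩

/-- The interleaving property for two vertices of one level. -/
theorem cross_vertex {y z p₁ p₂ p₃ p₄ : W} (hne : y ≠ z) (hl : L.lev y = L.lev z)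
    (h₁ : L.Up p₁ y) (h₂ : L.Up p₂ z) (h₃ : L.Up p₃ y) (h₄ : L.Up p₄ z)
    (h₁₂ : L.a p₁ y < L.a p₂ z) (h₂₃ : L.a p₂ z < L.a p₃ y) (h₃₄ : L.a p₃ y < L.a p₄ z) :
    False := by
  have e₁ := h₁.2
  have e₂ := h₂.2
  have e₃ := h₃.2
  have e₄ := h₄.2
  refine L.isLayering.cross (L.lev p₁) {y} {z} (by simpa using hne) ?_ ?_ p₁ p₂ p₃ p₄ y y z z rfl
    (by omega) (by omega) (by omega) h₁.1 h₂.1 h₃.1 h₄.1 rfl rfl rfl rfl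
    Relation.ReflTransGen.refl Relation.ReflTransGen.refl h₁₂ h₂₃ h₃₄
  · rintro x rfl; omega
  · rintro x rfl; omega

/-- The interleaving property for a vertex and a connected set, the vertex coming first. -/
theorem cross_vertex_set {y z z' p₁ p₂ p₃ p₄ : W} {B : Set W} (hB : ∀ x ∈ B, L.lev y ≤ L.lev x)
    (hy : y ∉ B) (hz : z ∈ B) (hzz : LinkedIn L.graph B z z')
    (hl : L.lev z = L.lev y) (hl' : L.lev z' = L.lev y)
    (h₁ : L.Up p₁ y) (h₂ : L.Up p₂ z) (h₃ : L.Up p₃ y) (h₄ : L.Up p₄ z')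
    (h₁₂ : L.a p₁ y < L.a p₂ z) (h₂₃ : L.a p₂ z < L.a p₃ y) (h₃₄ : L.a p₃ y < L.a p₄ z') :
    False := by
  have e₁ := h₁.2
  have e₂ := h₂.2
  have e₃ := h₃.2
  have e₄ := h₄.2
  have hz' : z' ∈ B := by
    rcases Relation.ReflTransGen.cases_tail hzz with rfl | ⟨c, -, hc⟩
    · exact hz
    · exact hc.2.2
  refine L.isLayering.cross (L.lev p₁) {y} B (by simpa using hy) ?_ ?_ p₁ p₂ p₃ p₄ y y z z' rfl
    (by omega) (by omega) (by omega) h₁.1 h₂.1 h₃.1 h₄.1 rfl rfl hz hz'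
    Relation.ReflTransGen.refl hzz h₁₂ h₂₃ h₃₄
  · rintro x rfl; omega
  · intro x hx
    have := hB x hx; omega

/-- The interleaving property for a vertex and a connected set, the set coming first. -/
theorem cross_set_vertex {y z z' p₁ p₂ p₃ p₄ : W} {B : Set W} (hB : ∀ x ∈ B, L.lev y ≤ L.lev x)
    (hy : y ∉ B) (hz : z ∈ B) (hzz : LinkedIn L.graph B z z')
    (hl : L.lev z = L.lev y) (hl' : L.lev z' = L.lev y)
    (h₁ : L.Up p₁ z) (h₂ : L.Up p₂ y) (h₃ : L.Up p₃ z') (h₄ : L.Up p₄ y)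
    (h₁₂ : L.a p₁ z < L.a p₂ y) (h₂₃ : L.a p₂ y < L.a p₃ z') (h₃₄ : L.a p₃ z' < L.a p₄ y) :
    False := by
  have e₁ := h₁.2
  have e₂ := h₂.2
  have e₃ := h₃.2
  have e₄ := h₄.2
  have hz' : z' ∈ B := by
    rcases Relation.ReflTransGen.cases_tail hzz with rfl | ⟨c, -, hc⟩
    · exact hz
    · exact hc.2.2
  refine L.isLayering.cross (L.lev p₁) B {y} (by simpa using hy) ?_ ?_ p₁ p₂ p₃ p₄ z z' y y rfl
    (by omega) (by omega) (by omega) h₁.1 h₂.1 h₃.1 h₄.1 hz hz' rfl rfl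
    hzz Relation.ReflTransGen.refl h₁₂ h₂₃ h₃₄
  · intro x hx
    have := hB x hx; omega
  · rintro x rfl; omega

variable (L)

/-- `l` encloses `y`: the darts of `l` occur on both sides of the first dart of `y`. -/
def Enc (l y : W) : Prop :=
  L.lev l = L.lev y ∧ L.dm l < L.dm y ∧ ∃ p, L.Up p l ∧ L.dm y < L.a p l

/-- The darts entering the component of `y` above its level. -/
def compDarts (y : W) : Set ℤ :=
  {d | ∃ p z, L.Up p z ∧ L.lev z = L.lev y ∧ L.Con (L.lev y) z y ∧ d = L.a p z}

/-- The first dart entering the component of `y` above its level. -/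
noncomputable def fd (y : W) : ℤ := sInf (L.compDarts y)

/-- Candidates for the block key of `y`. -/
def blockKeys (y : W) : Set ℤ :=
  {c | c = 2 * L.fd y - 1 ∨ ∃ p l, L.Enc l y ∧ L.Up p l ∧ L.a p l < L.dm y ∧ c = 2 * L.a p l}

open Classical in
/-- The block key of a vertex of even level. -/
noncomputable def κ (y : W) : ℤ := if L.lev y = 0 then 2 * L.R y else sSup (L.blockKeys y)

variable {L}

theorem fd_eq {y z : W} (hl : L.lev z = L.lev y) (hc : L.Con (L.lev y) z y) :
    L.fd z = L.fd y := by
  unfold fd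
  congr 1
  ext d
  constructor
  · rintro ⟨p, w, h1, h2, h3, h4⟩
    exact ⟨p, w, h1, h2.trans hl, (hl ▸ h3).trans hc, h4⟩
  · rintro ⟨p, w, h1, h2, h3, h4⟩
    exact ⟨p, w, h1, h2.trans hl.symm, by rw [hl]; exact h3.trans hc.symm, h4⟩

theorem Enc.ne {l y : W} (h : L.Enc l y) : l ≠ y := by
  rintro rfl
  exact lt_irrefl _ h.2.1

variable [Finite W]

theorem fd_mem {y : W} (h0 : 0 < L.lev y) : L.fd y ∈ L.compDarts y := by
  have hfin : (L.compDarts y).Finite := by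
    refine (Set.finite_range fun q : W × W => L.a q.1 q.2).subset ?_
    rintro d ⟨p, z, -, -, -, rfl⟩
    exact ⟨(p, z), rfl⟩
  exact Int.csInf_mem ⟨L.dm y, L.par y, y, up_par h0, rfl, Relation.ReflTransGen.refl, rfl⟩
    hfin.bddBelow

theorem fd_le {y p z : W} (hp : L.Up p z) (hl : L.lev z = L.lev y) (hc : L.Con (L.lev y) z y) :
    L.fd y ≤ L.a p z := by
  have hfin : (L.compDarts y).Finite := by
    refine (Set.finite_range fun q : W × W => L.a q.1 q.2).subset ?_
    rintro d ⟨p, z, -, -, -, rfl⟩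
    exact ⟨(p, z), rfl⟩
  exact csInf_le hfin.bddBelow ⟨p, z, hp, hl, hc, rfl⟩

theorem lt_of_mem_blockKeys {y : W} (h0 : 0 < L.lev y) {c : ℤ} (hc : c ∈ L.blockKeys y) :
    c < 2 * L.dm y := by
  rcases hc with rfl | ⟨p, l, -, -, h, rfl⟩
  · have : L.fd y ≤ L.dm y := fd_le (up_par h0) rfl Relation.ReflTransGen.refl
    omega
  · omega

theorem κ_mem {y : W} (h0 : 0 < L.lev y) : L.κ y ∈ L.blockKeys y := by
  rw [κ, if_neg h0.ne']
  exact Int.csSup_mem ⟨2 * L.fd y - 1, Or.inl rfl⟩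
    ⟨2 * L.dm y, fun c hc => (lt_of_mem_blockKeys h0 hc).le⟩

theorem le_κ {y : W} (h0 : 0 < L.lev y) {c : ℤ} (hc : c ∈ L.blockKeys y) : c ≤ L.κ y := by
  rw [κ, if_neg h0.ne']
  exact le_csSup ⟨2 * L.dm y, fun c hc => (lt_of_mem_blockKeys h0 hc).le⟩ hc

theorem κ_lt {y : W} (h0 : 0 < L.lev y) : L.κ y < 2 * L.dm y :=
  lt_of_mem_blockKeys h0 (κ_mem h0)

theorem fd_le_κ {y : W} (h0 : 0 < L.lev y) : 2 * L.fd y - 1 ≤ L.κ y := le_κ h0 (Or.inl rfl)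

theorem le_κ_of_enc {y l p : W} (h0 : 0 < L.lev y) (he : L.Enc l y) (hp : L.Up p l)
    (h : L.a p l < L.dm y) : 2 * L.a p l ≤ L.κ y := le_κ h0 (Or.inr ⟨p, l, he, hp, h, rfl⟩)

/-- The block key of `y` is, up to rounding, a dart entering the component of `y`. -/
theorem exists_source {y : W} (h0 : 0 < L.lev y) : ∃ p z, L.Up p z ∧ L.lev z = L.lev y ∧
    L.Con (L.lev y) z y ∧ L.a p z ≤ L.dm y ∧ (L.κ y = 2 * L.a p z ∨ L.κ y = 2 * L.a p z - 1) := by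
  have hlt := κ_lt h0
  rcases κ_mem h0 with h | ⟨p, l, he, hp, hlt', h⟩
  · obtain ⟨p, z, hp, hz, hc, hd⟩ := fd_mem h0
    rw [hd] at h
    exact ⟨p, z, hp, hz, hc, by omega, Or.inr h⟩
  · refine ⟨p, l, hp, he.1, ?_, by omega, Or.inl h⟩
    have hfd := fd_le_κ h0
    obtain ⟨q, z, hq, hz, hc, hd⟩ := fd_mem h0
    rw [hd] at hfd
    by_cases hzl : z = l
    · exact hzl ▸ hc
    by_contra hcon
    obtain ⟨hll, hdm, p', hp', hlt''⟩ := id he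
    have hne : L.a q z ≠ L.a p l := dart_ne hq hp (by omega) hzl
    refine cross_set_vertex (L := L) (B := {x | L.lev y ≤ L.lev x ∧ L.Con (L.lev y) y x}) (y := l)
      (z := z) (z' := y) ?_ ?_ ?_ (hc.linkedIn hc.symm) (by omega) (by omega)
      hq hp (up_par h0) hp' (by omega) hlt' hlt''
    · intro x hx
      rw [hll]; exact hx.1
    · intro hx
      exact hcon hx.2.symm
    · exact ⟨hz.ge, hc.symm⟩

/-- Two vertices of one level with nested block keys have their darts in the reverse order. -/
theorem κ_nested {y₁ y₂ p₁ p₂ : W} (hl : L.lev y₁ = L.lev y₂) (h₁ : L.Up p₁ y₁)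
    (h₂ : L.Up p₂ y₂) (hκ : L.κ y₁ < L.κ y₂) (hκ₂ : L.κ y₂ < 2 * L.a p₁ y₁)
    (h : L.a p₁ y₁ < L.a p₂ y₂) : False := by
  have h0₁ := lev_lt_of_up h₁
  have h0₂ := lev_lt_of_up h₂
  have hne : y₁ ≠ y₂ := by rintro rfl; exact lt_irrefl _ hκ
  rcases κ_mem h0₂ with hk | ⟨p, l, he, hp, hlt, hk⟩
  · obtain ⟨q₂, z₂, hq₂, hz₂, hc₂, hd₂⟩ := fd_mem h0₂
    obtain ⟨q₁, z₁, hq₁, hz₁, hc₁, hd₁⟩ := fd_mem h0₁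
    have hf₁ := fd_le_κ h0₁
    have hncon : ¬ L.Con (L.lev y₂) y₁ y₂ := by
      intro hc
      rw [fd_eq hl hc] at hf₁
      omega
    have hlt : L.fd y₂ < L.a p₁ y₁ := by
      have hle : L.fd y₂ ≤ L.a p₁ y₁ := by omega
      refine lt_of_le_of_ne hle fun he => hncon ?_
      rw [hd₂] at he
      rw [← (dart_eq hq₂ h₁ (by omega) he).2]
      exact hc₂
    have e₁ := h₁.2
    have e₂ := h₂.2
    have e₃ := hq₁.2
    have e₄ := hq₂.2
    refine L.isLayering.cross (L.lev p₁) {x | L.lev y₁ ≤ L.lev x ∧ L.Con (L.lev y₁) y₁ x}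
      {x | L.lev y₂ ≤ L.lev x ∧ L.Con (L.lev y₂) y₂ x} ?_ ?_ ?_ q₁ q₂ p₁ p₂ z₁ y₁ z₂ y₂
      (by omega) (by omega) (by omega) (by omega) hq₁.1 hq₂.1 h₁.1 h₂.1 ⟨hz₁.ge, hc₁.symm⟩
      ⟨le_rfl, Relation.ReflTransGen.refl⟩ ⟨hz₂.ge, hc₂.symm⟩ ⟨le_rfl, Relation.ReflTransGen.refl⟩
      (hc₁.linkedIn hc₁.symm) (hc₂.linkedIn hc₂.symm) (by omega) (by omega) h
    · rw [Set.disjoint_left]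
      rintro x ⟨-, hx1⟩ ⟨-, hx2⟩
      exact hncon ((hl ▸ hx1).trans hx2.symm)
    · intro x hx
      have := hx.1
      omega
    · intro x hx
      have := hx.1
      omega
  · obtain ⟨hll, hdm, p', hp', hlt'⟩ := id he
    have hly : l ≠ y₂ := he.ne
    have h₂p' : L.a p₂ y₂ < L.a p' l := by
      have hne' := dart_ne h₂ hp' hll.symm hly.symm
      by_contra hcon
      exact cross_vertex hly hll hp (up_par h0₂) hp' h₂ hlt hlt' (by omega)
    by_cases hyl : y₁ = l
    · subst hyl
      have hne' : L.a p₁ y₁ ≠ L.dm y₂ := dart_ne h₁ (up_par h0₂) hl hne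
      rcases lt_or_gt_of_ne hne' with h3 | h3
      · have := le_κ_of_enc h0₂ he h₁ h3
        omega
      · exact cross_vertex hly hll hp (up_par h0₂) h₁ h₂ hlt h3 h
    · have hne' : L.dm y₁ ≠ L.a p l := dart_ne (up_par h0₁) hp (by omega) hyl
      rcases lt_or_gt_of_ne hne' with h3 | h3
      · exact cross_vertex hyl (by omega) (up_par h0₁) hp h₁ hp' h3 (by omega) (by omega)
      · have hdl : L.dm l ≤ L.a p l := dm_le hp
        have hd₁ := dm_le h₁
        have : L.Enc l y₁ := ⟨by omega, by omega, p', hp', by omega⟩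
        have := le_κ_of_enc h0₁ this hp h3
        omega

/-- Within a block, later darts belong to vertices whose first dart is later. -/
theorem dm_lt_of_κ_eq {y₁ y₂ p₁ p₂ : W} (hl : L.lev y₁ = L.lev y₂) (h₁ : L.Up p₁ y₁)
    (h₂ : L.Up p₂ y₂) (hκ : L.κ y₁ = L.κ y₂) (hne : y₁ ≠ y₂) (h : L.a p₁ y₁ < L.a p₂ y₂) :
    L.dm y₁ < L.dm y₂ := by
  have h0₁ := lev_lt_of_up h₁
  have h0₂ := lev_lt_of_up h₂
  by_contra hcon
  have h3 : L.dm y₂ < L.dm y₁ :=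
    lt_of_le_of_ne (not_lt.1 hcon) (dm_ne hl.symm h0₂ hne.symm)
  have hd := dm_le h₁
  have := le_κ_of_enc h0₁ (l := y₂) ⟨hl.symm, h3, p₂, h₂, by omega⟩ (up_par h0₂) h3
  have h4 := κ_lt h0₂
  change 2 * L.dm y₂ ≤ _ at this
  omega

end Layered

namespace Layered

variable {W : Type*} (L : Layered W)

/-- `p` is the origin of a dart defining the block key of `y`. -/
def IsSource (p y : W) : Prop := ∃ z, L.Up p z ∧ L.lev z = L.lev y ∧
  L.Con (L.lev y) z y ∧ L.a p z ≤ L.dm y ∧ (L.κ y = 2 * L.a p z ∨ L.κ y = 2 * L.a p z - 1)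

/-- The origin of the dart defining the block key of `y`. -/
noncomputable def src (y : W) : W := @Classical.epsilon W ⟨y⟩ fun p => L.IsSource p y

/-- The vertices below the cluster of `p`. -/
def below (p : W) : Set W :=
  {x | ∃ q, L.Con (L.lev p) p q ∧ L.lev q = L.lev p ∧ L.Up x q}

/-- A vertex with the largest block key below the cluster of `p`. -/
noncomputable def top (p : W) : W :=
  @Classical.epsilon W ⟨p⟩ fun x => x ∈ L.below p ∧ ∀ z ∈ L.below p, L.κ z ≤ L.κ x

/-- The block address of a vertex of level `2 * i`. -/
noncomputable def blockAddr : ℕ → W → List ℤ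
  | 0, x => [L.κ x]
  | i + 1, y => blockAddr i (L.top (L.src y)) ++ [L.R (L.par (L.src y)), L.κ y]

/-- The address of a vertex of even level. -/
noncomputable def addr (y : W) : List ℤ := L.blockAddr (L.lev y / 2) y ++ [L.R y]

/-- The block address of a vertex of odd level. -/
noncomputable def pointAddr (p : W) : List ℤ := L.blockAddr (L.lev p / 2) (L.top p)

variable {L}

theorem mem_below {x p : W} (h : L.Up x p) : x ∈ L.below p :=
  ⟨p, Relation.ReflTransGen.refl, rfl, h⟩

theorem below_eq {p q : W} (h : L.Con (L.lev p) p q) (hl : L.lev q = L.lev p) :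
    L.below p = L.below q := by
  ext x
  constructor
  · rintro ⟨r, h1, h2, h3⟩
    exact ⟨r, by rw [hl]; exact h.symm.trans h1, h2.trans hl.symm, h3⟩
  · rintro ⟨r, h1, h2, h3⟩
    exact ⟨r, h.trans (hl ▸ h1), h2.trans hl, h3⟩

theorem top_eq {p q : W} (h : L.Con (L.lev p) p q) (hl : L.lev q = L.lev p) :
    L.top p = L.top q := by
  unfold top
  rw [below_eq h hl]

theorem lev_of_mem_below {x p : W} (h : x ∈ L.below p) : L.lev p = L.lev x + 1 := by
  obtain ⟨q, -, h2, h3⟩ := h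
  rw [← h2, h3.2]

theorem length_blockAddr (i : ℕ) (x : W) : (L.blockAddr i x).length = 2 * i + 1 := by
  induction i generalizing x with
  | zero => rfl
  | succ i ih => simp [blockAddr, ih]; omega

theorem length_addr {y : W} (h : Even (L.lev y)) : (L.addr y).length = L.lev y + 2 := by
  obtain ⟨j, hj⟩ := h
  simp [addr, length_blockAddr]
  omega

theorem length_pointAddr {p : W} (h : Odd (L.lev p)) : (L.pointAddr p).length = L.lev p := by
  obtain ⟨j, hj⟩ := h
  simp [pointAddr, length_blockAddr]
  omega

/-- Members of the set below a cluster are joined above their level, avoiding any given vertex of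
their level different from them. -/
theorem linkedIn_of_mem_below {p x x' l : W} (hx : x ∈ L.below p) (hx' : x' ∈ L.below p)
    (hl : L.lev l = L.lev x) (h : x ≠ l) (h' : x' ≠ l) :
    LinkedIn L.graph {z | L.lev x ≤ L.lev z ∧ z ≠ l} x x' := by
  have e := lev_of_mem_below hx
  have e' := lev_of_mem_below hx'
  obtain ⟨q, h1, h2, h3⟩ := hx
  obtain ⟨q', h1', h2', h3'⟩ := hx'
  have key : ∀ z, L.lev p ≤ L.lev z → z ∈ {z | L.lev x ≤ L.lev z ∧ z ≠ l} := by
    intro z hz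
    refine ⟨by omega, ?_⟩
    rintro rfl
    omega
  have hm : LinkedIn L.graph {z | L.lev x ≤ L.lev z ∧ z ≠ l} q q' :=
    LinkedIn.mono (fun z hz => key z hz) (h1.symm.trans h1')
  refine Relation.ReflTransGen.tail (Relation.ReflTransGen.head ⟨h3.1, ⟨le_rfl, h⟩, key q h2.ge⟩ hm)
    ⟨h3'.1.symm, key q' h2'.ge, by show L.lev x ≤ L.lev x'; omega, h'⟩

theorem con_of_mem_below {p x x' : W} (hx : x ∈ L.below p) (hx' : x' ∈ L.below p) :
    L.Con (L.lev x) x x' := by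
  have e := lev_of_mem_below hx
  have e' := lev_of_mem_below hx'
  obtain ⟨q, h1, h2, h3⟩ := hx
  obtain ⟨q', h1', h2', h3'⟩ := hx'
  have h4 : L.Con (L.lev x) q q' := Con.mono (by omega) (h1.symm.trans h1')
  exact ((con_of_adj h3.1 le_rfl (by omega)).trans h4).trans
    (con_of_adj h3'.1.symm (by omega) (by omega))

theorem eq_of_mem_below {p x x' : W} (h0 : L.lev x = 0) (hx : x ∈ L.below p)
    (hx' : x' ∈ L.below p) : x = x' := by
  have e := lev_of_mem_below hx
  have e' := lev_of_mem_below hx'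
  exact L.isLayering.root x x' h0 (by omega) (LinkedIn.reachable (con_of_mem_below hx hx'))

/-- The parent is monotone on a level of odd parity. -/
theorem R_par_le {p q : W} (hl : L.lev p = L.lev q) (hp : Odd (L.lev p)) (h : L.R p ≤ L.R q) :
    L.R (L.par p) ≤ L.R (L.par q) := by
  rw [R_eq_dm hp, R_eq_dm (hl ▸ hp)] at h
  have h1 := L.isLayering.par_lev p hp.pos
  have h2 := L.isLayering.par_lev q (hl ▸ hp.pos)
  exact R_le_of_a_le (by omega) h

theorem addr_injOn {y y' : W} (h : Even (L.lev y)) (h' : Even (L.lev y'))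
    (he : L.addr y = L.addr y') : y = y' := by
  have h1 := congrArg List.length he
  rw [length_addr h, length_addr h'] at h1
  have h2 := congrArg List.getLast? he
  simp [addr] at h2
  exact L.isLayering.R_inj y y' (by omega) h2

variable [Finite W]

theorem isSource_src {y : W} (h0 : 0 < L.lev y) : L.IsSource (L.src y) y :=
  Classical.epsilon_spec (p := fun p => L.IsSource p y) (exists_source h0)

theorem lev_src {y : W} (h0 : 0 < L.lev y) : L.lev (L.src y) + 1 = L.lev y := by
  obtain ⟨z, h1, h2, -⟩ := isSource_src h0
  rw [← h2, h1.2]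

theorem top_spec {p : W} (h0 : 0 < L.lev p) :
    L.top p ∈ L.below p ∧ ∀ z ∈ L.below p, L.κ z ≤ L.κ (L.top p) := by
  refine Classical.epsilon_spec (p := fun x => x ∈ L.below p ∧ ∀ z ∈ L.below p, L.κ z ≤ L.κ x) ?_
  exact Set.exists_max_image _ _ (Set.toFinite _) ⟨L.par p, mem_below (up_par h0)⟩

theorem src_eq_of_κ_eq {y y' : W} (hl : L.lev y = L.lev y') (h0 : 0 < L.lev y)
    (h : L.κ y = L.κ y') : L.src y = L.src y' := by
  obtain ⟨z, h1, h2, -, -, h3⟩ := isSource_src h0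
  obtain ⟨z', h1', h2', -, -, h3'⟩ := isSource_src (hl ▸ h0)
  exact (dart_eq h1 h1' (by omega) (by omega)).1

theorem R_src_le_of_κ_le {y y' : W} (hl : L.lev y = L.lev y') (h0 : 0 < L.lev y)
    (h : L.κ y ≤ L.κ y') : L.R (L.src y) ≤ L.R (L.src y') := by
  obtain ⟨z, h1, h2, -, -, h3⟩ := isSource_src h0
  obtain ⟨z', h1', h2', -, -, h3'⟩ := isSource_src (hl ▸ h0)
  have e := h1.2
  have e' := h1'.2
  exact R_le_of_a_le (by omega) (show L.a (L.src y) z ≤ L.a (L.src y') z' by omega)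

theorem κ_lt_of_R_src_lt {y y' : W} (hl : L.lev y = L.lev y') (h0 : 0 < L.lev y)
    (h : L.R (L.src y) < L.R (L.src y')) : L.κ y < L.κ y' := by
  by_contra hcon
  exact absurd (R_src_le_of_κ_le hl.symm (hl ▸ h0) (not_lt.1 hcon)) (not_le.2 h)

theorem κ_lt_of_R_src_lt_R {y q w : W} (h0 : 0 < L.lev y) (hl : L.lev q + 1 = L.lev y)
    (h : L.R (L.src y) < L.R q) : L.κ y < 2 * L.a q w := by
  obtain ⟨z, h1, h2, -, -, h3⟩ := isSource_src h0
  have e := h1.2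
  have := L.isLayering.a_lt (L.src y) q z w (by omega) h
  omega

theorem R_par_src_le_of_κ_le {y y' : W} (hl : L.lev y = L.lev y') (h0 : 0 < L.lev y)
    (he : Even (L.lev y)) (h : L.κ y ≤ L.κ y') :
    L.R (L.par (L.src y)) ≤ L.R (L.par (L.src y')) := by
  have h1 := lev_src h0
  have h2 := lev_src (hl ▸ h0 : 0 < L.lev y')
  refine R_par_le (by omega) ?_ (R_src_le_of_κ_le hl h0 h)
  rw [← h1] at he
  exact Nat.not_even_iff_odd.1 (Nat.even_add_one.1 he)

theorem R_src_le {p y : W} (h : L.Up p y) : L.R (L.src y) ≤ L.R p := by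
  obtain ⟨z, h1, h2, -, h4, h3⟩ := isSource_src (lev_lt_of_up h)
  have e := h1.2
  have e' := h.2
  exact R_le_of_a_le (by omega) (h4.trans (dm_le h))

theorem R_par_src_le {p y : W} (h : L.Up p y) (hp : Odd (L.lev p)) :
    L.R (L.par (L.src y)) ≤ L.R (L.par p) := by
  have h1 := lev_src (lev_lt_of_up h)
  have h2 := h.2
  have h3 : L.lev (L.src y) = L.lev p := by omega
  exact R_par_le h3 (h3 ▸ hp) (R_src_le h)

theorem con_src {y : W} (h0 : 0 < L.lev y) : L.Con (L.lev (L.src y)) (L.src y) y := by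
  obtain ⟨z, h1, h2, h3, -⟩ := isSource_src h0
  have e := h1.2
  exact (con_of_adj h1.1 le_rfl (by omega)).trans (Con.mono (by omega) h3)

theorem top_src_eq {p y : W} (h : L.Up p y) : L.top (L.src y) = L.top p := by
  have h1 := lev_src (lev_lt_of_up h)
  have h2 := h.2
  refine top_eq ((con_src (lev_lt_of_up h)).trans (con_of_adj h.1.symm ?_ ?_)) ?_ <;> omega

theorem blockAddr_eq {i : ℕ} {y y' : W} (hl : L.lev y = L.lev y') (hi : L.lev y = 2 * i)
    (h : L.κ y = L.κ y') : L.blockAddr i y = L.blockAddr i y' := by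
  cases i with
  | zero => simp [blockAddr, h]
  | succ i => simp [blockAddr, h, src_eq_of_κ_eq hl (by omega) h]

/-- The address of a lower neighbour in the last block. -/
theorem addr_of_κ_eq {p r : W} (hp : Odd (L.lev p)) (h : L.Up r p)
    (hκ : L.κ r = L.κ (L.top p)) : L.addr r = L.pointAddr p ++ [L.R r] := by
  have e := h.2
  have e' := lev_of_mem_below (top_spec hp.pos).1
  obtain ⟨j, hj⟩ := hp
  have h1 : L.lev r / 2 = j := by omega
  have h2 : L.lev p / 2 = j := by omega
  rw [addr, pointAddr, h1, h2, blockAddr_eq (by omega) (by omega) hκ]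

/-- The address of an upper neighbour. -/
theorem addr_of_up {p y : W} (hp : Odd (L.lev p)) (h : L.Up p y) :
    L.addr y = L.pointAddr p ++ [L.R (L.par (L.src y)), L.κ y, L.R y] := by
  have e := h.2
  obtain ⟨j, hj⟩ := hp
  have h1 : L.lev y / 2 = j + 1 := by omega
  have h2 : L.lev p / 2 = j := by omega
  rw [addr, pointAddr, h1, h2, blockAddr, top_src_eq h]
  simp

/-- Among the vertices below a cluster, one with an earlier first dart lies in the same block as
the other or encloses it. -/
theorem κ_eq_or_enc {p x x' : W} (hx : x ∈ L.below p) (hx' : x' ∈ L.below p) (h0 : 0 < L.lev x)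
    (h : L.dm x < L.dm x') :
    L.κ x = L.κ x' ∨ ∃ q, L.Up q x ∧ L.κ x' = 2 * L.a q x := by
  have e := lev_of_mem_below hx
  have e' := lev_of_mem_below hx'
  have hl : L.lev x' = L.lev x := by omega
  have h0' : 0 < L.lev x' := by omega
  have hfd : L.fd x = L.fd x' := by
    apply fd_eq (by omega)
    rw [hl]
    exact con_of_mem_below hx hx'
  have hle : L.κ x ≤ L.κ x' := by
    rcases κ_mem h0 with hk | ⟨q, l, he, hq, hlt, hk⟩
    · rw [hk, hfd]
      exact fd_le_κ h0'
    · obtain ⟨hll, hdm, q', hq', hlt'⟩ := id he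
      have hlx' : x' ≠ l := by
        rintro rfl
        have := dm_le hq
        omega
      have hne := dart_ne hq' (up_par h0') (by omega) hlx'.symm
      change _ ≠ L.dm x' at hne
      by_cases hc : L.a q' l < L.dm x'
      · exact (cross_vertex_set (B := {z | L.lev x ≤ L.lev z ∧ z ≠ l}) (y := l) (z := x) (z' := x')
          (fun z hz => hll ▸ hz.1) (fun hz => hz.2 rfl) ⟨le_rfl, he.ne.symm⟩
          (linkedIn_of_mem_below hx hx' hll he.ne.symm hlx') (by omega) (by omega)
          hq (up_par h0) hq' (up_par h0') hlt hlt' hc).elim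
      · rw [hk]
        exact le_κ_of_enc h0' ⟨by omega, by omega, q', hq', by omega⟩ hq (by omega)
  rcases hle.eq_or_lt with hk | hlt
  · exact Or.inl hk
  refine Or.inr ?_
  rcases κ_mem h0' with hk | ⟨q, l, he, hq, hlt', hk⟩
  · have := fd_le_κ h0
    omega
  · by_cases hxl : x = l
    · exact ⟨q, hxl ▸ hq, hxl ▸ hk⟩
    obtain ⟨hll, hdm, q', hq', hlt''⟩ := id he
    have hne := dart_ne (up_par h0) hq (by omega) hxl
    change L.dm x ≠ _ at hne
    rcases lt_or_gt_of_ne hne with hc | hc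
    · exact (cross_set_vertex (B := {z | L.lev x ≤ L.lev z ∧ z ≠ l}) (y := l) (z := x) (z' := x')
          (fun z hz => by rw [hll, hl]; exact hz.1) (fun hz => hz.2 rfl) ⟨le_rfl, hxl⟩
          (linkedIn_of_mem_below hx hx' (by omega) hxl he.ne.symm) (by omega) (by omega)
          (up_par h0) hq (up_par h0') hq' hc hlt' hlt'').elim
    · have hd := dm_le hq
      have := le_κ_of_enc h0 (l := l) ⟨by omega, by omega, q', hq', by omega⟩ hq hc
      omega

/-- A vertex below a cluster outside the last block is the one whose dart opens that block. -/
theorem κ_top_of_ne {p x : W} (h0 : 0 < L.lev p) (hx : x ∈ L.below p)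
    (h : L.κ x ≠ L.κ (L.top p)) :
    0 < L.lev x ∧ L.κ x < L.κ (L.top p) ∧ ∃ q, L.Up q x ∧ L.κ (L.top p) = 2 * L.a q x := by
  obtain ⟨ht, hmax⟩ := top_spec h0
  have hne : x ≠ L.top p := by
    rintro he
    exact h (he ▸ rfl)
  have hx0 : 0 < L.lev x := by
    by_contra hc
    exact hne (eq_of_mem_below (by omega) hx ht)
  have e := lev_of_mem_below hx
  have e' := lev_of_mem_below ht
  have hlt : L.κ x < L.κ (L.top p) := lt_of_le_of_ne (hmax x hx) h
  refine ⟨hx0, hlt, ?_⟩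
  rcases lt_or_gt_of_ne (dm_ne (by omega) hx0 hne) with hd | hd
  · exact (κ_eq_or_enc hx ht hx0 hd).resolve_left h
  · rcases κ_eq_or_enc ht hx (by omega) hd with hk | ⟨q, hq, hk⟩
    · exact absurd hk.symm h
    · have h1 := dm_le hq
      have h2 := κ_lt (L := L) (y := L.top p) (by omega)
      omega

end Layered

theorem List.append_lt_append_left_iff {q s t : List ℤ} : q ++ s < q ++ t ↔ s < t := by
  induction q with
  | nil => simp
  | cons x q ih => simp [ih]

theorem List.IsPrefix.of_between {q a b c : List ℤ} (ha : q <+: a) (hc : q <+: c) (hab : a < b)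
    (hbc : b < c) : q <+: b := by
  induction q generalizing a b c with
  | nil => exact List.nil_prefix
  | cons x q ih =>
    obtain ⟨a', rfl⟩ := ha
    obtain ⟨c', rfl⟩ := hc
    cases b with
    | nil => simp at hab
    | cons y b =>
      simp only [List.cons_append, List.cons_lt_cons_iff] at hab hbc
      have hxy : x = y := by omega
      subst hxy
      simp only [lt_self_iff_false, true_and, false_or] at hab hbc
      exact (List.prefix_cons_inj x).2 (ih (List.prefix_append _ _) (List.prefix_append _ _) hab hbc)

theorem List.IsPrefix.eq_of_length_eq {b b' u : List ℤ} (hu : b <+: u)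
    (hl : b.length = b'.length) (h : b' <+: u) : b = b' :=
  (List.prefix_of_prefix_length_le hu h hl.le).eq_of_length hl

namespace Layered

variable {W : Type*} {L : Layered W}

theorem even_of_up {p y : W} (hp : Odd (L.lev p)) (h : L.Up p y) : Even (L.lev y) := by
  rw [h.2]
  exact hp.add_one

theorem even_of_up_odd {p y : W} (hp : Odd (L.lev p)) (h : L.Up y p) : Even (L.lev y) := by
  rw [h.2] at hp
  rcases Nat.even_or_odd (L.lev y) with h1 | h1
  · exact h1
  · exact absurd h1.add_one (Nat.not_even_iff_odd.2 hp)

/-- Two vertices of one level do not have interleaving lower neighbours. -/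
theorem cross_R {p p' u u' w w' : W} (hne : p ≠ p') (hl : L.lev p = L.lev p') (hu : L.Up u p)
    (hw : L.Up w p) (hu' : L.Up u' p') (hw' : L.Up w' p') (h₁ : L.R u < L.R u')
    (h₂ : L.R u' < L.R w) (h₃ : L.R w < L.R w') : False := by
  have e₁ := hu.2
  have e₂ := hu'.2
  have e₃ := hw.2
  have e₄ := hw'.2
  exact cross_vertex hne hl hu hu' hw hw' (L.isLayering.a_lt _ _ _ _ (by omega) h₁)
    (L.isLayering.a_lt _ _ _ _ (by omega) h₂) (L.isLayering.a_lt _ _ _ _ (by omega) h₃)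

variable [Finite W]

theorem cross_beta {p p' y y' : W} (hp : Odd (L.lev p)) (hp' : Odd (L.lev p'))
    (hx : L.κ (L.par p) = L.κ (L.top p)) (hx' : L.κ (L.par p') = L.κ (L.top p'))
    (hy : L.Up p y) (hy' : L.Up p' y')
    (hβ : L.R (L.par (L.src y)) = L.R (L.par p)) (hβ' : L.R (L.par (L.src y')) = L.R (L.par p'))
    (h₁ : L.addr (L.par p) < L.addr (L.par p')) (h₂ : L.addr (L.par p') < L.addr y)
    (h₃ : L.addr y < L.addr y') : False := by
  have q : ∀ {p y : W}, Odd (L.lev p) → L.κ (L.par p) = L.κ (L.top p) → L.Up p y →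
      L.R (L.par (L.src y)) = L.R (L.par p) → L.addr (L.par p) <+: L.addr y := by
    intro p y hp hx hy hβ
    rw [addr_of_κ_eq hp (up_par hp.pos) hx, addr_of_up hp hy, hβ]
    simp
  have k₁ := List.IsPrefix.of_between (List.prefix_refl _) (q hp hx hy hβ) h₁ h₂
  have k₂ := List.IsPrefix.of_between (List.prefix_refl _) (q hp' hx' hy' hβ') h₂ h₃
  have l₁ := length_addr (even_of_up_odd hp (up_par hp.pos))
  have l₂ := length_addr (even_of_up_odd hp' (up_par hp'.pos))
  have l₃ := length_addr (even_of_up hp hy)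
  have m₁ := k₁.length_le
  have m₂ := k₂.length_le
  have e₁ := (up_par hp.pos : L.Up _ _).2
  have e₂ := (up_par hp'.pos : L.Up _ _).2
  have e₃ := hy.2
  by_cases hl : L.lev p = L.lev p'
  · exact h₁.ne (k₁.eq_of_length (by omega))
  · obtain ⟨i, hi⟩ := hp
    obtain ⟨i', hi'⟩ := hp'
    exact h₂.ne (k₂.eq_of_length (by omega))

theorem cross_low {p p' u u' w w' : W} (hp : Odd (L.lev p)) (hp' : Odd (L.lev p')) (hne : p ≠ p')
    (hu : L.Up u p) (hw : L.Up w p) (hu' : L.Up u' p') (hw' : L.Up w' p')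
    (ku : L.κ u = L.κ (L.top p)) (kw : L.κ w = L.κ (L.top p))
    (ku' : L.κ u' = L.κ (L.top p')) (kw' : L.κ w' = L.κ (L.top p'))
    (h₁ : L.addr u < L.addr u') (h₂ : L.addr u' < L.addr w) (h₃ : L.addr w < L.addr w') :
    False := by
  have au := addr_of_κ_eq hp hu ku
  have aw := addr_of_κ_eq hp hw kw
  have au' := addr_of_κ_eq hp' hu' ku'
  have aw' := addr_of_κ_eq hp' hw' kw'
  have lb := length_pointAddr hp
  have lb' := length_pointAddr hp'
  rw [au, au'] at h₁
  rw [au', aw] at h₂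
  rw [aw, aw'] at h₃
  have k₁ := List.IsPrefix.of_between (List.prefix_append _ _) (List.prefix_append _ _) h₁ h₂
  have k₂ := List.IsPrefix.of_between (List.prefix_append _ _) (List.prefix_append _ _) h₂ h₃
  have m₁ := k₁.length_le
  have m₂ := k₂.length_le
  simp only [List.length_append, List.length_singleton] at m₁ m₂
  obtain ⟨i, hi⟩ := hp
  obtain ⟨i', hi'⟩ := hp'
  have hb : L.pointAddr p = L.pointAddr p' :=
    List.IsPrefix.eq_of_length_eq k₁ (by omega) (List.prefix_append _ _)
  rw [hb, List.append_lt_append_left_iff] at h₁ h₂ h₃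
  simp only [List.cons_lt_cons_iff, lt_self_iff_false, and_false, or_false] at h₁ h₂ h₃
  exact cross_R hne (by omega) hu hw hu' hw' h₁ h₂ h₃

/-- Upper neighbours of a later point coming from sources before an earlier point precede the upper
neighbours of the earlier point. -/
theorem addr_lt_of_src_lt {p p' y y' : W} (hp : Odd (L.lev p)) (hl : L.lev p = L.lev p')
    (hb : L.pointAddr p = L.pointAddr p') (h : L.R p < L.R p') (hy : L.Up p y) (hy' : L.Up p' y')
    (hs : L.R (L.src y') < L.R p) (hne : y ≠ y') : L.addr y' < L.addr y := by
  have h0 := lev_lt_of_up hy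
  have h0' := lev_lt_of_up hy'
  have e := hy.2
  have e' := hy'.2
  have ha := L.isLayering.a_lt p p' y y' hl h
  have hk := κ_lt_of_R_src_lt_R (q := p) (w := y) h0' (by omega) hs
  have hle : L.κ y' ≤ L.κ y := by
    by_contra hc
    exact κ_nested (by omega) hy hy' (not_le.1 hc) hk ha
  have hr := R_par_src_le_of_κ_le (by omega) h0' (even_of_up (hl ▸ hp) hy') hle
  rw [addr_of_up hp hy, addr_of_up (hl ▸ hp) hy', hb, List.append_lt_append_left_iff]
  simp only [List.cons_lt_cons_iff, lt_self_iff_false, and_false, or_false]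
  rcases hle.lt_or_eq with hlt | heq
  · omega
  · have hd := dm_lt_of_κ_eq (by omega) hy hy' heq.symm hne ha
    have := R_eq_neg_dm (even_of_up hp hy) h0
    have := R_eq_neg_dm (even_of_up (hl ▸ hp) hy') h0'
    omega

theorem addr_lt_of_lt_src {p p' y y' : W} (hp : Odd (L.lev p)) (hl : L.lev p = L.lev p')
    (hb : L.pointAddr p = L.pointAddr p') (hy : L.Up p y) (hy' : L.Up p' y')
    (hs : L.R p < L.R (L.src y')) : L.addr y < L.addr y' := by
  have h0 := lev_lt_of_up hy
  have e := hy.2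
  have e' := hy'.2
  have hlt : L.κ y < L.κ y' :=
    κ_lt_of_R_src_lt (by omega) h0 ((R_src_le hy).trans_lt hs)
  have hr := R_par_src_le_of_κ_le (by omega) h0 (even_of_up hp hy) hlt.le
  rw [addr_of_up hp hy, addr_of_up (hl ▸ hp) hy', hb, List.append_lt_append_left_iff]
  simp only [List.cons_lt_cons_iff, lt_self_iff_false, and_false, or_false]
  omega

theorem cross_gamma {p p' y y' : W} (hp : Odd (L.lev p)) (hp' : Odd (L.lev p'))
    (hmod : L.lev p / 2 % 2 = L.lev p' / 2 % 2)
    (hx : L.κ (L.par p) = L.κ (L.top p)) (hx' : L.κ (L.par p') = L.κ (L.top p'))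
    (hy : L.Up p y) (hy' : L.Up p' y')
    (h₁ : L.addr y < L.addr y') (h₂ : L.addr y' < L.addr (L.par p))
    (h₃ : L.addr (L.par p) < L.addr (L.par p')) : False := by
  have ax := addr_of_κ_eq hp (up_par hp.pos) hx
  have ax' := addr_of_κ_eq hp' (up_par hp'.pos) hx'
  have ay := addr_of_up hp hy
  have ay' := addr_of_up hp' hy'
  have lb := length_pointAddr hp
  have lb' := length_pointAddr hp'
  have g₁ := h₁
  rw [ay, ay'] at h₁
  rw [ax, ay'] at h₂
  rw [ax, ax'] at h₃
  have k₁ := List.IsPrefix.of_between (List.prefix_append _ _) (List.prefix_append _ _) h₁ h₂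
  have k₂ := List.IsPrefix.of_between (List.prefix_append _ _) (List.prefix_append _ _) h₂ h₃
  have m₁ := k₁.length_le
  have m₂ := k₂.length_le
  simp only [List.length_append, List.length_cons, List.length_nil] at m₁ m₂
  have hl : L.lev p = L.lev p' := by
    obtain ⟨i, hi⟩ := hp
    obtain ⟨i', hi'⟩ := hp'
    omega
  have hb : L.pointAddr p = L.pointAddr p' :=
    List.IsPrefix.eq_of_length_eq k₁ (by omega) (List.prefix_append _ _)
  rw [hb, List.append_lt_append_left_iff] at h₂ h₃
  simp only [List.cons_lt_cons_iff, lt_self_iff_false, and_false, or_false, List.not_lt_nil] at h₂ h₃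
  have hR : L.R p < L.R p' := by
    by_contra hc
    exact absurd (R_par_le hl.symm hp' (not_lt.1 hc)) (not_le.2 h₃)
  have hs : L.R (L.src y') < L.R p := by
    have e := hy'.2
    have := lev_src (lev_lt_of_up hy')
    by_contra hc
    exact absurd (R_par_le (by omega) hp (not_lt.1 hc)) (not_le.2 h₂)
  exact lt_asymm g₁ (addr_lt_of_src_lt hp hl hb hR hy hy' hs (fun he => g₁.ne (he ▸ rfl)))

variable (L) in
/-- The lower neighbour of `p` outside the last block. -/
def IsLead (p l : W) : Prop := L.Up l p ∧ L.κ l ≠ L.κ (L.top p)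

variable (L) in
/-- The number of vertices enclosing `l`. -/
noncomputable def depth (l : W) : ℕ := {m | L.Enc m l}.ncard

theorem IsLead.unique {p p' l l' : W} (h : L.IsLead p l) (h' : L.IsLead p' l')
    (hl : L.lev p = L.lev p') (hk : L.κ (L.top p) = L.κ (L.top p')) : l = l' := by
  have e := h.1.2
  have e' := h'.1.2
  obtain ⟨-, -, q, hq, hk₁⟩ := κ_top_of_ne (lev_lt_of_up h.1) (mem_below h.1) h.2
  obtain ⟨-, -, q', hq', hk₂⟩ := κ_top_of_ne (lev_lt_of_up h'.1) (mem_below h'.1) h'.2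
  exact (dart_eq hq hq' (by omega) (by omega)).2

theorem IsLead.addr_append {p l v : W} (hp : Odd (L.lev p)) (h : L.IsLead p l)
    (hv : L.graph.Adj p v) (hne : v ≠ l) : L.pointAddr p <+: L.addr v := by
  rcases up_of_adj hv with hv | hv
  · rw [addr_of_up hp hv]
    exact List.prefix_append _ _
  · by_cases hk : L.κ v = L.κ (L.top p)
    · rw [addr_of_κ_eq hp hv hk]
      exact List.prefix_append _ _
    · exact absurd (IsLead.unique ⟨hv, hk⟩ h rfl rfl) hne

theorem IsLead.pointAddr_par {p l : W} (hp : Odd (L.lev p)) (h : L.IsLead p l) :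
    L.addr l = L.pointAddr (L.par l) ++ [L.R (L.par (L.src l)), L.κ l, L.R l] ∧
    L.pointAddr p = L.pointAddr (L.par l) ++
      [L.R (L.par (L.src (L.top p))), L.κ (L.top p)] := by
  have hl0 := (κ_top_of_ne (lev_lt_of_up h.1) (mem_below h.1) h.2).1
  have ht := (top_spec hp.pos).1
  have e := h.1.2
  have e' := lev_of_mem_below ht
  have hpl : L.Up (L.par l) l := up_par hl0
  have hpt : L.Up (L.par (L.top p)) (L.top p) := up_par (by omega)
  have e₁ := hpl.2
  have e₂ := hpt.2
  have hcon := con_of_mem_below (mem_below h.1) ht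
  have hodd : Odd (L.lev (L.par l)) := by
    have := even_of_up_odd hp h.1
    rw [e₁] at this
    exact Nat.not_even_iff_odd.1 (Nat.even_add_one.1 this)
  refine ⟨addr_of_up hodd hpl, ?_⟩
  have htop : L.top (L.par l) = L.top (L.par (L.top p)) :=
    top_eq (((con_of_adj hpl.1 le_rfl (by omega)).trans (Con.mono (by omega) hcon)).trans
      (con_of_adj hpt.1.symm (by omega) (by omega))) (by omega)
  obtain ⟨i, hi⟩ := hodd
  have h1 : L.lev p / 2 = i + 1 := by omega
  have h2 : L.lev (L.par l) / 2 = i := by omega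
  rw [pointAddr, pointAddr, h1, h2, blockAddr, top_src_eq hpt, htop]

theorem κ_le_of_lt {t t' : W} {s s' U : List ℤ} (hl : L.lev t = L.lev t') (h0 : 0 < L.lev t)
    (he : Even (L.lev t))
    (h : U ++ (L.R (L.par (L.src t)) :: L.κ t :: s) < U ++ (L.R (L.par (L.src t')) :: L.κ t' :: s')) :
    L.κ t ≤ L.κ t' := by
  by_contra hc
  have := R_par_src_le_of_κ_le hl.symm (hl ▸ h0) (hl ▸ he) (not_le.1 hc).le
  rw [List.append_lt_append_left_iff] at h
  simp only [List.cons_lt_cons_iff] at h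
  omega

theorem IsLead.addr_lt {p l v : W} (hp : Odd (L.lev p)) (h : L.IsLead p l)
    (hv : L.graph.Adj p v) (hne : v ≠ l) : L.addr l < L.addr v := by
  obtain ⟨h0, hk, -⟩ := κ_top_of_ne (lev_lt_of_up h.1) (mem_below h.1) h.2
  obtain ⟨s, hs⟩ := h.addr_append hp hv hne
  obtain ⟨h1, h2⟩ := h.pointAddr_par hp
  have e := h.1.2
  have e' := lev_of_mem_below (top_spec hp.pos).1
  have hr := R_par_src_le_of_κ_le (by omega) h0 (even_of_up_odd hp h.1) hk.le
  rw [← hs, h1, h2, List.append_assoc, List.append_lt_append_left_iff]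
  simp only [List.cons_append, List.cons_lt_cons_iff]
  omega

theorem depth_succ {l₁ l₂ q : W} (hl : L.lev l₁ = L.lev l₂) (h0 : 0 < L.lev l₂)
    (hq : L.Up q l₁) (hk : L.κ l₂ = 2 * L.a q l₁) : L.depth l₂ = L.depth l₁ + 1 := by
  have h0₁ : 0 < L.lev l₁ := by omega
  rcases κ_mem h0 with hk' | ⟨q', l', he, hq', hlt, hk'⟩
  · omega
  obtain ⟨rfl, rfl⟩ := dart_eq hq hq' (by rw [he.1, hl]) (by omega)
  obtain ⟨-, hd, q₂, hq₂, hlt₂⟩ := id he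
  have hdq := dm_le hq
  have hset : {m | L.Enc m l₂} = insert l₁ {m | L.Enc m l₁} := by
    ext m
    simp only [Set.mem_ofPred_eq, Set.mem_insert_iff]
    constructor
    · rintro ⟨hm, hmd, r, hr, hrd⟩
      by_cases hml : m = l₁
      · exact Or.inl hml
      refine Or.inr ⟨by omega, ?_, r, hr, by omega⟩
      have hne : L.dm m ≠ L.a q l₁ := dart_ne (up_par (by omega)) hq (by omega) hml
      rcases (dm_ne (L := L) (by omega) (by omega) hml).lt_or_gt with h | h
      · exact h
      rcases hne.lt_or_gt with h' | h'
      · exact (cross_vertex (Ne.symm hml) (by omega) (up_par h0₁) (up_par (by omega)) hq hr h h'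
          (by omega)).elim
      · have := le_κ_of_enc h0 ⟨hm, hmd, r, hr, hrd⟩ (up_par (by omega)) hmd
        change 2 * L.dm m ≤ _ at this
        omega
    · rintro (rfl | ⟨hm, hmd, r, hr, hrd⟩)
      · exact he
      have hml : m ≠ l₁ := by
        rintro rfl
        exact lt_irrefl _ hmd
      refine ⟨by omega, by omega, r, hr, ?_⟩
      have hne : L.a r m ≠ L.a q₂ l₁ := dart_ne hr hq₂ (by omega) hml
      rcases hne.lt_or_gt with h' | h'
      · exact (cross_vertex hml (by omega) (up_par (by omega)) (up_par h0₁) hr hq₂ hmd hrd h').elim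
      · omega
  rw [depth, hset, Set.ncard_insert_of_notMem (fun h => h.ne rfl) (Set.toFinite _), depth]

theorem cross_lead {p₁ p₂ l₁ l₂ v₁ v₂ : W} (hp₁ : Odd (L.lev p₁)) (hp₂ : Odd (L.lev p₂))
    (hl₁ : L.IsLead p₁ l₁) (hl₂ : L.IsLead p₂ l₂) (hv₁ : L.graph.Adj p₁ v₁)
    (hv₂ : L.graph.Adj p₂ v₂) (hne₁ : v₁ ≠ l₁) (hne₂ : v₂ ≠ l₂)
    (hmod : L.lev p₁ / 2 % 3 = L.lev p₂ / 2 % 3) (hdep : L.depth l₁ % 2 = L.depth l₂ % 2)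
    (h₁ : L.addr l₁ < L.addr l₂) (h₂ : L.addr l₂ < L.addr v₁) (h₃ : L.addr v₁ < L.addr v₂) :
    False := by
  obtain ⟨s₁, hs₁⟩ := hl₁.addr_append hp₁ hv₁ hne₁
  obtain ⟨s₂, hs₂⟩ := hl₂.addr_append hp₂ hv₂ hne₂
  obtain ⟨a₁, b₁⟩ := hl₁.pointAddr_par hp₁
  obtain ⟨a₂, b₂⟩ := hl₂.pointAddr_par hp₂
  obtain ⟨z₁, k₁, q₁, hq₁, c₁⟩ := κ_top_of_ne (lev_lt_of_up hl₁.1) (mem_below hl₁.1) hl₁.2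
  obtain ⟨z₂, k₂, q₂, hq₂, c₂⟩ := κ_top_of_ne (lev_lt_of_up hl₂.1) (mem_below hl₂.1) hl₂.2
  have e₁ := hl₁.1.2
  have e₂ := hl₂.1.2
  have t₁ := lev_of_mem_below (top_spec hp₁.pos).1
  have t₂ := lev_of_mem_below (top_spec hp₂.pos).1
  have lv : (L.addr v₁).length ≤ L.lev p₁ + 3 := by
    rcases up_of_adj hv₁ with h | h
    · rw [length_addr (even_of_up hp₁ h), h.2]
    · rw [length_addr (even_of_up_odd hp₁ h)]
      have := h.2
      omega
  have ll := length_addr (even_of_up_odd hp₂ hl₂.1)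
  have lb₁ := length_pointAddr hp₁
  have lb₂ := length_pointAddr hp₂
  have lU₁ := congrArg List.length b₁
  have lU₂ := congrArg List.length b₂
  simp only [List.length_append, List.length_cons, List.length_nil] at lU₁ lU₂
  rw [← hs₁, b₁, List.append_assoc] at h₂ h₃ lv
  rw [← hs₂, b₂, List.append_assoc] at h₃
  rw [a₂] at h₁ h₂ ll
  rw [a₁] at h₁
  have r₁ := List.IsPrefix.of_between (List.prefix_append _ _) (List.prefix_append _ _) h₁ h₂
  have r₂ := List.IsPrefix.of_between (List.prefix_append _ _) (List.prefix_append _ _) h₂ h₃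
  have m₁ := r₁.length_le
  have m₂ := r₂.length_le
  have hl : L.lev p₁ = L.lev p₂ := by
    obtain ⟨i, hi⟩ := hp₁
    obtain ⟨i', hi'⟩ := hp₂
    omega
  have hU : L.pointAddr (L.par l₁) = L.pointAddr (L.par l₂) :=
    List.IsPrefix.eq_of_length_eq r₁ (by omega) (List.prefix_append _ _)
  have ev := even_of_up_odd hp₂ hl₂.1
  rw [hU] at h₁ h₂ h₃
  have i₂ : L.κ l₂ ≤ L.κ (L.top p₁) := κ_le_of_lt (by omega) (by omega) ev h₂
  have i₁ : L.κ l₁ ≤ L.κ l₂ :=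
    κ_le_of_lt (by omega) (by omega) (even_of_up_odd hp₁ hl₁.1) h₁
  have i₃ : L.κ (L.top p₁) ≤ L.κ (L.top p₂) := by
    refine κ_le_of_lt (by omega) (by omega) ?_ h₃
    rwa [show L.lev (L.top p₁) = L.lev l₂ by omega]
  have hne : l₁ ≠ l₂ := by
    rintro rfl
    exact lt_irrefl _ h₁
  have i₄ : L.κ (L.top p₁) < L.κ (L.top p₂) :=
    lt_of_le_of_ne i₃ fun hk => hne (hl₁.unique hl₂ hl hk)
  rcases i₂.eq_or_lt with hk | hk
  · have := depth_succ (by omega) (by omega) hq₁ (hk.trans c₁)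
    omega
  rcases i₁.eq_or_lt with hk' | hk'
  · have hd := dm_lt_of_κ_eq (by omega) hq₁ hq₂ hk' hne (by omega)
    have := R_eq_neg_dm (even_of_up_odd hp₁ hl₁.1) z₁
    have := R_eq_neg_dm ev z₂
    rw [hk', src_eq_of_κ_eq (by omega) z₁ hk', List.append_lt_append_left_iff] at h₁
    simp only [List.cons_lt_cons_iff, lt_self_iff_false, and_false, or_false,
      true_and, false_or] at h₁
    omega
  · exact κ_nested (by omega) hq₁ hq₂ hk' (by omega) (by omega)

end Layered

theorem exists_noncrossing_coloring {E : ℤ → ℤ → Prop}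
    (hE : ∀ a b c d, a < b → b < c → c < d → E a c → E b d → False) (n : ℕ) (l r : ℤ) (hlr : l < r)
    (hn : r - l ≤ n) (cl cr : Fin 3) (hc : cl ≠ cr) :
    ∃ col : ℤ → Fin 3, col l = cl ∧ col r = cr ∧
      ∀ a b, l ≤ a → a < b → b ≤ r → E a b → col a ≠ col b := by
  induction n generalizing l r cl cr with
  | zero => omega
  | succ n ih =>
    by_cases hr : r = l + 1
    · refine ⟨fun x => if x = l then cl else cr, by simp, by simp [hr], ?_⟩
      intro a b ha hab hb _
      have h1 : a = l := by omega
      have h2 : b ≠ l := by omega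
      simp [h1, h2, hc]
    obtain ⟨m, hlm, hmr, hm⟩ : ∃ m, l < m ∧ m < r ∧
        ∀ a b, l ≤ a → a < m → m < b → b ≤ r → E a b → a = l ∧ b = r := by
      by_cases hex : ∃ b, (l < b ∧ b < r) ∧ E l b
      · obtain ⟨m, ⟨⟨h1, h2⟩, h3⟩, hmax⟩ :=
          Int.exists_greatest_of_bdd (P := fun b => (l < b ∧ b < r) ∧ E l b)
            ⟨r, fun z hz => hz.1.2.le⟩ hex
        refine ⟨m, h1, h2, fun a b ha ham hmb hb hab => ?_⟩
        rcases ha.eq_or_lt with rfl | ha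
        · refine ⟨rfl, ?_⟩
          by_contra hbr
          have := hmax b ⟨⟨by omega, by omega⟩, hab⟩
          omega
        · exact (hE l a m b ha ham hmb h3 hab).elim
      · refine ⟨l + 1, by omega, by omega, fun a b ha ham hmb hb hab => ?_⟩
        have : a = l := by omega
        subst this
        refine ⟨rfl, ?_⟩
        by_contra hbr
        exact hex ⟨b, ⟨by omega, by omega⟩, hab⟩
    obtain ⟨cm, h1, h2⟩ : ∃ cm : Fin 3, cl ≠ cm ∧ cm ≠ cr := by
      revert cl cr
      decide
    obtain ⟨f, hf1, hf2, hf⟩ := ih l m hlm (by omega) cl cm h1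
    obtain ⟨g, hg1, hg2, hg⟩ := ih m r hmr (by omega) cm cr h2
    refine ⟨fun x => if x ≤ m then f x else g x, by simp [hlm.le, hf1],
      by simp [not_le.2 hmr, hg2], ?_⟩
    intro a b ha hab hb he
    by_cases h3 : b ≤ m
    · have h4 : a ≤ m := by omega
      simpa [h3, h4] using hf a b ha hab h3 he
    by_cases h4 : a ≤ m
    · rcases h4.eq_or_lt with rfl | h4
      · simpa [h3, hf2, ← hg1] using hg a b le_rfl hab hb he
      · obtain ⟨rfl, rfl⟩ := hm a b ha h4 (by omega) hb he
        simpa [h3, h4.le, hf1, hg2] using hc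
    · simpa [h3, h4] using hg a b (by omega) hab hb he

namespace Layered

variable {W : Type*} {L : Layered W}

variable (L) in
/-- The neighbours of a point other than its parent and its lead. -/
def Main (p v : W) : Prop := (L.Up v p ∧ v ≠ L.par p ∧ L.κ v = L.κ (L.top p)) ∨ L.Up p v

theorem Main.adj {p v : W} (h : L.Main p v) : L.graph.Adj p v := by
  rcases h with h | h
  · exact h.1.1.symm
  · exact h.1

theorem R_par_lt {p r : W} (h : L.Up r p) (hne : r ≠ L.par p) : L.R (L.par p) < L.R r := by
  have e := h.2
  have e' := L.isLayering.par_lev p (by omega)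
  refine lt_of_le_of_ne (R_le_of_a_le (by omega) (dm_le h)) fun hR => hne ?_
  exact (L.isLayering.R_inj _ _ (by omega) hR).symm

variable [Finite W]

variable (L) in
/-- Points can be coloured with three colours so that a point differs from the other origins of the
keys of its upper neighbours. -/
theorem exists_color : ∃ col : W → Fin 3, ∀ p p' y, L.Up p' y → L.src y = p → p ≠ p' →
    col p ≠ col p' := by
  obtain ⟨lo, hlo⟩ := (Set.finite_range L.R).bddBelow
  obtain ⟨hi, hhi⟩ := (Set.finite_range L.R).bddAbove
  have hcol : ∀ n : ℕ, ∃ col : ℤ → Fin 3, ∀ p p' y, L.lev p' = n → L.Up p' y → L.src y = p →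
      p ≠ p' → col (L.R p) ≠ col (L.R p') := by
    intro n
    obtain ⟨col, -, -, h⟩ := exists_noncrossing_coloring
      (E := fun a c => ∃ p' y, L.lev p' = n ∧ L.Up p' y ∧ L.R (L.src y) = a ∧ L.R p' = c) (by
        rintro a b c d hab hbc hcd ⟨p₁, y₁, hn₁, hy₁, rfl, rfl⟩ ⟨p₂, y₂, hn₂, hy₂, rfl, rfl⟩
        have e₁ := hy₁.2
        have e₂ := hy₂.2
        exact κ_nested (by omega) hy₁ hy₂ (κ_lt_of_R_src_lt (by omega) (by omega) hab)
          (κ_lt_of_R_src_lt_R (by omega) (by omega) hbc) (L.isLayering.a_lt _ _ _ _ (by omega) hcd))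
      (max (hi + 1) lo - (lo - 1)).toNat (lo - 1) (max (hi + 1) lo) (by omega) (by omega) 0 1 (by decide)
    refine ⟨col, fun p p' y hn hy hs hne => ?_⟩
    have h1 := hlo ⟨p, rfl⟩
    have h2 := hhi ⟨p', rfl⟩
    subst hs
    have e := lev_src (lev_lt_of_up hy)
    have e' := hy.2
    refine h _ _ (by omega) ?_ (by omega) ⟨p', y, hn, hy, rfl, rfl⟩
    exact lt_of_le_of_ne (R_src_le hy) fun hR => hne (L.isLayering.R_inj _ _ (by omega) hR)
  choose col hcol using hcol
  refine ⟨fun p => col (L.lev p) (L.R p), fun p p' y hy hs hne => ?_⟩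
  have e := lev_src (lev_lt_of_up hy)
  have e' := hy.2
  rw [hs] at e
  have := hcol (L.lev p') p p' y rfl hy hs hne
  beta_reduce
  rwa [show L.lev p = L.lev p' by omega]

variable (L) in
/-- `p` or the origin of the key of an upper neighbour of `p`. -/
def Assoc (p z : W) : Prop := z = p ∨ ∃ y, L.Up p y ∧ L.src y = z

theorem Assoc.lev_eq {p z : W} (h : L.Assoc p z) : L.lev z = L.lev p := by
  rcases h with rfl | ⟨y, hy, rfl⟩
  · rfl
  · have e := lev_src (lev_lt_of_up hy)
    have := hy.2
    omega

theorem Assoc.linkedIn {p p' z : W} (h : L.Assoc p' z) (hl : L.lev p = L.lev p') (hp : p' ≠ p)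
    (hz : z ≠ p) : LinkedIn L.graph {v | L.lev p ≤ L.lev v ∧ v ≠ p} p' z := by
  have key : ∀ v, L.lev p < L.lev v → v ∈ {v | L.lev p ≤ L.lev v ∧ v ≠ p} := by
    intro v hv
    refine ⟨hv.le, ?_⟩
    rintro rfl
    exact lt_irrefl _ hv
  rcases h with rfl | ⟨y, hy, rfl⟩
  · exact Relation.ReflTransGen.refl
  · obtain ⟨t, h1, h2, h3, -⟩ := isSource_src (lev_lt_of_up hy)
    have e := hy.2
    have e' := h1.2
    have hm : LinkedIn L.graph {v | L.lev p ≤ L.lev v ∧ v ≠ p} y t :=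
      LinkedIn.mono (fun v hv => key v (lt_of_lt_of_le (by omega) hv)) h3.symm
    have hp' : p' ∈ {v | L.lev p ≤ L.lev v ∧ v ≠ p} := ⟨hl.le, hp⟩
    exact Relation.ReflTransGen.tail
      (Relation.ReflTransGen.head ⟨hy.1, hp', key y (by omega)⟩ hm)
      ⟨h1.1.symm, key t (by omega), by show L.lev p ≤ L.lev (L.src y); omega, hz⟩

theorem Assoc.linkedIn' {p p' z z' : W} (h : L.Assoc p' z) (h' : L.Assoc p' z')
    (hl : L.lev p = L.lev p') (hp : p' ≠ p) (hz : z ≠ p) (hz' : z' ≠ p) :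
    LinkedIn L.graph {v | L.lev p ≤ L.lev v ∧ v ≠ p} z z' :=
  Relation.ReflTransGen.trans (LinkedIn.symm (h.linkedIn hl hp hz)) (h'.linkedIn hl hp hz')

/-- Every neighbour other than the parent and the lead that does not come from a source before `p`
is addressed through a dart entering after the first dart of `p`. -/
theorem Main.exists_dart {p p' v : W} (hp : Odd (L.lev p)) (hl : L.lev p = L.lev p')
    (hR : L.R p < L.R p') (hv : L.Main p' v) (hlate : L.Up p' v → L.R p < L.R (L.src v)) :
    ∃ x z t, L.Up x z ∧ L.Assoc p' z ∧ z ≠ p ∧ L.dm p < L.a x z ∧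
      L.addr v = L.pointAddr p' ++ L.R x :: t ∧
      ((x = v ∧ z = p' ∧ t = [] ∧ v ≠ L.par p') ∨ (L.Up p' v ∧ x = L.par (L.src v))) := by
  have hpp : p' ≠ p := by
    rintro rfl
    exact lt_irrefl _ hR
  have hp' : Odd (L.lev p') := hl ▸ hp
  rcases hv with ⟨h1, h2, h3⟩ | h1
  · refine ⟨v, p', [], h1, Or.inl rfl, hpp, ?_, addr_of_κ_eq hp' h1 h3,
      Or.inl ⟨rfl, rfl, rfl, h2⟩⟩
    rw [R_eq_dm hp, R_eq_dm hp'] at hR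
    exact hR.trans_le (dm_le h1)
  · have hs := hlate h1
    have e := lev_src (lev_lt_of_up h1)
    have e' := h1.2
    have hsl : L.lev (L.src v) = L.lev p := by omega
    refine ⟨L.par (L.src v), L.src v, [L.κ v, L.R v], up_par (hsl ▸ hp.pos),
      Or.inr ⟨v, h1, rfl⟩, ?_, ?_, addr_of_up hp' h1, Or.inr ⟨h1, rfl⟩⟩
    · intro he
      rw [he] at hs
      exact lt_irrefl _ hs
    · rwa [R_eq_dm hp, R_eq_dm (hsl ▸ hp : Odd (L.lev (L.src v)))] at hs

/-- If no upper neighbour of `p'` comes from a source before `p`, then only special pairs of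
neighbours of `p'` straddle a lower neighbour of `p`. -/
theorem straddle {p p' r u w : W} (hp : Odd (L.lev p)) (hl : L.lev p = L.lev p')
    (hb : L.pointAddr p = L.pointAddr p') (hR : L.R p < L.R p') (hr : L.Up r p)
    (hk : L.κ r = L.κ (L.top p)) (hu : L.Main p' u) (hw : L.Main p' w)
    (hu' : L.Up p' u → L.R p < L.R (L.src u)) (hw' : L.Up p' w → L.R p < L.R (L.src w))
    (h₁ : L.addr u < L.addr r) (h₂ : L.addr r < L.addr w) :
    (L.Up p' u ∧ L.R (L.par (L.src u)) < L.R (L.par p')) ∧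
    (L.Up p' w ∧ L.R (L.par (L.src w)) = L.R (L.par p')) := by
  have hp' : Odd (L.lev p') := hl ▸ hp
  have hpp : p' ≠ p := by
    rintro rfl
    exact lt_irrefl _ hR
  obtain ⟨x, z, t, hxz, hz, hzp, hd, ha, hc⟩ := hu.exists_dart hp hl hR hu'
  obtain ⟨x', z', t', hxz', hz', hzp', hd', ha', hc'⟩ := hw.exists_dart hp hl hR hw'
  have ar := addr_of_κ_eq hp hr hk
  have e := hz.lev_eq
  have e' := hz'.lev_eq
  have e₁ := hxz.2
  have e₂ := hxz'.2
  have e₃ := hr.2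
  rw [ha, ar, hb, List.append_lt_append_left_iff] at h₁
  rw [ha', ar, hb, List.append_lt_append_left_iff] at h₂
  simp only [List.cons_lt_cons_iff, List.not_lt_nil, and_false, or_false] at h₁ h₂
  have sep : ∀ {y s}, L.Up y s → L.Assoc p' s → s ≠ p → L.R r < L.R y → False := by
    intro y s hy hs hsp hlt
    have f := hs.lev_eq
    have f' := hy.2
    exact cross_vertex_set (B := {v | L.lev p ≤ L.lev v ∧ v ≠ p}) (fun v hv => hv.1)
      (fun hv => hv.2 rfl) (show z ∈ {v | L.lev p ≤ L.lev v ∧ v ≠ p} from ⟨by omega, hzp⟩) (hz.linkedIn' hs hl hpp hzp hsp) (by omega)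
      (by omega) (up_par hp.pos) hxz hr hy hd (L.isLayering.a_lt _ _ _ _ (by omega) h₁)
      (L.isLayering.a_lt _ _ _ _ (by omega) hlt)
  rcases h₂ with h₂ | ⟨h₂, h₃⟩
  · exact (sep hxz' hz' hzp' h₂).elim
  rcases hc' with ⟨-, -, rfl, -⟩ | ⟨hw₁, rfl⟩
  · simp at h₃
  have g₁ := R_par_src_le hw₁ hp'
  have g₂ : ¬ L.R r < L.R (L.par p') := sep (up_par hp'.pos) (Or.inl rfl) hpp
  refine ⟨?_, hw₁, by omega⟩
  rcases hc with ⟨rfl, rfl, -, hne⟩ | ⟨hu₁, rfl⟩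
  · have := R_par_lt hxz hne
    omega
  · exact ⟨hu₁, by omega⟩

/-- Pairs of main neighbours of two points in one block of one level hardly cross. -/
theorem main_cross {p p' e₁ e₂ u w : W} (hp : Odd (L.lev p)) (hl : L.lev p = L.lev p')
    (hb : L.pointAddr p = L.pointAddr p') (hR : L.R p < L.R p')
    (hs : ∀ y, L.Up p' y → L.src y ≠ p)
    (he₁ : L.Main p e₁) (he₂ : L.Main p e₂) (hu : L.Main p' u) (hw : L.Main p' w)
    (h₁ : L.addr e₁ < L.addr u) (h₂ : L.addr u < L.addr e₂)
    (h₃ : L.addr w < L.addr e₁ ∨ L.addr e₂ < L.addr w) :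
    L.Up e₂ p ∧ L.Up p' u ∧ L.Up p' w ∧ ∃ s t, s ∈ ({u, w} : Set W) ∧ t ∈ ({u, w} : Set W) ∧
      L.addr s < L.addr t ∧
      L.R (L.par (L.src s)) < L.R (L.par p') ∧ L.R (L.par (L.src t)) = L.R (L.par p') := by
  have hp' : Odd (L.lev p') := hl ▸ hp
  have hpp : p' ≠ p := by
    rintro rfl
    exact lt_irrefl _ hR
  have hlev : ∀ {y}, L.Up p' y → L.lev (L.src y) = L.lev p := by
    intro y hy
    have := lev_src (lev_lt_of_up hy)
    have := hy.2
    omega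
  have hcase : ∀ {y}, L.Up p' y → L.R (L.src y) < L.R p ∨ L.R p < L.R (L.src y) := by
    intro y hy
    exact lt_or_gt_of_ne fun h => hs y hy (L.isLayering.R_inj _ _ (hlev hy) h)
  have hlate : ∀ {y}, L.Main p' y → (L.Up p' y → L.R p < L.R (L.src y)) → ∀ {e}, L.Up p e →
      L.addr e < L.addr y := by
    intro y hy hy' e he
    rcases hy with ⟨k1, k2, k3⟩ | k1
    · rw [addr_of_up hp he, addr_of_κ_eq hp' k1 k3, hb, List.append_lt_append_left_iff]
      simp only [List.cons_lt_cons_iff, and_false, or_false, List.not_lt_nil]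
      have := R_par_src_le he hp
      have := R_par_le hl hp hR.le
      have := R_par_lt k1 k2
      omega
    · exact addr_lt_of_lt_src hp hl hb he k1 (hy' k1)
  have hu' : L.Up p' u → L.R p < L.R (L.src u) := by
    intro huu
    refine (hcase huu).resolve_left fun hc => ?_
    refine lt_asymm h₁ ?_
    rcases he₁ with ⟨k1, k2, k3⟩ | k1
    · rw [addr_of_up hp' huu, addr_of_κ_eq hp k1 k3, hb, List.append_lt_append_left_iff]
      simp only [List.cons_lt_cons_iff, List.not_lt_nil, and_false, or_false]
      exact (R_par_le (hlev huu) (hlev huu ▸ hp) hc.le).trans_lt (R_par_lt k1 k2)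
    · exact addr_lt_of_src_lt hp hl hb hR k1 huu hc fun h => h₁.ne (h ▸ rfl)
  rcases he₂ with ⟨k1, k2, k3⟩ | k1
  swap
  · exact (lt_asymm h₂ (hlate hu hu' k1)).elim
  have hall : ∀ {y}, L.Up p' y → L.R p < L.R (L.src y) := by
    intro y hy
    refine (hcase hy).resolve_left fun hc => ?_
    obtain ⟨x, z, t, hxz, hz, hzp, hd, ha, -⟩ := hu.exists_dart hp hl hR hu'
    have f := hz.lev_eq
    have f₁ := hxz.2
    have f₂ := k1.2
    rw [ha, addr_of_κ_eq hp k1 k3, hb, List.append_lt_append_left_iff] at h₂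
    simp only [List.cons_lt_cons_iff, List.not_lt_nil, and_false, or_false] at h₂
    have hsy : L.Assoc p' (L.src y) := Or.inr ⟨y, hy, rfl⟩
    rw [R_eq_dm hp, R_eq_dm (hlev hy ▸ hp)] at hc
    exact cross_set_vertex (B := {v | L.lev p ≤ L.lev v ∧ v ≠ p}) (fun v hv => hv.1)
      (fun hv => hv.2 rfl) (show L.src y ∈ {v | L.lev p ≤ L.lev v ∧ v ≠ p} from ⟨(hlev hy).ge, hs y hy⟩)
      (hsy.linkedIn' hz hl hpp (hs y hy) hzp) (hlev hy) (by omega) (up_par (hlev hy ▸ hp.pos))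
      (up_par hp.pos) hxz k1 hc hd (L.isLayering.a_lt _ _ _ _ (by omega) h₂)
  rcases h₃ with h₃ | h₃
  · rcases he₁ with ⟨m1, m2, m3⟩ | m1
    swap
    · exact (lt_asymm h₃ (hlate hw hall m1)).elim
    obtain ⟨⟨g1, g2⟩, g3, g4⟩ := straddle hp hl hb hR m1 m3 hw hu hall hu' h₃ h₁
    exact ⟨k1, g3, g1, w, u, by simp, by simp, h₃.trans h₁, g2, g4⟩
  · obtain ⟨⟨g1, g2⟩, g3, g4⟩ := straddle hp hl hb hR k1 k3 hu hw hu' hall h₂ h₃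
    exact ⟨k1, g1, g3, u, w, by simp, by simp, h₂.trans h₃, g2, g4⟩

end Layered

/-- The pairs related by `E` can be put on `n` pages without crossings for the order given by `f`. -/
def Paged {W α : Type*} [LT α] (f : W → α) (E : W → W → Prop) (n : ℕ) : Prop :=
  ∃ page : W → W → ℕ, (∀ u w, E u w → page u w < n) ∧
    ∀ u w u' w', E u w → E u' w' → page u w = page u' w' → f u < f u' → f u' < f w → f w < f w' →
      False

theorem Paged.of_label {W α Λ : Type*} [LT α] [Fintype Λ] {f : W → α} {E : W → W → Prop}
    (Good : Λ → W → W → Prop) (hE : ∀ u w, E u w → ∃ ℓ, Good ℓ u w)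
    (hG : ∀ ℓ u w u' w', Good ℓ u w → Good ℓ u' w' → f u < f u' → f u' < f w → f w < f w' → False) :
    Paged f E (Fintype.card Λ) := by
  classical
  refine ⟨fun u w => if h : E u w then (Fintype.equivFin Λ (hE u w h).choose).1 else 0, ?_, ?_⟩
  · intro u w h
    simp only [dif_pos h]
    exact Fin.isLt _
  · intro u w u' w' h h' hp
    simp only [dif_pos h, dif_pos h'] at hp
    have hl := (Fintype.equivFin Λ).injective (Fin.ext hp)
    exact hG _ u w u' w' (hE u w h).choose_spec (hl ▸ (hE u' w' h').choose_spec)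

theorem Paged.mono {W α : Type*} [LT α] {f : W → α} {E E' : W → W → Prop} {n : ℕ}
    (h : Paged f E n) (hE : ∀ u w, E' u w → E u w) : Paged f E' n := by
  obtain ⟨page, h1, h2⟩ := h
  exact ⟨page, fun u w h => h1 u w (hE u w h), fun u w u' w' h h' =>
    h2 u w u' w' (hE u w h) (hE u' w' h')⟩

theorem Paged.of_noncrossing {W α : Type*} [LT α] {f : W → α} {E : W → W → Prop}
    (hE : ∀ u w u' w', E u w → E u' w' → f u < f u' → f u' < f w → f w < f w' → False) :
    Paged f E 1 :=
  ⟨fun _ _ => 0, fun _ _ _ => Nat.one_pos, fun u w u' w' h h' _ => hE u w u' w' h h'⟩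

theorem Paged.or {W α : Type*} [LT α] {f : W → α} {E E' : W → W → Prop} {n n' : ℕ}
    (h : Paged f E n) (h' : Paged f E' n') : Paged f (fun u w => E u w ∨ E' u w) (n + n') := by
  classical
  obtain ⟨g, hg, hc⟩ := h
  obtain ⟨g', hg', hc'⟩ := h'
  refine ⟨fun u w => if E u w then g u w else n + g' u w, ?_, ?_⟩
  · intro u w hE
    by_cases h1 : E u w
    · have := hg u w h1
      simp only [if_pos h1]
      omega
    · have := hg' u w (hE.resolve_left h1)
      simp only [if_neg h1]
      omega
  · intro u w u' w' hE hE' hp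
    by_cases h1 : E u w <;> by_cases h2 : E u' w'
    · simp only [if_pos h1, if_pos h2] at hp
      exact hc u w u' w' h1 h2 hp
    · simp only [if_pos h1, if_neg h2] at hp
      have := hg u w h1
      omega
    · simp only [if_neg h1, if_pos h2] at hp
      have := hg u' w' h2
      omega
    · simp only [if_neg h1, if_neg h2] at hp
      exact hc' u w u' w' (hE.resolve_left h1) (hE'.resolve_left h2) (by omega)

theorem index_conflict {a b c d n : ℕ} (hab : a < b) (hbc : b < c) (hcd : c < d) (hd : d < n)
    (h : (a + c) % n / 2 = (b + d) % n / 2) : False := by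
  have key : ∀ x, x < 2 * n → x % n = x ∧ x < n ∨ x % n + n = x := by
    intro x hx
    by_cases hxn : x < n
    · exact Or.inl ⟨Nat.mod_eq_of_lt hxn, hxn⟩
    · rw [Nat.mod_eq_sub_mod (by omega), Nat.mod_eq_of_lt (by omega)]
      omega
  rcases key (a + c) (by omega) with h1 | h1 <;> rcases key (b + d) (by omega) with h2 | h2 <;> omega

namespace Layered

variable {W : Type*} (L : Layered W)

/-- The number of members of `A` addressed before `v`. -/
noncomputable def rank (A : Set W) (v : W) : ℕ := {z | z ∈ A ∧ L.addr z < L.addr v}.ncard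

/-- Upper neighbours of `p` addressed before its parent. -/
def early (p : W) : Set W := {y | L.Up p y ∧ L.R (L.par (L.src y)) < L.R (L.par p)}

/-- Upper neighbours of `p` addressed after its parent. -/
def late (p : W) : Set W := {y | L.Up p y ∧ L.R (L.par (L.src y)) = L.R (L.par p)}

variable {L} [Finite W]

theorem rank_lt_rank {A : Set W} {u v : W} (hu : u ∈ A) (h : L.addr u < L.addr v) :
    L.rank A u < L.rank A v := by
  refine Set.ncard_lt_ncard ⟨fun z hz => ⟨hz.1, hz.2.trans h⟩, fun hsub => ?_⟩ (Set.toFinite _)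
  exact lt_irrefl _ (hsub ⟨hu, h⟩ : u ∈ A ∧ L.addr u < L.addr u).2

theorem rank_lt_ncard {A : Set W} {v : W} (hv : v ∈ A) : L.rank A v < A.ncard := by
  refine Set.ncard_lt_ncard ⟨fun z hz => hz.1, fun hsub => ?_⟩ (Set.toFinite _)
  exact lt_irrefl _ (hsub hv : v ∈ A ∧ L.addr v < L.addr v).2

theorem ncard_main_lt {p : W} (hp : Odd (L.lev p)) :
    {v | L.Main p v}.ncard < {v | L.graph.Adj p v}.ncard := by
  refine Set.ncard_lt_ncard ⟨fun z hz => Main.adj hz, fun hsub => ?_⟩ (Set.toFinite _)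
  have hu : L.Up (L.par p) p := up_par hp.pos
  have h : L.Main p (L.par p) := hsub hu.1.symm
  rcases h with h | h
  · exact h.2.1 rfl
  · have := h.2
    have := hu.2
    omega

theorem ncard_early_add_ncard_late_le (p : W) :
    (L.early p).ncard + (L.late p).ncard ≤ {v | L.Main p v}.ncard := by
  rw [← Set.ncard_union_eq _ (Set.toFinite _) (Set.toFinite _)]
  · refine Set.ncard_le_ncard ?_ (Set.toFinite _)
    rintro v (hv | hv)
    · exact Or.inr hv.1
    · exact Or.inr hv.1
  · rw [Set.disjoint_left]
    intro v hv hv'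
    exact hv.2.ne hv'.2

theorem Main.addr_extends {p v : W} (hp : Odd (L.lev p)) (h : L.Main p v) :
    L.pointAddr p <+: L.addr v ∧ (L.addr v).length ≤ L.lev p + 3 := by
  rcases h with h | h
  · have e := h.1.2
    rw [length_addr (even_of_up_odd hp h.1), addr_of_κ_eq hp h.1 h.2.2]
    exact ⟨List.prefix_append _ _, by omega⟩
  · rw [length_addr (even_of_up hp h), addr_of_up hp h, h.2]
    exact ⟨List.prefix_append _ _, by omega⟩

/-- Crossing pairs of main neighbours of two points of one colour are of different kinds. -/
theorem group_cross {col : W → Fin 3}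
    (hcol : ∀ p p' y, L.Up p' y → L.src y = p → p ≠ p' → col p ≠ col p')
    {p p' u w u' w' : W} (hp : Odd (L.lev p)) (hp' : Odd (L.lev p')) (hne : p ≠ p')
    (hmod : L.lev p / 2 % 2 = L.lev p' / 2 % 2) (hc : col p = col p')
    (hu : L.Main p u) (hw : L.Main p w) (hu' : L.Main p' u') (hw' : L.Main p' w')
    (hk : (u ∈ L.early p ∧ w ∈ L.late p) ↔ (u' ∈ L.early p' ∧ w' ∈ L.late p'))
    (h₁ : L.addr u < L.addr u') (h₂ : L.addr u' < L.addr w) (h₃ : L.addr w < L.addr w') :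
    False := by
  obtain ⟨a₁, -⟩ := hu.addr_extends hp
  obtain ⟨a₂, b₂⟩ := hw.addr_extends hp
  obtain ⟨a₃, b₃⟩ := hu'.addr_extends hp'
  obtain ⟨a₄, -⟩ := hw'.addr_extends hp'
  have lb := length_pointAddr hp
  have lb' := length_pointAddr hp'
  have k₁ := List.IsPrefix.of_between a₁ a₂ h₁ h₂
  have k₂ := List.IsPrefix.of_between a₃ a₄ h₂ h₃
  have m₁ := k₁.length_le
  have m₂ := k₂.length_le
  have hl : L.lev p = L.lev p' := by
    obtain ⟨i, hi⟩ := hp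
    obtain ⟨i', hi'⟩ := hp'
    omega
  have hb : L.pointAddr p = L.pointAddr p' := List.IsPrefix.eq_of_length_eq k₁ (by omega) a₃
  have asym : ∀ {q v}, L.Up q v → L.Up v q → False := by
    intro q v h h'
    have := h.2
    have := h'.2
    omega
  have sorted : ∀ {q u w s t}, L.addr u < L.addr w → s ∈ ({u, w} : Set W) →
      t ∈ ({u, w} : Set W) → L.addr s < L.addr t → L.Up q u → L.Up q w →
      L.R (L.par (L.src s)) < L.R (L.par q) → L.R (L.par (L.src t)) = L.R (L.par q) →
      u ∈ L.early q ∧ w ∈ L.late q := by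
    intro q u w s t huw hs ht hst h1 h2 h3 h4
    rcases hs with rfl | rfl <;> rcases ht with rfl | rfl
    · exact (lt_irrefl _ hst).elim
    · exact ⟨⟨h1, h3⟩, h2, h4⟩
    · exact (lt_asymm huw hst).elim
    · exact (lt_irrefl _ hst).elim
  rcases lt_or_gt_of_ne fun h => hne (L.isLayering.R_inj _ _ hl h) with hR | hR
  · obtain ⟨g1, g2, g3, s, t, hs, ht, hst, g4, g5⟩ := main_cross hp hl hb hR
      (fun y hy hs => hcol p p' y hy hs hne hc) hu hw hu' hw' h₁ h₂ (Or.inr h₃)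
    exact asym (hk.2 (sorted (h₂.trans h₃) hs ht hst g2 g3 g4 g5)).2.1 g1
  · obtain ⟨g1, g2, g3, s, t, hs, ht, hst, g4, g5⟩ := main_cross hp' hl.symm hb.symm hR
      (fun y hy hs => hcol p' p y hy hs hne.symm hc.symm) hu' hw' hw hu h₂ h₃ (Or.inl h₁)
    rw [Set.pair_comm] at hs ht
    exact asym (hk.1 (sorted (h₁.trans h₂) hs ht hst g3 g2 g4 g5)).2.1 g1

variable (L)

theorem paged_beta : Paged L.addr (fun u w => ∃ p, Odd (L.lev p) ∧ u = L.par p ∧ w ∈ L.late p ∧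
    L.κ (L.par p) = L.κ (L.top p)) 1 := by
  refine Paged.of_noncrossing ?_
  rintro u w u' w' ⟨p, hp, rfl, hw, hk⟩ ⟨p', hp', rfl, hw', hk'⟩ h₁ h₂ h₃
  exact cross_beta hp hp' hk hk' hw.1 hw'.1 hw.2 hw'.2 h₁ h₂ h₃

theorem paged_low : Paged L.addr (fun u w => ∃ p, Odd (L.lev p) ∧ (u = L.par p ∨ w = L.par p) ∧
    L.Up u p ∧ L.Up w p ∧ L.κ u = L.κ (L.top p) ∧ L.κ w = L.κ (L.top p)) 1 := by
  refine Paged.of_noncrossing ?_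
  rintro u w u' w' ⟨p, hp, hx, hu, hw, ku, kw⟩ ⟨p', hp', hx', hu', hw', ku', kw'⟩ h₁ h₂ h₃
  refine cross_low hp hp' ?_ hu hw hu' hw' ku kw ku' kw' h₁ h₂ h₃
  rintro rfl
  rcases hx with rfl | rfl <;> rcases hx' with rfl | rfl
  · exact lt_irrefl _ h₁
  · exact lt_irrefl _ (h₁.trans (h₂.trans h₃))
  · exact lt_irrefl _ h₂
  · exact lt_irrefl _ h₃

theorem paged_gamma : Paged L.addr (fun u w => ∃ p, Odd (L.lev p) ∧ w = L.par p ∧ L.Up p u ∧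
    L.κ (L.par p) = L.κ (L.top p)) 2 := by
  refine Paged.of_label (Λ := Fin 2) (fun ℓ u w => ∃ p, Odd (L.lev p) ∧ w = L.par p ∧ L.Up p u ∧
    L.κ (L.par p) = L.κ (L.top p) ∧ L.lev p / 2 % 2 = ℓ) ?_ ?_
  · rintro u w ⟨p, hp, h1, h2, h3⟩
    exact ⟨⟨L.lev p / 2 % 2, Nat.mod_lt _ (by norm_num)⟩, p, hp, h1, h2, h3, rfl⟩
  · rintro ℓ u w u' w' ⟨p, hp, rfl, hu, hk, hm⟩ ⟨p', hp', rfl, hu', hk', hm'⟩ h₁ h₂ h₃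
    exact cross_gamma hp hp' (hm.trans hm'.symm) hk hk' hu hu' h₁ h₂ h₃

theorem paged_lead : Paged L.addr (fun u w => ∃ p, Odd (L.lev p) ∧ L.IsLead p u ∧
    L.graph.Adj p w ∧ w ≠ u) 6 := by
  refine Paged.of_label (Λ := Fin 3 × Fin 2) (fun ℓ u w => ∃ p, Odd (L.lev p) ∧ L.IsLead p u ∧
    L.graph.Adj p w ∧ w ≠ u ∧ L.lev p / 2 % 3 = ℓ.1 ∧ L.depth u % 2 = ℓ.2) ?_ ?_
  · rintro u w ⟨p, hp, h1, h2, h3⟩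
    exact ⟨(⟨L.lev p / 2 % 3, Nat.mod_lt _ (by norm_num)⟩,
      ⟨L.depth u % 2, Nat.mod_lt _ (by norm_num)⟩), p, hp, h1, h2, h3, rfl, rfl⟩
  · rintro ℓ u w u' w' ⟨p, hp, hu, hw, hn, hm, hd⟩ ⟨p', hp', hu', hw', hn', hm', hd'⟩ h₁ h₂ h₃
    exact cross_lead hp hp' hu hu' hw hw' hn hn' (hm.trans hm'.symm) (hd.trans hd'.symm) h₁ h₂ h₃

theorem paged_special {k : ℕ}
    (hk : ∀ p, Odd (L.lev p) → {v | L.graph.Adj p v}.ncard ≤ k) :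
    Paged L.addr (fun u w => ∃ p, Odd (L.lev p) ∧ u ∈ L.early p ∧
    w ∈ L.late p) (6 * ((k - 1) / 2)) := by
  obtain ⟨col, hcol⟩ := L.exists_color
  have := Paged.of_label (f := L.addr) (Λ := Fin 2 × Fin 3 × Fin ((k - 1) / 2))
    (E := fun u w => ∃ p, Odd (L.lev p) ∧ u ∈ L.early p ∧ w ∈ L.late p)
    (fun ℓ u w => ∃ p, Odd (L.lev p) ∧ u ∈ L.early p ∧ w ∈ L.late p ∧
      L.lev p / 2 % 2 = ℓ.1 ∧ col p = ℓ.2.1 ∧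
      (L.rank (L.early p) u + L.rank (L.late p) w) / 2 = ℓ.2.2) ?_ ?_
  · convert this using 1
    simp
    omega
  · rintro u w ⟨p, hp, h1, h2⟩
    have l1 := rank_lt_ncard (L := L) h1
    have l2 := rank_lt_ncard (L := L) h2
    have l3 := ncard_early_add_ncard_late_le (L := L) p
    have l4 := ncard_main_lt hp
    have l5 := hk p hp
    exact ⟨(⟨L.lev p / 2 % 2, Nat.mod_lt _ (by norm_num)⟩, col p,
      ⟨(L.rank (L.early p) u + L.rank (L.late p) w) / 2, by omega⟩), p, hp, h1, h2, rfl, rfl, rfl⟩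
  · rintro ℓ u w u' w' ⟨p, hp, hu, hw, hm, hc, hi⟩ ⟨p', hp', hu', hw', hm', hc', hi'⟩ h₁ h₂ h₃
    by_cases hne : p = p'
    · subst hne
      have := rank_lt_rank hu h₁
      have := rank_lt_rank hw h₃
      omega
    · exact group_cross hcol hp hp' hne (hm.trans hm'.symm) (hc.trans hc'.symm) (Or.inr hu.1)
        (Or.inr hw.1) (Or.inr hu'.1) (Or.inr hw'.1) (iff_of_true ⟨hu, hw⟩ ⟨hu', hw'⟩) h₁ h₂ h₃

theorem paged_main {k : ℕ}
    (hk : ∀ p, Odd (L.lev p) → {v | L.graph.Adj p v}.ncard ≤ k) :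
    Paged L.addr (fun u w => ∃ p, Odd (L.lev p) ∧ L.Main p u ∧ L.Main p w ∧
    ¬ (u ∈ L.early p ∧ w ∈ L.late p)) (6 * (k / 2)) := by
  obtain ⟨col, hcol⟩ := L.exists_color
  have := Paged.of_label (f := L.addr) (Λ := Fin 2 × Fin 3 × Fin (k / 2))
    (E := fun u w => ∃ p, Odd (L.lev p) ∧ L.Main p u ∧ L.Main p w ∧
      ¬ (u ∈ L.early p ∧ w ∈ L.late p))
    (fun ℓ u w => ∃ p, Odd (L.lev p) ∧ L.Main p u ∧ L.Main p w ∧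
      ¬ (u ∈ L.early p ∧ w ∈ L.late p) ∧ L.lev p / 2 % 2 = ℓ.1 ∧ col p = ℓ.2.1 ∧
      (L.rank {v | L.Main p v} u + L.rank {v | L.Main p v} w) % (k - 1) / 2 = ℓ.2.2) ?_ ?_
  · convert this using 1
    simp
    omega
  · rintro u w ⟨p, hp, h1, h2, h3⟩
    have l1 := rank_lt_ncard (L := L) (A := {v | L.Main p v}) h1
    have l4 := ncard_main_lt hp
    have l5 := hk p hp
    have l6 := Nat.mod_lt (L.rank {v | L.Main p v} u + L.rank {v | L.Main p v} w)
      (show 0 < k - 1 by omega)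
    exact ⟨(⟨L.lev p / 2 % 2, Nat.mod_lt _ (by norm_num)⟩, col p, ⟨_, by omega⟩), p, hp, h1, h2, h3,
      rfl, rfl, rfl⟩
  · rintro ℓ u w u' w' ⟨p, hp, hu, hw, hs, hm, hc, hi⟩ ⟨p', hp', hu', hw', hs', hm', hc', hi'⟩
      h₁ h₂ h₃
    by_cases hne : p = p'
    · subst hne
      have l1 := rank_lt_ncard (L := L) (A := {v | L.Main p v}) hw'
      have l4 := ncard_main_lt hp
      have l5 := hk p hp
      exact index_conflict (rank_lt_rank (A := {v | L.Main p v}) hu h₁)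
        (rank_lt_rank (A := {v | L.Main p v}) hu' h₂) (rank_lt_rank (A := {v | L.Main p v}) hw h₃)
        (by omega) (hi.trans hi'.symm)
    · exact group_cross hcol hp hp' hne (hm.trans hm'.symm) (hc.trans hc'.symm) hu hw hu' hw'
        (iff_of_false hs hs') h₁ h₂ h₃

/-- The pairs of vertices with a common neighbour on an odd level fit on few pages. -/
theorem paged {k : ℕ}
    (hk : ∀ p, Odd (L.lev p) → {v | L.graph.Adj p v}.ncard ≤ k) :
    Paged L.addr (fun u w => ∃ p, Odd (L.lev p) ∧ L.graph.Adj p u ∧ L.graph.Adj p w ∧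
    L.addr u < L.addr w) (10 + 6 * ((k - 1) / 2) + 6 * (k / 2)) := by
  refine Paged.mono (((((L.paged_beta.or L.paged_low).or L.paged_gamma).or L.paged_lead).or
    (L.paged_special hk)).or (L.paged_main hk)) ?_
  rintro u w ⟨p, hp, hu, hw, hlt⟩
  by_cases hlu : L.IsLead p u
  · exact Or.inl (Or.inl (Or.inr ⟨p, hp, hlu, hw, fun he => hlt.ne (he ▸ rfl)⟩))
  by_cases hlw : L.IsLead p w
  · exact (lt_asymm hlt (hlw.addr_lt hp hu fun he => hlt.ne (he ▸ rfl))).elim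
  have hκu : L.Up u p → L.κ u = L.κ (L.top p) := fun h => by
    by_contra hc
    exact hlu ⟨h, hc⟩
  have hκw : L.Up w p → L.κ w = L.κ (L.top p) := fun h => by
    by_contra hc
    exact hlw ⟨h, hc⟩
  have hx : L.Up (L.par p) p := up_par hp.pos
  by_cases hux : u = L.par p
  · have hup : L.Up u p := hux ▸ hx
    rcases up_of_adj hw with h | h
    · refine Or.inl (Or.inl (Or.inl (Or.inl (Or.inl ⟨p, hp, hux, ⟨h, ?_⟩, hux ▸ hκu hup⟩))))
      have := R_par_src_le h hp
      rw [addr_of_κ_eq hp hup (hκu hup), addr_of_up hp h, List.append_lt_append_left_iff, hux] at hlt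
      simp only [List.cons_lt_cons_iff] at hlt
      omega
    · exact Or.inl (Or.inl (Or.inl (Or.inl (Or.inr
        ⟨p, hp, Or.inl hux, hup, h, hκu hup, hκw h⟩))))
  by_cases hwx : w = L.par p
  · have hup : L.Up w p := hwx ▸ hx
    rcases up_of_adj hu with h | h
    · exact Or.inl (Or.inl (Or.inl (Or.inr ⟨p, hp, hwx, h, hwx ▸ hκw hup⟩)))
    · exact Or.inl (Or.inl (Or.inl (Or.inl (Or.inr
        ⟨p, hp, Or.inr hwx, h, hup, hκu h, hκw hup⟩))))
  have hmain : ∀ {v}, L.graph.Adj p v → v ≠ L.par p → (L.Up v p → L.κ v = L.κ (L.top p)) →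
      L.Main p v := by
    intro v hv hne hκ
    rcases up_of_adj hv with h | h
    · exact Or.inr h
    · exact Or.inl ⟨h, hne, hκ h⟩
  by_cases hs : u ∈ L.early p ∧ w ∈ L.late p
  · exact Or.inl (Or.inr ⟨p, hp, hs.1, hs.2⟩)
  · exact Or.inr ⟨p, hp, hmain hu hux hκu, hmain hw hwx hκw, hs⟩

end Layered

theorem exists_embedding_nat {V α : Type*} [Finite V] [LinearOrder α] (f : V → α)
    (hf : Function.Injective f) : ∃ ord : V ↪ ℕ, ∀ a b, ord a < ord b ↔ f a < f b := by
  have hlt : ∀ a b, f a < f b → {z | f z < f a}.ncard < {z | f z < f b}.ncard := by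
    intro a b h
    refine Set.ncard_lt_ncard ⟨fun z hz => lt_trans hz h, fun hsub => ?_⟩ (Set.toFinite _)
    exact lt_irrefl _ (hsub h : f a < f a)
  refine ⟨⟨fun a => {z | f z < f a}.ncard, fun a b h => ?_⟩, fun a b => ⟨fun h => ?_, hlt a b⟩⟩
  · by_contra hne
    rcases lt_or_gt_of_ne (hf.ne hne) with h' | h'
    · exact (hlt a b h').ne h
    · exact (hlt b a h').ne h.symm
  · by_contra hc
    rcases (not_lt.1 hc).lt_or_eq with h' | h'
    · exact lt_asymm h (hlt b a h')
    · exact lt_irrefl _ (hf h' ▸ h)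

theorem bookThickness_le_of_paged {V W α : Type*} [Finite V] [LinearOrder α] {G : SimpleGraph V}
    {f : W → α} {e : V → W} (he : Function.Injective (f ∘ e)) {E : W → W → Prop} {n : ℕ}
    (h : Paged f E n) (hE : ∀ a b, G.Adj a b → f (e a) < f (e b) → E (e a) (e b)) :
    bookThickness G ≤ n := by
  obtain ⟨page, h1, h2⟩ := h
  obtain ⟨ord, hord⟩ := exists_embedding_nat _ he
  refine Nat.sInf_le ⟨ord, fun a b => if ord a < ord b then page (e a) (e b) else page (e b) (e a),
    ?_, ?_, ?_⟩
  · intro a b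
    rcases lt_trichotomy (ord a) (ord b) with h | h | h
    · simp [h, h.not_gt]
    · simp [ord.injective h]
    · simp [h, h.not_gt]
  · intro a b hab
    rcases lt_or_gt_of_ne (ord.injective.ne hab.ne) with h | h
    · simpa [h] using h1 _ _ (hE a b hab ((hord a b).1 h))
    · simpa [h.not_gt] using h1 _ _ (hE b a hab.symm ((hord b a).1 h))
  · rintro a b c d hab hcd hp ⟨hac, hcb, hbd⟩
    simp only [if_pos (hac.trans hcb), if_pos (hcb.trans hbd)] at hp
    exact h2 _ _ _ _ (hE a b hab ((hord a b).1 (hac.trans hcb)))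
      (hE c d hcd ((hord c d).1 (hcb.trans hbd))) hp ((hord a c).1 hac) ((hord c b).1 hcb)
      ((hord b d).1 hbd)

/-- The book thickness of every `k`-map graph is at most `6k + 5`. -/
theorem bookThickness_kmap {V : Type*} [Fintype V] (G : SimpleGraph V) (k : ℕ)
    (hG : IsKMapGraph G k) : bookThickness G ≤ 6 * k + 5 := by
  obtain ⟨P, _, H, ⟨pos, hpos⟩, hV, hP, hk, hadj⟩ := hG
  rcases Nat.eq_zero_or_pos k with rfl | hk0
  · refine le_trans (bookThickness_le_of_paged (n := 0) (f := id)
      (e := (Fintype.equivFin V : V → Fin (Fintype.card V))) (E := fun _ _ => False)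
      (Fintype.equivFin V).injective ⟨fun _ _ => 0, by simp, by simp⟩ ?_) (Nat.zero_le _)
    intro a b hab _
    obtain ⟨-, p, hp, -⟩ := (hadj a b).1 hab
    have := (Set.ncard_eq_zero (Set.toFinite _)).1 (Nat.le_zero.1 (hk p))
    exact (Set.eq_empty_iff_forall_notMem.1 this a hp).elim
  obtain ⟨lev, hl, hev⟩ := exists_isLeveling H (Set.range Sum.inl) (by
    rintro (a | p) (b | q) h
    · exact (hV a b h).elim
    · simp
    · simp
    · exact (hP p q h).elim)
  obtain ⟨par, a, R, hlay⟩ := hpos.exists_layering hl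
  let L : Layered (V ⊕ P) := ⟨H, lev, par, a, R, hlay⟩
  have hodd : ∀ {v p}, H.Adj (Sum.inl v) (Sum.inr p) → Odd (lev (Sum.inr p)) := by
    intro v p h
    have h1 := hev (Sum.inl v) ⟨v, rfl⟩
    rcases hl.adj _ _ h with h2 | h2
    · rw [h2]
      exact h1.add_one
    · rw [h2] at h1
      exact Nat.not_even_iff_odd.1 (Nat.even_add_one.1 h1)
  have hcard : ∀ p, Odd (L.lev p) → {v | L.graph.Adj p v}.ncard ≤ k := by
    rintro (v | p) hp
    · exact (Nat.not_even_iff_odd.2 hp (hev _ ⟨v, rfl⟩)).elim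
    · refine le_trans ?_ (hk p)
      rw [← Set.ncard_image_of_injective _ (Sum.inl_injective (α := V) (β := P))]
      refine Set.ncard_le_ncard ?_ (Set.toFinite _)
      rintro (w | q) h
      · exact ⟨w, (show H.Adj _ _ from h).symm, rfl⟩
      · exact (hP p q h).elim
  have hinj : Function.Injective (L.addr ∘ (Sum.inl : V → V ⊕ P)) := by
    intro a b h
    exact Sum.inl_injective (Layered.addr_injOn (hev _ ⟨a, rfl⟩) (hev _ ⟨b, rfl⟩) h)
  refine le_trans (bookThickness_le_of_paged hinj (L.paged hcard) ?_) (by omega)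
  intro a b hab hlt
  obtain ⟨-, p, h1, h2⟩ := (hadj a b).1 hab
  exact ⟨Sum.inr p, hodd h1, h1.symm, h2.symm, hlt⟩
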